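/- Let n ≥ 2 and fix exponents p₀, …, p_n ∈ (1, ∞) with ∑_{j=0}^{n} 1/p_j = 1, and suppose that for every standard smooth symbol m′ on ℝⁿ there is a constant c(m′) with |Λ_{m′}(F₀, …, F_n)| ≤ c(m′) ∏_{j=0}^{n} ‖F_j‖_{p_j} for all Schwartz F_j. Let ψ be a smooth function supported in [−2, −1/2] ∪ [1/2, 2] and let φ be a smooth function supported in [−2^{−ℓ₀+1}, 2^{−ℓ₀+1}] with ℓ₀ ≥ 100 log n; write g_k(η) = g(2^{−k}η). Then the multilinear form Λ_m associated with the symbol m(ξ) = ∑_{k ∈ ℤ} μ_n(ξ) ψ_k(ξ₁) φ_k(ξ₂) ⋯ φ_k(ξ_n) satisfies |Λ_m(F₀, …, F_n)| ≤ c ∏_{j=0}^{n} ‖F_j‖_{p_j} for some finite constant c and all Schwartz functions F₀, …, F_n on ℝⁿ. -/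

import Mathlib

open MeasureTheory

/-- The symbol `μ_n` in dimension `n = m + 1`:
`μ_n(ξ) = ∫_{[0,1]^{n-1}} sgn(α₁ξ₁ + ⋯ + α_{n-1}ξ_{n-1} + ξ_n) dα`. -/
noncomputable def muSymbol (m : ℕ) (ξ : Fin (m + 1) → ℝ) : ℝ :=
  ∫ α in (Set.univ.pi fun _ : Fin m => Set.Icc (0:ℝ) 1),
    Real.sign ((∑ j : Fin m, α j * ξ j.castSucc) + ξ (Fin.last m))

/-- The Fourier transform `F̂(ξ) = ∫_{ℝⁿ} e^{-2πi x·ξ} F(x) dx` on `ℝⁿ`. -/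
noncomputable def fourierT (n : ℕ) (F : (Fin n → ℝ) → ℂ) (ξ : Fin n → ℝ) : ℂ :=
  ∫ x : Fin n → ℝ,
    Complex.exp (((-2 * Real.pi * ∑ j, x j * ξ j : ℝ) : ℂ) * Complex.I) * F x

/-- The multilinear form `Λ_m` associated to a symbol `m` on `ℝⁿ`. -/
noncomputable def formM (n : ℕ) (m : (Fin n → ℝ) → ℂ) (F : ℕ → (Fin n → ℝ) → ℂ) : ℂ :=
  ∫ τ : Fin n → Fin n → ℝ,
    fourierT n (F 0) (-(∑ j, τ j)) *
      (∏ j : Fin n, fourierT n (F (j.1 + 1)) (τ j)) *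
      m (fun j => τ j j)

/-- A bounded function `m ∈ C^∞(ℝⁿ ∖ {0})` is a standard smooth symbol if all its
derivatives satisfy `|∂^α m(ξ)| ≤ c_α |ξ|^{-|α|}` away from the origin. -/
def IsStandardSymbol (n : ℕ) (m : (Fin n → ℝ) → ℂ) : Prop :=
  (∃ C : ℝ, ∀ ξ, ‖m ξ‖ ≤ C) ∧
  ContDiffOn ℝ (⊤ : ℕ∞) m {(0 : Fin n → ℝ)}ᶜ ∧
  ∀ k : ℕ, ∃ c : ℝ, 0 < c ∧ ∀ ξ : Fin n → ℝ, ξ ≠ 0 →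
    ‖iteratedFDerivWithin ℝ k m {(0 : Fin n → ℝ)}ᶜ ξ‖ ≤ c * ‖ξ‖ ^ (-(k : ℝ))

section Aux
open FourierTransform

/-! ### Calderón–Zygmund theory on the line -/

/-- Dyadic interval. -/
def dyI (q : ℤ × ℤ) : Set ℝ := Set.Ico ((q.2 : ℝ) * 2 ^ q.1) (((q.2 : ℝ) + 1) * 2 ^ q.1)

lemma dyI_meas (q : ℤ × ℤ) : MeasurableSet (dyI q) := measurableSet_Ico

lemma dyI_vol (q : ℤ × ℤ) : volume (dyI q) = ENNReal.ofReal (2 ^ q.1) := by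
  rw [dyI, Real.volume_Ico]; congr 1; ring

lemma dyI_nest {q r : ℤ × ℤ} {x : ℝ} (hq : x ∈ dyI q) (hr : x ∈ dyI r) (h : q.1 ≤ r.1) :
    dyI q ⊆ dyI r := by
  obtain ⟨k, m⟩ := q
  obtain ⟨k', m'⟩ := r
  simp only at h
  obtain ⟨j, rfl⟩ := Int.le.dest h
  simp only [dyI, Set.mem_Ico] at hq hr
  have hk : (0:ℝ) < 2 ^ k := by positivity
  have e : (2:ℝ) ^ (k + (j:ℤ)) = 2 ^ j * 2 ^ k := by
    rw [zpow_add₀ (by norm_num), zpow_natCast, mul_comm]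
  rw [e] at hr
  have h1 : (m:ℝ) < ((m':ℝ)+1) * 2 ^ j := by
    have : (m:ℝ) * 2 ^ k < (((m':ℝ)+1) * 2 ^ j) * 2 ^ k := by nlinarith [hq.1, hr.2]
    exact lt_of_mul_lt_mul_right this hk.le
  have h2 : (m':ℝ) * 2 ^ j < (m:ℝ) + 1 := by
    have : ((m':ℝ) * 2 ^ j) * 2 ^ k < ((m:ℝ)+1) * 2 ^ k := by nlinarith [hq.2, hr.1]
    exact lt_of_mul_lt_mul_right this hk.le
  have h1' : m + 1 ≤ (m'+1) * 2 ^ j := by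
    have : m < (m'+1) * 2 ^ j := by exact_mod_cast h1
    omega
  have h2' : m' * 2 ^ j ≤ m := by
    have : m' * 2 ^ j < m + 1 := by exact_mod_cast h2
    omega
  have h1r : (m:ℝ) + 1 ≤ ((m':ℝ)+1) * 2 ^ j := by exact_mod_cast h1'
  have h2r : (m':ℝ) * 2 ^ j ≤ m := by exact_mod_cast h2'
  intro y hy
  simp only [dyI, Set.mem_Ico] at hy ⊢
  rw [e]
  constructor
  · nlinarith [hy.1]
  · nlinarith [hy.2]

lemma dyI_exists (k : ℤ) (x : ℝ) : x ∈ dyI (k, ⌊x / 2 ^ k⌋) := by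
  have hk : (0:ℝ) < 2 ^ k := by positivity
  simp only [dyI, Set.mem_Ico]
  constructor
  · rw [← le_div_iff₀ hk]; exact Int.floor_le _
  · rw [← div_lt_iff₀ hk]; exact Int.lt_floor_add_one _

lemma dyI_unique {q r : ℤ × ℤ} {x : ℝ} (hq : x ∈ dyI q) (hr : x ∈ dyI r) (h : q.1 = r.1) :
    q = r := by
  obtain ⟨k, m⟩ := q
  obtain ⟨k', m'⟩ := r
  simp only at h
  subst h
  simp only [dyI, Set.mem_Ico] at hq hr
  have hk : (0:ℝ) < 2 ^ k := by positivity
  have h1 : (m:ℝ) < m' + 1 := lt_of_mul_lt_mul_right (hq.1.trans_lt hr.2) hk.le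
  have h2 : (m':ℝ) < m + 1 := lt_of_mul_lt_mul_right (hr.1.trans_lt hq.2) hk.le
  have h1' : m < m' + 1 := by exact_mod_cast h1
  have h2' : m' < m + 1 := by exact_mod_cast h2
  have : m = m' := by omega
  rw [this]

/-- Selected (maximal) dyadic intervals. -/
def czSel (f : ℝ → ℂ) (t : ℝ) : Set (ℤ × ℤ) :=
  {q | t * 2 ^ q.1 < ∫ x in dyI q, ‖f x‖ ∧
    ∀ r : ℤ × ℤ, q.1 < r.1 → dyI q ⊆ dyI r → ∫ x in dyI r, ‖f x‖ ≤ t * 2 ^ r.1}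

def czOm (f : ℝ → ℂ) (t : ℝ) : Set ℝ := ⋃ q : czSel f t, dyI q.1

lemma czOm_meas (f : ℝ → ℂ) (t : ℝ) : MeasurableSet (czOm f t) :=
  MeasurableSet.iUnion fun q => dyI_meas _

lemma czSel_unique {f : ℝ → ℂ} {t : ℝ} {q r : ℤ × ℤ} (hq : q ∈ czSel f t) (hr : r ∈ czSel f t)
    {x : ℝ} (h1 : x ∈ dyI q) (h2 : x ∈ dyI r) : q = r := by
  rcases lt_trichotomy q.1 r.1 with h | h | h
  · exact absurd hr.1 (not_lt.mpr (hq.2 r h (dyI_nest h1 h2 h.le)))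
  · exact dyI_unique h1 h2 h
  · exact absurd hq.1 (not_lt.mpr (hr.2 q h (dyI_nest h2 h1 h.le)))

lemma czSel_disj (f : ℝ → ℂ) (t : ℝ) :
    Pairwise (Function.onFun Disjoint fun q : czSel f t => dyI q.1) := by
  intro q r hqr
  rw [Function.onFun, Set.disjoint_left]
  intro x h1 h2
  exact hqr (Subtype.ext (czSel_unique q.2 r.2 h1 h2))

lemma czSel_upper {f : ℝ → ℂ} {t : ℝ} {q : ℤ × ℤ} (hq : q ∈ czSel f t) :
    ∫ x in dyI q, ‖f x‖ ≤ 2 * t * 2 ^ q.1 ∨ ¬ Integrable f := by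
  by_cases hf : Integrable f
  swap
  · exact Or.inr hf
  left
  have hx : ((q.2:ℝ) * 2 ^ q.1) ∈ dyI q := by
    have hk : (0:ℝ) < 2 ^ q.1 := by positivity
    simp only [dyI, Set.mem_Ico]; constructor <;> nlinarith
  have h := dyI_exists (q.1 + 1) ((q.2:ℝ) * 2 ^ q.1)
  have hs := dyI_nest hx h (by simp)
  have := hq.2 _ (by simp) hs
  calc ∫ x in dyI q, ‖f x‖ ≤ ∫ x in dyI (q.1 + 1, ⌊((q.2:ℝ) * 2 ^ q.1) / 2 ^ (q.1+1)⌋), ‖f x‖ :=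
        setIntegral_mono_set hf.norm.integrableOn (Filter.Eventually.of_forall fun x => norm_nonneg _)
          (Filter.Eventually.of_forall hs)
    _ ≤ _ := this
    _ = 2 * t * 2 ^ q.1 := by
        simp only; rw [zpow_add₀ (by norm_num)]; norm_num; ring

/-- Off the exceptional set, `f` is small. -/
lemma cz_off {f : ℝ → ℂ} (hc : Continuous f) (hf : Integrable f) {t : ℝ} (ht : 0 < t) {x : ℝ}
    (hx : x ∉ czOm f t) : ‖f x‖ ≤ t := by
  have key : ∀ k : ℤ, ∫ y in dyI (k, ⌊x / 2 ^ k⌋), ‖f y‖ ≤ t * 2 ^ k := by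
    intro k
    by_contra hcon
    push Not at hcon
    obtain ⟨b, hb⟩ : ∃ b : ℤ, ∀ z : ℤ, t * 2 ^ z < ∫ y in dyI (z, ⌊x / 2 ^ z⌋), ‖f y‖ → z ≤ b := by
      obtain ⟨N, hN⟩ := pow_unbounded_of_one_lt ((∫ y, ‖f y‖) / t) (one_lt_two (α := ℝ))
      refine ⟨N, fun z hz => ?_⟩
      by_contra hzN
      push Not at hzN
      have h1 : ∫ y in dyI (z, ⌊x / 2 ^ z⌋), ‖f y‖ ≤ ∫ y, ‖f y‖ :=
        setIntegral_le_integral hf.norm (Filter.Eventually.of_forall fun x => norm_nonneg _)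
      have h2 : (2:ℝ) ^ N ≤ 2 ^ z := by
        rw [← zpow_natCast]; exact zpow_le_zpow_right₀ (by norm_num) hzN.le
      rw [div_lt_iff₀ ht] at hN
      nlinarith
    obtain ⟨K, hK, hKmax⟩ := Int.exists_greatest_of_bdd
      (P := fun z => t * 2 ^ z < ∫ y in dyI (z, ⌊x / 2 ^ z⌋), ‖f y‖) ⟨b, hb⟩ ⟨k, hcon⟩
    apply hx
    refine Set.mem_iUnion.mpr ⟨⟨(K, ⌊x / 2 ^ K⌋), hK, ?_⟩, dyI_exists K x⟩
    intro r hr hsub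
    by_contra h
    push Not at h
    have hxr : x ∈ dyI r := hsub (dyI_exists K x)
    have : r = (r.1, ⌊x / 2 ^ r.1⌋) := dyI_unique hxr (dyI_exists r.1 x) rfl
    rw [this] at h
    have := hKmax r.1 h
    simp only at hr
    omega
  by_contra hcon
  push Not at hcon
  have hnb : ∀ᶠ y in nhds x, t < ‖f y‖ := (hc.norm.tendsto x).eventually (lt_mem_nhds hcon)
  obtain ⟨ε, hε, hball⟩ := Metric.eventually_nhds_iff.mp hnb
  obtain ⟨N, hN⟩ := exists_pow_lt_of_lt_one hε (show (1/2:ℝ) < 1 by norm_num)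
  have h2 : (2:ℝ) ^ (-(N:ℤ)) < ε := by
    rw [zpow_neg, zpow_natCast, ← inv_pow]; simpa using hN
  set q : ℤ × ℤ := (-(N:ℤ), ⌊x / 2 ^ (-(N:ℤ))⌋) with hq
  have hxq : x ∈ dyI q := dyI_exists _ x
  have hsub : ∀ y ∈ dyI q, t < ‖f y‖ := by
    intro y hy
    apply hball
    simp only [dyI, Set.mem_Ico] at hy hxq
    rw [Real.dist_eq, abs_lt]
    have : q.1 = -(N:ℤ) := rfl
    rw [this] at hy hxq
    constructor <;> nlinarith [hy.1, hy.2, hxq.1, hxq.2]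
  have h3 := key (-(N:ℤ))
  have hfin : volume (dyI q) ≠ ⊤ := by rw [dyI_vol]; exact ENNReal.ofReal_ne_top
  have hpos : 0 < volume (dyI q) := by
    rw [dyI_vol]; exact ENNReal.ofReal_pos.mpr (by positivity)
  have h4 : ∫ y in dyI q, (‖f y‖ - t) ≤ 0 := by
    rw [integral_sub hf.norm.integrableOn (integrableOn_const hfin)]
    rw [setIntegral_const, Measure.real, dyI_vol, ENNReal.toReal_ofReal (by positivity)]
    simp only [smul_eq_mul]
    have : q.1 = -(N:ℤ) := rfl
    rw [this]
    linarith
  have h5 : 0 < ∫ y in dyI q, (‖f y‖ - t) := by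
    rw [setIntegral_pos_iff_support_of_nonneg_ae]
    · refine lt_of_lt_of_le hpos (measure_mono ?_)
      intro y hy
      refine ⟨?_, hy⟩
      simp only [Function.mem_support]
      linarith [hsub y hy]
    · exact (ae_restrict_iff' (dyI_meas q)).mpr
        (Filter.Eventually.of_forall fun y hy => by simp; exact (hsub y hy).le)
    · exact hf.norm.integrableOn.sub (integrableOn_const hfin)
  linarith

lemma czOm_vol (f : ℝ → ℂ) (t : ℝ) : volume (czOm f t) = ∑' q : czSel f t, ENNReal.ofReal (2 ^ q.1.1) := by
  rw [czOm, measure_iUnion (czSel_disj f t) (fun q => dyI_meas _)]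
  simp_rw [dyI_vol]

lemma cz_vol_le {f : ℝ → ℂ} (hc : Continuous f) (hf : Integrable f) {t : ℝ} (ht : 0 < t) :
    ENNReal.ofReal (t / 2) * volume (czOm f t) ≤ ∫⁻ x in {x | t / 2 < ‖f x‖}, ‖f x‖ₑ := by
  rw [czOm_vol, ← ENNReal.tsum_mul_left]
  set S := {x | t / 2 < ‖f x‖} with hS
  have hSm : MeasurableSet S := measurableSet_lt measurable_const hc.norm.measurable
  have key : ∀ q : czSel f t, ENNReal.ofReal (t / 2) * ENNReal.ofReal (2 ^ q.1.1) ≤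
      ∫⁻ x in dyI q.1, S.indicator (fun x => ‖f x‖ₑ) x := by
    intro q
    have h1 := q.2.1
    have hsplit : ∫⁻ x in dyI q.1, ‖f x‖ₑ ≤
        (∫⁻ x in dyI q.1, S.indicator (fun x => ‖f x‖ₑ) x) +
          ENNReal.ofReal (t/2) * ENNReal.ofReal (2 ^ q.1.1) := by
      rw [← dyI_vol, ← setLIntegral_const, ← lintegral_add_left]
      · apply lintegral_mono
        intro x
        by_cases hx : x ∈ S
        · simp [hx]
        · simp only [hx, not_false_eq_true, Set.indicator_of_notMem, zero_add]
          rw [← ofReal_norm]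
          apply ENNReal.ofReal_le_ofReal
          simpa [hS] using hx
      · exact (hc.measurable.enorm).indicator hSm
    have h2 : ENNReal.ofReal (t * 2 ^ q.1.1) ≤ ∫⁻ x in dyI q.1, ‖f x‖ₑ := by
      rw [← ofReal_integral_norm_eq_lintegral_enorm hf.integrableOn]
      exact ENNReal.ofReal_le_ofReal h1.le
    have h3 : ENNReal.ofReal (t * 2 ^ q.1.1) = ENNReal.ofReal (t/2) * ENNReal.ofReal (2 ^ q.1.1)
        + ENNReal.ofReal (t/2) * ENNReal.ofReal (2 ^ q.1.1) := by
      rw [← ENNReal.ofReal_mul (by positivity), ← ENNReal.ofReal_add (by positivity) (by positivity)]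
      congr 1; ring
    rw [h3] at h2
    have h4 := h2.trans hsplit
    exact (ENNReal.add_le_add_iff_right (by
      exact ENNReal.mul_ne_top ENNReal.ofReal_ne_top ENNReal.ofReal_ne_top)).mp h4
  calc _ ≤ ∑' q : czSel f t, ∫⁻ x in dyI q.1, S.indicator (fun x => ‖f x‖ₑ) x :=
        ENNReal.tsum_le_tsum key
    _ = ∫⁻ x in czOm f t, S.indicator (fun x => ‖f x‖ₑ) x := by
        rw [czOm, lintegral_iUnion (fun q => dyI_meas _) (czSel_disj f t)]
    _ ≤ ∫⁻ x, S.indicator (fun x => ‖f x‖ₑ) x := setLIntegral_le_lintegral _ _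
    _ = _ := lintegral_indicator hSm _

lemma cz_vol_fin {f : ℝ → ℂ} (hc : Continuous f) (hf : Integrable f) {t : ℝ} (ht : 0 < t) :
    volume (czOm f t) < ⊤ := by
  have h := cz_vol_le hc hf ht
  have h2 : ∫⁻ x in {x | t / 2 < ‖f x‖}, ‖f x‖ₑ < ⊤ :=
    lt_of_le_of_lt (setLIntegral_le_lintegral _ _) hf.2
  have h3 := h.trans_lt h2
  by_contra hcon
  rw [not_lt, top_le_iff] at hcon
  rw [hcon, ENNReal.mul_top] at h3
  · exact absurd h3 (lt_irrefl _)
  · exact (ENNReal.ofReal_pos.mpr (by positivity)).ne'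

open Classical in
/-- Good part of the Calderón–Zygmund decomposition. -/
noncomputable def czG (f : ℝ → ℂ) (t : ℝ) (x : ℝ) : ℂ :=
  if h : ∃ q : czSel f t, x ∈ dyI q.1 then
    ((2:ℝ) ^ (h.choose).1.1)⁻¹ • ∫ y in dyI (h.choose).1, f y
  else f x

lemma czG_on {f : ℝ → ℂ} {t : ℝ} (q : czSel f t) {x : ℝ} (hx : x ∈ dyI q.1) :
    czG f t x = ((2:ℝ) ^ q.1.1)⁻¹ • ∫ y in dyI q.1, f y := by
  have h : ∃ q : czSel f t, x ∈ dyI q.1 := ⟨q, hx⟩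
  have he : h.choose = q := Subtype.ext (czSel_unique h.choose.2 q.2 h.choose_spec hx)
  rw [czG, dif_pos h, he]

lemma czG_off {f : ℝ → ℂ} {t : ℝ} {x : ℝ} (hx : x ∉ czOm f t) : czG f t x = f x := by
  have h : ¬ ∃ q : czSel f t, x ∈ dyI q.1 := by
    intro h; exact hx (Set.mem_iUnion.mpr h)
  rw [czG, dif_neg h]

lemma czG_meas {f : ℝ → ℂ} (hc : Continuous f) (t : ℝ) : Measurable (czG f t) := by
  intro s hs
  have : czG f t ⁻¹' s = ((czOm f t)ᶜ ∩ f ⁻¹' s) ∪ ⋃ q : czSel f t, (dyI q.1 ∩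
      {_x | ((2:ℝ) ^ q.1.1)⁻¹ • (∫ y in dyI q.1, f y) ∈ s}) := by
    ext x
    by_cases hx : x ∈ czOm f t
    · obtain ⟨q, hq⟩ := Set.mem_iUnion.mp hx
      simp only [Set.mem_preimage, Set.mem_union, Set.mem_inter_iff, Set.mem_compl_iff, hx,
        not_true_eq_false, false_and, false_or, Set.mem_iUnion, Set.mem_ofPred_eq]
      rw [czG_on q hq]
      constructor
      · intro h; exact ⟨q, hq, h⟩
      · rintro ⟨r, hr, h⟩
        have : q = r := Subtype.ext (czSel_unique q.2 r.2 hq hr)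
        rw [this]; exact h
    · simp only [Set.mem_preimage, Set.mem_union, Set.mem_inter_iff, Set.mem_compl_iff, hx,
        not_false_eq_true, true_and, Set.mem_iUnion, Set.mem_ofPred_eq]
      rw [czG_off hx]
      constructor
      · intro h; exact Or.inl h
      · rintro (h | ⟨r, hr, h⟩)
        · exact h
        · exact absurd (Set.mem_iUnion.mpr ⟨r, hr⟩) hx
  rw [this]
  refine ((czOm_meas f t).compl.inter (hc.measurable hs)).union
    (MeasurableSet.iUnion fun q => (dyI_meas _).inter (MeasurableSet.const _))

lemma czG_norm_on {f : ℝ → ℂ} (hf : Integrable f) {t : ℝ} {x : ℝ} (hx : x ∈ czOm f t) :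
    ‖czG f t x‖ ≤ 2 * t := by
  obtain ⟨q, hq⟩ := Set.mem_iUnion.mp hx
  rw [czG_on q hq, norm_smul]
  have hk : (0:ℝ) < 2 ^ q.1.1 := by positivity
  rw [Real.norm_of_nonneg (by positivity), inv_mul_le_iff₀ hk]
  refine (norm_integral_le_integral_norm _).trans ?_
  rcases czSel_upper q.2 with h | h
  · linarith
  · exact absurd hf h

lemma czG_norm_le {f : ℝ → ℂ} (hc : Continuous f) (hf : Integrable f) {t : ℝ} (ht : 0 < t) (x : ℝ) :
    ‖czG f t x‖ ≤ 2 * t := by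
  by_cases hx : x ∈ czOm f t
  · exact czG_norm_on hf hx
  · rw [czG_off hx]; linarith [cz_off hc hf ht hx]

lemma czG_int {f : ℝ → ℂ} (hc : Continuous f) (hf : Integrable f) {t : ℝ} (ht : 0 < t) :
    Integrable (czG f t) := by
  have h1 : Integrable (fun x => ‖f x‖ + (czOm f t).indicator (fun _ => 2 * t) x) :=
    hf.norm.add ((integrable_indicator_iff (czOm_meas f t)).mpr
      (integrableOn_const (cz_vol_fin hc hf ht).ne))
  refine h1.mono' (czG_meas hc t).aestronglyMeasurable (Filter.Eventually.of_forall fun x => ?_)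
  by_cases hx : x ∈ czOm f t
  · simp only [hx, Set.indicator_of_mem]
    linarith [czG_norm_on hf hx, norm_nonneg (f x)]
  · simp [hx, czG_off hx]

lemma czB_int_zero {f : ℝ → ℂ} (hf : Integrable f) {t : ℝ} (q : czSel f t) :
    ∫ y in dyI q.1, (f y - czG f t y) = 0 := by
  have hfin : volume (dyI q.1) ≠ ⊤ := by rw [dyI_vol]; exact ENNReal.ofReal_ne_top
  have : ∫ y in dyI q.1, (f y - czG f t y) =
      ∫ y in dyI q.1, (f y - ((2:ℝ) ^ q.1.1)⁻¹ • ∫ y in dyI q.1, f y) :=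
    setIntegral_congr_fun (dyI_meas _) fun y hy => by simp only [czG_on q hy]
  rw [this, integral_sub hf.integrableOn (integrableOn_const hfin), setIntegral_const,
    Measure.real, dyI_vol, ENNReal.toReal_ofReal (by positivity), smul_smul, mul_inv_cancel₀
    (by positivity), one_smul, sub_self]

lemma czB_norm {f : ℝ → ℂ} (hf : Integrable f) {t : ℝ} (ht : 0 < t) (q : czSel f t) :
    ∫⁻ y in dyI q.1, ‖f y - czG f t y‖ₑ ≤ ENNReal.ofReal (4 * t) * ENNReal.ofReal (2 ^ q.1.1) := by
  calc ∫⁻ y in dyI q.1, ‖f y - czG f t y‖ₑ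
      ≤ ∫⁻ y in dyI q.1, (‖f y‖ₑ + ENNReal.ofReal (2 * t)) := by
        apply setLIntegral_mono' (dyI_meas _)
        intro y hy
        refine (enorm_sub_le).trans ?_
        gcongr
        rw [← ofReal_norm]
        exact ENNReal.ofReal_le_ofReal (czG_norm_on hf (Set.mem_iUnion.mpr ⟨q, hy⟩))
    _ = (∫⁻ y in dyI q.1, ‖f y‖ₑ) + ENNReal.ofReal (2 * t) * ENNReal.ofReal (2 ^ q.1.1) := by
        rw [lintegral_add_right _ measurable_const, setLIntegral_const, dyI_vol]
    _ ≤ ENNReal.ofReal (2 * t) * ENNReal.ofReal (2 ^ q.1.1) +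
          ENNReal.ofReal (2 * t) * ENNReal.ofReal (2 ^ q.1.1) := by
        gcongr
        rw [← ofReal_integral_norm_eq_lintegral_enorm hf.integrableOn,
          ← ENNReal.ofReal_mul (by positivity)]
        apply ENNReal.ofReal_le_ofReal
        rcases czSel_upper q.2 with h | h
        · exact h
        · exact absurd hf h
    _ = _ := by
        rw [← add_mul, ← ENNReal.ofReal_add (by positivity) (by positivity)]
        congr 2; ring

/-- convolution operator -/
noncomputable def cnv (κ f : ℝ → ℂ) (x : ℝ) : ℂ := ∫ y, κ (x - y) * f y

lemma cnv_integrable {κ f : ℝ → ℂ} (hκ : Continuous κ) {M : ℝ} (hM : ∀ x, ‖κ x‖ ≤ M)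
    (hf : Integrable f) (x : ℝ) : Integrable (fun y => κ (x - y) * f y) := by
  refine hf.bdd_mul (c := M) ?_ (Filter.Eventually.of_forall fun y => hM _)
  exact (hκ.comp (continuous_const.sub continuous_id)).aestronglyMeasurable

lemma cnv_meas {κ f : ℝ → ℂ} (hκ : Continuous κ) (hf : Measurable f) : Measurable (cnv κ f) := by
  have : StronglyMeasurable (Function.uncurry fun x y => κ (x - y) * f y) := by
    apply Measurable.stronglyMeasurable
    exact (hκ.measurable.comp (measurable_fst.sub measurable_snd)).mul (hf.comp measurable_snd)
  exact (this.integral_prod_right).measurable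

/-- Enlarged exceptional set. -/
def czOs (f : ℝ → ℂ) (t : ℝ) : Set ℝ :=
  ⋃ q : czSel f t, Metric.closedBall (((q.1.2 : ℝ) + 1/2) * 2 ^ q.1.1) (2 ^ q.1.1)

lemma czOs_vol (f : ℝ → ℂ) (t : ℝ) : volume (czOs f t) ≤ 2 * volume (czOm f t) := by
  rw [czOm_vol, ← ENNReal.tsum_mul_left]
  refine (measure_iUnion_le _).trans (ENNReal.tsum_le_tsum fun q => ?_)
  rw [Real.volume_closedBall, ENNReal.ofReal_mul (by norm_num)]
  simp

/-- Hörmander condition -/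
def Horm (κ : ℝ → ℂ) : Prop :=
  ∀ y : ℝ, ∫⁻ x in {x | 2 * |y| ≤ |x|}, ‖κ (x - y) - κ x‖ₑ ≤ 1

def L2b (κ : ℝ → ℂ) : Prop :=
  ∀ g : ℝ → ℂ, Measurable g → Integrable g → (∃ M, ∀ x, ‖g x‖ ≤ M) →
    ∫⁻ x, ‖cnv κ g x‖ₑ ^ 2 ≤ ∫⁻ x, ‖g x‖ₑ ^ 2

lemma cz_bad {κ f : ℝ → ℂ} (hκ : Continuous κ) {M : ℝ} (hM : ∀ x, ‖κ x‖ ≤ M)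
    (hH : Horm κ) (hc : Continuous f) (hf : Integrable f) {t : ℝ} (ht : 0 < t) :
    ∫⁻ x in (czOs f t)ᶜ, ‖cnv κ (fun y => f y - czG f t y) x‖ₑ ≤
      ENNReal.ofReal (4 * t) * volume (czOm f t) := by
  set b : ℝ → ℂ := fun y => f y - czG f t y with hb
  have hbi : Integrable b := hf.sub (czG_int hc hf ht)
  have hbm : Measurable b := hc.measurable.sub (czG_meas hc t)
  set c : czSel f t → ℝ := fun q => ((q.1.2 : ℝ) + 1/2) * 2 ^ q.1.1 with hcdef
  have pt : ∀ x, ‖cnv κ b x‖ₑ ≤ ∑' q : czSel f t,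
      ∫⁻ y in dyI q.1, ‖κ (x - y) - κ (x - c q)‖ₑ * ‖b y‖ₑ := by
    intro x
    have hI := cnv_integrable hκ hM hbi x
    have h1 : cnv κ b x = ∫ y in czOm f t, κ (x - y) * b y := by
      rw [cnv]
      symm
      apply setIntegral_eq_integral_of_forall_compl_eq_zero
      intro y hy
      simp [hb, czG_off hy]
    have h2 : HasSum (fun q : czSel f t => ∫ y in dyI q.1, κ (x - y) * b y) (cnv κ b x) := by
      rw [h1]
      exact hasSum_integral_iUnion (fun q => dyI_meas _) (czSel_disj f t) hI.integrableOn
    rw [← h2.tsum_eq]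
    refine (enorm_tsum_le_tsum_enorm).trans (ENNReal.tsum_le_tsum fun q => ?_)
    have h3 : ∫ y in dyI q.1, κ (x - y) * b y = ∫ y in dyI q.1, (κ (x - y) - κ (x - c q)) * b y := by
      have : ∫ y in dyI q.1, (κ (x - y) - κ (x - c q)) * b y =
          (∫ y in dyI q.1, κ (x - y) * b y) - ∫ y in dyI q.1, κ (x - c q) * b y := by
        rw [← integral_sub hI.integrableOn (hbi.const_mul _).integrableOn]
        congr 1; ext y; ring
      rw [this, integral_const_mul, czB_int_zero hf q, mul_zero, sub_zero]
    rw [h3]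
    refine (enorm_integral_le_lintegral_enorm _).trans ?_
    simp_rw [enorm_mul]; exact le_rfl
  have hmeas : ∀ q : czSel f t, Measurable (Function.uncurry fun x y =>
      ‖κ (x - y) - κ (x - c q)‖ₑ * ‖b y‖ₑ) := by
    intro q
    have h1 : Continuous (fun z : ℝ × ℝ => κ (z.1 - z.2) - κ (z.1 - c q)) := by fun_prop
    exact h1.measurable.enorm.mul (hbm.comp measurable_snd).enorm
  calc ∫⁻ x in (czOs f t)ᶜ, ‖cnv κ b x‖ₑ
      ≤ ∫⁻ x in (czOs f t)ᶜ, ∑' q : czSel f t,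
          ∫⁻ y in dyI q.1, ‖κ (x - y) - κ (x - c q)‖ₑ * ‖b y‖ₑ := lintegral_mono pt
    _ = ∑' q : czSel f t, ∫⁻ x in (czOs f t)ᶜ, 
          ∫⁻ y in dyI q.1, ‖κ (x - y) - κ (x - c q)‖ₑ * ‖b y‖ₑ := by
        apply lintegral_tsum
        intro q
        exact (Measurable.lintegral_prod_right (hmeas q)).aemeasurable
    _ ≤ ∑' q : czSel f t, ∫⁻ y in dyI q.1, ‖b y‖ₑ := by
        refine ENNReal.tsum_le_tsum fun q => ?_
        rw [lintegral_lintegral_swap (hmeas q).aemeasurable]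
        apply setLIntegral_mono' (dyI_meas _)
        intro y hy
        rw [lintegral_mul_const']
        swap
        · exact enorm_ne_top
        conv_rhs => rw [← one_mul ‖b y‖ₑ]
        gcongr
        refine le_trans ?_ (hH (y - c q))
        have e : ∫⁻ x in {x | 2 * |y - c q| ≤ |x|}, ‖κ (x - (y - c q)) - κ x‖ₑ =
            ∫⁻ x, ({x | 2 * |y - c q| ≤ |x|}.indicator
              (fun x => ‖κ (x - (y - c q)) - κ x‖ₑ)) (x - c q) := by
          rw [lintegral_sub_right_eq_self (fun x => ({x | 2 * |y - c q| ≤ |x|}.indicator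
              (fun x => ‖κ (x - (y - c q)) - κ x‖ₑ)) x) (c q), lintegral_indicator]
          exact measurableSet_le measurable_const (by fun_prop)
        rw [e]
        have hOs : MeasurableSet (czOs f t)ᶜ :=
          (MeasurableSet.iUnion fun q => Metric.isClosed_closedBall.measurableSet).compl
        rw [← lintegral_indicator hOs]
        apply lintegral_mono
        intro x
        beta_reduce
        by_cases hx : x ∈ (czOs f t)ᶜ
        · have hk : (0:ℝ) < 2 ^ q.1.1 := by positivity
          have h1 : 2 ^ q.1.1 < |x - c q| := by
            by_contra hcon
            push Not at hcon
            apply hx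
            refine Set.mem_iUnion.mpr ⟨q, ?_⟩
            rw [Metric.mem_closedBall, Real.dist_eq]; exact hcon
          have h2 : 2 * |y - c q| ≤ 2 ^ q.1.1 := by
            simp only [dyI, Set.mem_Ico] at hy
            have : |y - c q| ≤ 2 ^ q.1.1 / 2 := by
              rw [abs_le, hcdef]; simp only; constructor <;> nlinarith [hy.1, hy.2]
            linarith
          have h3 : (x - c q) ∈ {x | 2 * |y - c q| ≤ |x|} := h2.trans h1.le
          rw [Set.indicator_of_mem hx, Set.indicator_of_mem h3]
          apply le_of_eq
          congr 3; ring
        · rw [Set.indicator_of_notMem hx]; exact zero_le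
    _ ≤ ∑' q : czSel f t, ENNReal.ofReal (4 * t) * ENNReal.ofReal (2 ^ q.1.1) :=
        ENNReal.tsum_le_tsum fun q => czB_norm hf ht q
    _ = _ := by rw [ENNReal.tsum_mul_left, czOm_vol]

lemma cz_good {f : ℝ → ℂ} (hc : Continuous f) (hf : Integrable f) {t : ℝ} (ht : 0 < t) :
    ∫⁻ x, ‖czG f t x‖ₑ ^ 2 ≤ (∫⁻ x in {x | ‖f x‖ ≤ t}, ‖f x‖ₑ ^ 2) +
      ENNReal.ofReal ((2 * t)^2) * volume (czOm f t) := by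
  have hSm : MeasurableSet {x | ‖f x‖ ≤ t} := measurableSet_le hc.norm.measurable measurable_const
  rw [← lintegral_indicator hSm, ← lintegral_indicator_const (czOm_meas f t), ← lintegral_add_left]
  swap
  · exact (hc.measurable.enorm.pow_const 2).indicator hSm
  apply lintegral_mono
  intro x
  beta_reduce
  by_cases hx : x ∈ czOm f t
  · rw [Set.indicator_of_mem hx]
    refine le_trans ?_ le_add_self
    rw [← ofReal_norm, ← ENNReal.ofReal_pow (norm_nonneg _)]
    apply ENNReal.ofReal_le_ofReal
    have := czG_norm_on hf hx
    gcongr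
  · have : x ∈ {x | ‖f x‖ ≤ t} := cz_off hc hf ht hx
    rw [Set.indicator_of_mem this, czG_off hx]
    exact le_self_add

lemma cz_weak {κ f : ℝ → ℂ} (hκ : Continuous κ) {M : ℝ} (hM : ∀ x, ‖κ x‖ ≤ M)
    (hH : Horm κ) (hL : L2b κ) (hc : Continuous f) (hf : Integrable f) {t : ℝ} (ht : 0 < t) :
    volume {x | 2 * t < ‖cnv κ f x‖} ≤ 
      ENNReal.ofReal (t ^ (-2 : ℝ)) * (∫⁻ x in {x | ‖f x‖ ≤ t}, ‖f x‖ₑ ^ 2) +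
      20 * (ENNReal.ofReal (t ^ (-1 : ℝ)) * ∫⁻ x in {x | t / 2 < ‖f x‖}, ‖f x‖ₑ) := by
  set g := czG f t
  set b : ℝ → ℂ := fun y => f y - g y with hb
  have hgi : Integrable g := czG_int hc hf ht
  have hgm : Measurable g := czG_meas hc t
  have hbi : Integrable b := hf.sub hgi
  have hbm : Measurable b := hc.measurable.sub hgm
  set V := volume (czOm f t)
  have hadd : ∀ x, cnv κ f x = cnv κ g x + cnv κ b x := by
    intro x
    rw [cnv, cnv, cnv, ← integral_add (cnv_integrable hκ hM hgi x) (cnv_integrable hκ hM hbi x)]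
    congr 1; ext y; simp only [hb]; ring
  have htE : ENNReal.ofReal t ≠ 0 := (ENNReal.ofReal_pos.mpr ht).ne'
  have hG : volume {x | t < ‖cnv κ g x‖} ≤ ENNReal.ofReal (t ^ (-2 : ℝ)) *
      (∫⁻ x in {x | ‖f x‖ ≤ t}, ‖f x‖ₑ ^ 2) + 4 * V := by
    have h1 : ENNReal.ofReal t ^ 2 * volume {x | t < ‖cnv κ g x‖} ≤ ∫⁻ x, ‖cnv κ g x‖ₑ ^ 2 := by
      refine le_trans ?_ (mul_meas_ge_le_lintegral₀
        ((cnv_meas hκ hgm).enorm.pow_const 2).aemeasurable (ENNReal.ofReal t ^ 2))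
      refine mul_le_mul_right (measure_mono ?_) _
      intro x hx
      replace hx : t < ‖cnv κ g x‖ := hx
      show ENNReal.ofReal t ^ 2 ≤ ‖cnv κ g x‖ₑ ^ 2
      gcongr
      rw [← ofReal_norm]
      exact ENNReal.ofReal_le_ofReal hx.le
    have h2 := (h1.trans (hL g hgm hgi ⟨_, czG_norm_le hc hf ht⟩)).trans (cz_good hc hf ht)
    have e1 : ENNReal.ofReal (t ^ (-2:ℝ)) * ENNReal.ofReal t ^ 2 = 1 := by
      rw [← ENNReal.ofReal_pow ht.le, ← ENNReal.ofReal_mul (by positivity)]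
      rw [Real.rpow_neg ht.le]; norm_cast
      rw [inv_mul_cancel₀ (by positivity), ENNReal.ofReal_one]
    calc volume {x | t < ‖cnv κ g x‖} = ENNReal.ofReal (t ^ (-2:ℝ)) *
          (ENNReal.ofReal t ^ 2 * volume {x | t < ‖cnv κ g x‖}) := by
            rw [← mul_assoc, e1, one_mul]
      _ ≤ ENNReal.ofReal (t ^ (-2:ℝ)) * ((∫⁻ x in {x | ‖f x‖ ≤ t}, ‖f x‖ₑ ^ 2) +
            ENNReal.ofReal ((2 * t)^2) * V) := by gcongr
      _ = _ := by
        rw [mul_add, ← mul_assoc, mul_pow, ENNReal.ofReal_mul (by positivity),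
          ENNReal.ofReal_pow ht.le, ← mul_assoc]
        have : ENNReal.ofReal (t ^ (-2:ℝ)) * ENNReal.ofReal (2^2) * ENNReal.ofReal t ^ 2 = 4 := by
          rw [mul_right_comm, e1]; norm_num
        rw [mul_assoc, mul_assoc, ← mul_assoc, ← mul_assoc, this]
  have hB : volume {x | t < ‖cnv κ b x‖} ≤ 6 * V := by
    have h1 : ENNReal.ofReal t * volume ({x | t < ‖cnv κ b x‖} ∩ (czOs f t)ᶜ) ≤
        ENNReal.ofReal t * (4 * V) := by
      calc ENNReal.ofReal t * volume ({x | t < ‖cnv κ b x‖} ∩ (czOs f t)ᶜ)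
          = ENNReal.ofReal t * (volume.restrict (czOs f t)ᶜ) {x | t < ‖cnv κ b x‖} := by
            rw [Measure.restrict_apply]
            exact measurableSet_lt measurable_const (cnv_meas hκ hbm).norm
        _ ≤ ENNReal.ofReal t * (volume.restrict (czOs f t)ᶜ) {x | ENNReal.ofReal t ≤ ‖cnv κ b x‖ₑ} := by
            refine mul_le_mul_right (measure_mono ?_) _
            intro x hx
            replace hx : t < ‖cnv κ b x‖ := hx
            show ENNReal.ofReal t ≤ ‖cnv κ b x‖ₑ
            rw [← ofReal_norm]
            exact ENNReal.ofReal_le_ofReal hx.le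
        _ ≤ _ := mul_meas_ge_le_lintegral₀ ((cnv_meas hκ hbm).enorm).aemeasurable _
        _ ≤ _ := cz_bad hκ hM hH hc hf ht
        _ = _ := by
          rw [ENNReal.ofReal_mul (by norm_num), mul_comm (ENNReal.ofReal 4), mul_assoc]
          norm_num
          rfl
    rw [ENNReal.mul_le_mul_iff_right htE ENNReal.ofReal_ne_top] at h1
    calc volume {x | t < ‖cnv κ b x‖} ≤ volume (({x | t < ‖cnv κ b x‖} ∩ (czOs f t)ᶜ) ∪ czOs f t) := by
          apply measure_mono
          intro x hx
          by_cases h : x ∈ czOs f t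
          · exact Or.inr h
          · exact Or.inl ⟨hx, h⟩
      _ ≤ _ := measure_union_le _ _
      _ ≤ 4 * V + 2 * V := add_le_add h1 (czOs_vol f t)
      _ = 6 * V := by rw [← add_mul]; norm_num
  have hV : V ≤ 2 * (ENNReal.ofReal (t ^ (-1 : ℝ)) * ∫⁻ x in {x | t / 2 < ‖f x‖}, ‖f x‖ₑ) := by
    have h := cz_vol_le hc hf ht
    have e1 : 2 * ENNReal.ofReal (t ^ (-1:ℝ)) * ENNReal.ofReal (t/2) = 1 := by
      have : (2:ENNReal) = ENNReal.ofReal 2 := by norm_num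
      rw [this, ← ENNReal.ofReal_mul (by norm_num), ← ENNReal.ofReal_mul (by positivity),
        Real.rpow_neg_one]
      rw [← ENNReal.ofReal_one]; congr 1; field_simp
    calc V = 2 * ENNReal.ofReal (t ^ (-1:ℝ)) * (ENNReal.ofReal (t/2) * V) := by
          rw [← mul_assoc, e1, one_mul]
      _ ≤ 2 * ENNReal.ofReal (t ^ (-1:ℝ)) * ∫⁻ x in {x | t / 2 < ‖f x‖}, ‖f x‖ₑ := by gcongr
      _ = _ := by rw [mul_assoc]
  calc volume {x | 2 * t < ‖cnv κ f x‖}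
      ≤ volume ({x | t < ‖cnv κ g x‖} ∪ {x | t < ‖cnv κ b x‖}) := by
        apply measure_mono
        intro x hx
        by_contra hcon
        simp only [Set.mem_union, Set.mem_ofPred_eq, not_or, not_lt] at hcon hx
        rw [hadd x] at hx
        linarith [norm_add_le (cnv κ g x) (cnv κ b x), hcon.1, hcon.2]
    _ ≤ _ := measure_union_le _ _
    _ ≤ _ := add_le_add hG hB
    _ = ENNReal.ofReal (t ^ (-2 : ℝ)) * (∫⁻ x in {x | ‖f x‖ ≤ t}, ‖f x‖ₑ ^ 2) + 10 * V := by
        rw [add_assoc, ← add_mul]; norm_num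
    _ ≤ ENNReal.ofReal (t ^ (-2 : ℝ)) * (∫⁻ x in {x | ‖f x‖ ≤ t}, ‖f x‖ₑ ^ 2) + 10 *
        (2 * (ENNReal.ofReal (t ^ (-1 : ℝ)) * ∫⁻ x in {x | t / 2 < ‖f x‖}, ‖f x‖ₑ)) := by gcongr
    _ = _ := by rw [← mul_assoc 10]; norm_num

lemma lint_Ioi_rpow {a c : ℝ} (ha : a < -1) (hc : 0 < c) :
    ∫⁻ s in Set.Ici c, ENNReal.ofReal (s ^ a) = ENNReal.ofReal (c ^ (a+1) / (-(a+1))) := by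
  rw [setLIntegral_congr (Ioi_ae_eq_Ici (μ := volume) (a := c)).symm]
  rw [← ofReal_integral_eq_lintegral_ofReal (integrableOn_Ioi_rpow_of_lt ha hc),
    integral_Ioi_rpow_of_lt ha hc]
  · congr 1; rw [neg_div, div_neg]
  · filter_upwards [ae_restrict_mem measurableSet_Ioi] with s hs
    exact Real.rpow_nonneg (hc.le.trans (le_of_lt hs)) _

lemma lint_Ioo_rpow {a c : ℝ} (ha : -1 < a) (hc : 0 ≤ c) :
    ∫⁻ s in Set.Ioc 0 c, ENNReal.ofReal (s ^ a) = ENNReal.ofReal (c ^ (a+1) / (a+1)) := by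
  have hi : IntervalIntegrable (fun s : ℝ => s ^ a) volume 0 c :=
    intervalIntegral.intervalIntegrable_rpow' ha
  rw [← ofReal_integral_eq_lintegral_ofReal ((intervalIntegrable_iff_integrableOn_Ioc_of_le hc).1 hi),
    ← intervalIntegral.integral_of_le hc, integral_rpow (Or.inl ha)]
  · congr 1; rw [Real.zero_rpow (by linarith), sub_zero]
  · filter_upwards [ae_restrict_mem measurableSet_Ioc] with s hs
    exact Real.rpow_nonneg hs.1.le _

lemma tonelli_set {g : ℝ → ENNReal} (hg : Measurable g) {w : ℝ → ENNReal} (hw : Measurable w)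
    {S : Set (ℝ × ℝ)} (hS : MeasurableSet S) :
    ∫⁻ s in Set.Ioi (0:ℝ), w s * ∫⁻ x in {x | (s, x) ∈ S}, g x =
      ∫⁻ x, g x * ∫⁻ s in Set.Ioi (0:ℝ) ∩ {s | (s, x) ∈ S}, w s := by
  have hm : Measurable (S.indicator (fun z : ℝ × ℝ => w z.1 * g z.2)) :=
    ((hw.comp measurable_fst).mul (hg.comp measurable_snd)).indicator hS
  calc _ = ∫⁻ s in Set.Ioi (0:ℝ), ∫⁻ x, S.indicator (fun z : ℝ × ℝ => w z.1 * g z.2) (s, x) := by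
        congr 1; ext s
        have hs : MeasurableSet {x | (s, x) ∈ S} := measurable_prodMk_left hS
        rw [← lintegral_indicator hs, ← lintegral_const_mul _ (hg.indicator hs)]
        congr 1; ext x
        by_cases h : (s, x) ∈ S <;> simp [Set.indicator, h]
    _ = ∫⁻ x, ∫⁻ s in Set.Ioi (0:ℝ), S.indicator (fun z : ℝ × ℝ => w z.1 * g z.2) (s, x) := by
        rw [lintegral_lintegral_swap]
        exact hm.aemeasurable
    _ = _ := by
        congr 1; ext x
        have hs : MeasurableSet {s | (s, x) ∈ S} := measurable_prodMk_right hS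
        rw [Set.inter_comm, ← Measure.restrict_restrict hs, ← lintegral_indicator hs,
          ← lintegral_const_mul _ (hw.indicator hs)]
        congr 1; ext s
        by_cases h : (s, x) ∈ S <;> simp [Set.indicator, h, mul_comm]

noncomputable def czC (p : ℝ) : ℝ := 2 ^ p * (p * (1 / (2 - p) + 20 * (2 ^ (p - 1) / (p - 1))))

lemma cz_lt2 {κ f : ℝ → ℂ} (hκ : Continuous κ) {M : ℝ} (hM : ∀ x, ‖κ x‖ ≤ M)
    (hH : Horm κ) (hL : L2b κ) (hc : Continuous f) (hf : Integrable f) {p : ℝ} (hp : 1 < p)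
    (hp2 : p < 2) :
    ∫⁻ x, ‖cnv κ f x‖ₑ ^ p ≤ ENNReal.ofReal (czC p) * ∫⁻ x, ‖f x‖ₑ ^ p := by
  have hhm : Measurable (fun x => ‖cnv κ f x‖ / 2) := (cnv_meas hκ hc.measurable).norm.div_const 2
  have hlc := lintegral_rpow_eq_lintegral_meas_lt_mul (μ := volume) (f := fun x => ‖cnv κ f x‖ / 2)
    (Filter.Eventually.of_forall fun x => by positivity) hhm.aemeasurable (p := p) (by linarith)
  have e0 : ∫⁻ x, ‖cnv κ f x‖ₑ ^ p = ENNReal.ofReal (2 ^ p) *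
      ∫⁻ x, ENNReal.ofReal ((‖cnv κ f x‖ / 2) ^ p) := by
    rw [← lintegral_const_mul _ (by fun_prop)]
    congr 1; ext x
    rw [← ENNReal.ofReal_mul (by positivity), ← Real.mul_rpow (by norm_num) (by positivity),
      mul_div_cancel₀ _ (by norm_num), ← ofReal_norm, ENNReal.ofReal_rpow_of_nonneg (norm_nonneg _)
      (by linarith)]
  have hfm : Measurable (fun x => ‖f x‖ₑ) := hc.measurable.enorm
  have hpm : ∀ a : ℝ, Measurable (fun s : ℝ => ENNReal.ofReal (s ^ a)) := fun a => by fun_prop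
  have hmain : ∫⁻ s in Set.Ioi (0:ℝ), volume {x | s < ‖cnv κ f x‖ / 2} * ENNReal.ofReal (s ^ (p-1))
      ≤ ENNReal.ofReal (1 / (2 - p)) * (∫⁻ x, ‖f x‖ₑ ^ p) +
        ENNReal.ofReal (20 * (2 ^ (p-1) / (p - 1))) * ∫⁻ x, ‖f x‖ₑ ^ p := by
    calc _ ≤ ∫⁻ s in Set.Ioi (0:ℝ), (ENNReal.ofReal (s ^ (p - 3)) *
            (∫⁻ x in {x | (s, x) ∈ {z : ℝ × ℝ | ‖f z.2‖ ≤ z.1}}, ‖f x‖ₑ ^ 2) +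
            20 * (ENNReal.ofReal (s ^ (p-2)) *
              ∫⁻ x in {x | (s, x) ∈ {z : ℝ × ℝ | z.1 / 2 < ‖f z.2‖}}, ‖f x‖ₑ)) := by
          apply setLIntegral_mono' measurableSet_Ioi
          intro s hs
          have hs0 : (0:ℝ) < s := hs
          have := cz_weak hκ hM hH hL hc hf hs0
          have e1 : {x | s < ‖cnv κ f x‖ / 2} = {x | 2 * s < ‖cnv κ f x‖} := by
            ext x; show s < _ / 2 ↔ 2 * s < _
            constructor <;> intro h <;> linarith
          rw [e1]
          refine (mul_le_mul_left this _).trans (le_of_eq ?_)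
          have p1 : ENNReal.ofReal (s ^ (p-3)) = ENNReal.ofReal (s ^ (-2:ℝ)) * ENNReal.ofReal (s ^ (p-1)) := by
            rw [← ENNReal.ofReal_mul (by positivity), ← Real.rpow_add hs0]; congr 2; ring
          have p2 : ENNReal.ofReal (s ^ (p-2)) = ENNReal.ofReal (s ^ (-1:ℝ)) * ENNReal.ofReal (s ^ (p-1)) := by
            rw [← ENNReal.ofReal_mul (by positivity), ← Real.rpow_add hs0]; congr 2; ring
          rw [p1, p2]
          simp only [Set.mem_ofPred_eq]
          ring
      _ = (∫⁻ s in Set.Ioi (0:ℝ), ENNReal.ofReal (s ^ (p - 3)) *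
            (∫⁻ x in {x | (s, x) ∈ {z : ℝ × ℝ | ‖f z.2‖ ≤ z.1}}, ‖f x‖ₑ ^ 2)) +
            20 * ∫⁻ s in Set.Ioi (0:ℝ), (ENNReal.ofReal (s ^ (p-2)) *
              ∫⁻ x in {x | (s, x) ∈ {z : ℝ × ℝ | z.1 / 2 < ‖f z.2‖}}, ‖f x‖ₑ) := by
          have hmm : Measurable (fun s : ℝ => ENNReal.ofReal (s ^ (p-2)) *
              ∫⁻ x in {x | (s, x) ∈ {z : ℝ × ℝ | z.1 / 2 < ‖f z.2‖}}, ‖f x‖ₑ) := by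
            have hS : MeasurableSet {z : ℝ × ℝ | z.1 / 2 < ‖f z.2‖} :=
              measurableSet_lt (by fun_prop) (hc.comp continuous_snd).norm.measurable
            refine (hpm _).mul ?_
            have : (fun s : ℝ => ∫⁻ x in {x | (s, x) ∈ {z : ℝ × ℝ | z.1 / 2 < ‖f z.2‖}}, ‖f x‖ₑ) =
              fun s => ∫⁻ x, ({z : ℝ × ℝ | z.1 / 2 < ‖f z.2‖}.indicator (fun z => ‖f z.2‖ₑ)) (s, x) := by
              ext s
              have hs : MeasurableSet {x | (s, x) ∈ {z : ℝ × ℝ | z.1 / 2 < ‖f z.2‖}} :=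
                measurable_prodMk_left hS
              rw [← lintegral_indicator hs]
              rfl
            rw [this]
            exact Measurable.lintegral_prod_right' ((hfm.comp measurable_snd).indicator hS)
          rw [lintegral_add_right _ (hmm.const_mul 20), lintegral_const_mul _ hmm]
      _ ≤ _ := by
          have hS1 : MeasurableSet {z : ℝ × ℝ | ‖f z.2‖ ≤ z.1} :=
            measurableSet_le (hc.comp continuous_snd).norm.measurable (by fun_prop) 
          have hS2 : MeasurableSet {z : ℝ × ℝ | z.1 / 2 < ‖f z.2‖} :=
            measurableSet_lt (by fun_prop) (hc.comp continuous_snd).norm.measurable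
          rw [tonelli_set (hfm.pow_const 2) (hpm _) hS1, tonelli_set hfm (hpm _) hS2]
          refine add_le_add ?_ ?_
          · rw [← lintegral_const_mul _ (by fun_prop)]
            apply lintegral_mono
            intro x
            beta_reduce
            by_cases hx : f x = 0
            · simp [hx]
            have hx0 : 0 < ‖f x‖ := norm_pos_iff.mpr hx
            have : Set.Ioi (0:ℝ) ∩ {s | (s, x) ∈ {z : ℝ × ℝ | ‖f z.2‖ ≤ z.1}} = Set.Ici ‖f x‖ := by
              ext s; simp only [Set.mem_inter_iff, Set.mem_Ioi, Set.mem_ofPred_eq, Set.mem_Ici]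
              constructor
              · exact fun h => h.2
              · exact fun h => ⟨hx0.trans_le h, h⟩
            rw [this, lint_Ioi_rpow (by linarith) hx0, ← ofReal_norm, ← ENNReal.ofReal_pow (norm_nonneg _),
              ENNReal.ofReal_rpow_of_nonneg (norm_nonneg _) (by linarith),
              ← ENNReal.ofReal_mul (by positivity), ← ENNReal.ofReal_mul
                (by apply div_nonneg <;> linarith)]
            apply le_of_eq; congr 1
            rw [← Real.rpow_natCast, ← mul_div_assoc, ← Real.rpow_add hx0, div_mul_eq_mul_div, one_mul]
            congr 2
            · push_cast; ring
            · ring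
          · rw [← lintegral_const_mul' _ _ (show (20:ENNReal) ≠ ⊤ by norm_num), 
              ← lintegral_const_mul' _ _ ENNReal.ofReal_ne_top]
            apply lintegral_mono
            intro x
            beta_reduce
            have : Set.Ioi (0:ℝ) ∩ {s | (s, x) ∈ {z : ℝ × ℝ | z.1 / 2 < ‖f z.2‖}} ⊆ Set.Ioc 0 (2 * ‖f x‖) := by
              intro s hs
              simp only [Set.mem_inter_iff, Set.mem_Ioi, Set.mem_ofPred_eq] at hs
              exact ⟨hs.1, by linarith [hs.2]⟩
            refine (mul_le_mul_right (mul_le_mul_right (lintegral_mono_set this) _) _).trans ?_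
            have e20 : (20:ENNReal) = ENNReal.ofReal 20 := by norm_num
            rw [lint_Ioo_rpow (by linarith) (by positivity), ← ofReal_norm, e20,
              ENNReal.ofReal_rpow_of_nonneg (norm_nonneg _) (by linarith),
              ← ENNReal.ofReal_mul (by positivity), ← ENNReal.ofReal_mul (by positivity),
              ← ENNReal.ofReal_mul (by have : 0 < p - 1 := by linarith
                                       positivity)]
            apply le_of_eq; congr 1
            have e3 : p - 2 + 1 = p - 1 := by ring
            have e4 : ‖f x‖ ^ p = ‖f x‖ * ‖f x‖ ^ (p - 1) := by
              rcases (norm_nonneg (f x)).eq_or_lt with h | h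
              · rw [← h, Real.zero_rpow (by linarith), zero_mul]
              · rw [← Real.rpow_one_add' h.le (by linarith)]; congr 1; ring
            rw [e3, Real.mul_rpow (by norm_num) (norm_nonneg _), e4]
            ring
  rw [e0, hlc]
  have hq : 0 ≤ 1 / (2 - p) := by apply div_nonneg <;> linarith
  have hq' : 0 ≤ (20 * ((2:ℝ) ^ (p-1) / (p - 1))) := by 
    have : 0 < p - 1 := by linarith
    positivity
  refine (mul_le_mul_right (mul_le_mul_right hmain _) _).trans (le_of_eq ?_)
  rw [← add_mul, ← ENNReal.ofReal_add hq hq', czC, ← mul_assoc, ← mul_assoc, ← ENNReal.ofReal_mul (by positivity),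
    ← ENNReal.ofReal_mul (by have : 0 < p := by linarith
                             positivity)]
  congr 2; ring

lemma Horm_neg {κ : ℝ → ℂ} (hH : Horm κ) : Horm (fun x => κ (-x)) := by
  intro y
  refine le_trans (le_of_eq ?_) (hH (-y))
  have hm : ∀ y : ℝ, MeasurableSet {x : ℝ | 2 * |y| ≤ |x|} := fun y =>
    measurableSet_le measurable_const (by fun_prop)
  rw [← lintegral_indicator (hm _), ← lintegral_indicator (hm _),
    ← lintegral_neg_eq_self]
  congr 1; ext x
  simp only [Set.indicator, Set.mem_ofPred_eq, abs_neg, neg_neg]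
  have : -(-x - y) = x - -y := by ring
  rw [this]

lemma L2b_neg {κ : ℝ → ℂ} (hL : L2b κ) : L2b (fun x => κ (-x)) := by
  intro g hg hgi ⟨M, hM⟩
  have h := hL (fun x => g (-x)) (hg.comp measurable_neg) hgi.comp_neg ⟨M, fun x => hM _⟩
  rw [← lintegral_neg_eq_self (fun x => ‖g x‖ₑ ^ 2), ← lintegral_neg_eq_self (fun x => ‖cnv _ g x‖ₑ ^ 2)]
  have e : ∀ x, cnv (fun x => κ (-x)) g (-x) = cnv κ (fun x => g (-x)) x := by
    intro x
    rw [cnv, cnv, ← integral_neg_eq_self]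
    congr 1; ext y; congr 2; ring
  simp_rw [e]
  exact h

lemma cnv_cont {κ f : ℝ → ℂ} (hκ : Continuous κ) {M : ℝ} (hM : ∀ x, ‖κ x‖ ≤ M)
    (hf : Integrable f) : Continuous (cnv κ f) := by
  apply continuous_of_dominated (bound := fun y => M * ‖f y‖)
  · intro x; exact (cnv_integrable hκ hM hf x).aestronglyMeasurable
  · intro x; refine Filter.Eventually.of_forall fun y => ?_
    rw [norm_mul]; gcongr; exact hM _
  · exact hf.norm.const_mul _
  · refine Filter.Eventually.of_forall fun y => ?_
    fun_prop

lemma cnv_bdd {κ f : ℝ → ℂ} {M : ℝ} (hM : ∀ x, ‖κ x‖ ≤ M)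
    (hf : Integrable f) (x : ℝ) : ‖cnv κ f x‖ ≤ M * ∫ y, ‖f y‖ := by
  rw [← integral_const_mul]
  apply norm_integral_le_of_norm_le (hf.norm.const_mul _)
  refine Filter.Eventually.of_forall fun y => ?_
  rw [norm_mul]; gcongr; exact hM _

lemma cnv_prod_int {κ f : ℝ → ℂ} (hκ : Integrable κ) (hf : Integrable f) :
    Integrable (fun z : ℝ × ℝ => κ (z.1 - z.2) * f z.2) (volume.prod volume) := by
  have := (Integrable.convolution_integrand (ContinuousLinearMap.mul ℂ ℂ) hf hκ (μ := volume) (ν := volume))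
  refine this.congr (Filter.Eventually.of_forall fun z => ?_)
  simp [mul_comm]

lemma cnv_int {κ f : ℝ → ℂ} (hκ : Integrable κ) (hf : Integrable f) : Integrable (cnv κ f) :=
  (cnv_prod_int hκ hf).integral_prod_left

lemma cnv_dual {κ f G : ℝ → ℂ} (hκi : Integrable κ) (hf : Integrable f)
    (hG : Continuous G) {N : ℝ} (hN : ∀ x, ‖G x‖ ≤ N) :
    ∫ x, cnv κ f x * G x = ∫ y, f y * cnv (fun x => κ (-x)) G y := by
  have hI : Integrable (Function.uncurry fun x y : ℝ => κ (x - y) * f y * G x) (volume.prod volume) := by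
    have := (cnv_prod_int hκi hf).mul_bdd (g := fun z => G z.1) (c := N)
      (hG.comp continuous_fst).aestronglyMeasurable (Filter.Eventually.of_forall fun z => hN _)
    exact this
  calc ∫ x, cnv κ f x * G x = ∫ x, ∫ y, κ (x - y) * f y * G x := by
        congr 1; ext x; rw [cnv, integral_mul_const]
    _ = ∫ y, ∫ x, κ (x - y) * f y * G x := integral_integral_swap hI
    _ = _ := by
        congr 1; ext y; rw [cnv, ← integral_const_mul]; congr 1; ext x
        rw [neg_sub]; ring

lemma cz_gt2 {κ f : ℝ → ℂ} (hκ : Continuous κ) {M : ℝ} (hM : ∀ x, ‖κ x‖ ≤ M) (hκi : Integrable κ)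
    (hH : Horm κ) (hL : L2b κ) (hf : Integrable f) {p q : ℝ}
    (hp : 2 < p) (hpq : p.HolderConjugate q) (hc : Continuous f) :
    ∫⁻ x, ‖cnv κ f x‖ₑ ^ p ≤ (ENNReal.ofReal (czC q)) ^ (p - 1) * ∫⁻ x, ‖f x‖ₑ ^ p := by
  set h := cnv κ f with hh
  have hcont : Continuous h := cnv_cont hκ hM hf
  set D := M * ∫ y, ‖f y‖ 
  have hbd : ∀ x, ‖h x‖ ≤ D := cnv_bdd hM hf
  have hint : Integrable h := cnv_int hκi hf
  set G : ℝ → ℂ := fun x => ((‖h x‖ ^ (p - 2) : ℝ) : ℂ) * (starRingEnd ℂ) (h x) with hG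
  have hGc : Continuous G := by
    refine (Complex.continuous_ofReal.comp ?_).mul (Complex.continuous_conj.comp hcont)
    exact hcont.norm.rpow_const fun x => Or.inr (by linarith)
  have hGn : ∀ x, ‖G x‖ = ‖h x‖ ^ (p - 1) := by
    intro x
    rw [hG]; simp only [norm_mul, Complex.norm_real, RCLike.norm_conj]
    rw [Real.norm_of_nonneg (by positivity), ← Real.rpow_add_one' (norm_nonneg _) (by linarith)]
    congr 1; ring
  have hGb : ∀ x, ‖G x‖ ≤ D ^ (p - 1) := by
    intro x; rw [hGn]; exact Real.rpow_le_rpow (norm_nonneg _) (hbd x) (by linarith)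
  have hGi : Integrable G := by
    refine Integrable.bdd_mul (c := D ^ (p-2)) ?_ ?_ ?_
    · exact (Complex.conjCLE.toContinuousLinearMap.integrable_comp hint)
    · exact (Complex.continuous_ofReal.comp (hcont.norm.rpow_const fun x => Or.inr (by linarith))).aestronglyMeasurable
    · refine Filter.Eventually.of_forall fun x => ?_
      rw [Complex.norm_real, Real.norm_of_nonneg (by positivity)]
      exact Real.rpow_le_rpow (norm_nonneg _) (hbd x) (by linarith)
  have hGh : ∀ x, h x * G x = ((‖h x‖ ^ p : ℝ) : ℂ) := by
    intro x
    rw [hG]; simp only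
    rw [mul_left_comm, Complex.mul_conj, Complex.normSq_eq_norm_sq, ← Complex.ofReal_mul]
    congr 1
    rw [← Real.rpow_natCast, ← Real.rpow_add' (norm_nonneg _) (by push_cast; linarith)]
    congr 1; push_cast; ring
  have hpi : Integrable (fun x => ‖h x‖ ^ p) := by
    have : Integrable (fun x => h x * G x) := hint.mul_bdd (c := D ^ (p-1)) hGc.aestronglyMeasurable
      (Filter.Eventually.of_forall hGb)
    have h2 := this.norm
    refine h2.congr (Filter.Eventually.of_forall fun x => ?_)
    simp only [hGh, Complex.norm_real, Real.norm_of_nonneg (Real.rpow_nonneg (norm_nonneg (h x)) p)]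
  set I := ∫⁻ x, ‖h x‖ₑ ^ p with hI
  have hIe : I = ENNReal.ofReal (∫ x, ‖h x‖ ^ p) := by
    rw [ofReal_integral_eq_lintegral_ofReal hpi (Filter.Eventually.of_forall fun x => by positivity), hI]
    congr 1; ext x
    rw [← ofReal_norm, ENNReal.ofReal_rpow_of_nonneg (norm_nonneg _) (by linarith)]
  have hIt : I ≠ ⊤ := by rw [hIe]; exact ENNReal.ofReal_ne_top
  set J := ∫⁻ x, ‖f x‖ₑ ^ p with hJ
  have hq1 : 1 < q := hpq.symm.lt
  have hp0 : 0 < p := by linarith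
  have hq0 : 0 < q := by linarith
  have hqp := hpq.inv_add_inv_eq_one
  have hq2 : q < 2 := by
    by_contra hcon; push Not at hcon
    have h1 : p⁻¹ < 2⁻¹ := by gcongr
    have h2 : q⁻¹ ≤ 2⁻¹ := by gcongr
    linarith
  have hpq1 : (p - 1) * q = p := by rw [hpq.sub_one_mul_conj]
  have h1 : I ≤ ∫⁻ x, ‖f x‖ₑ * ‖cnv (fun x => κ (-x)) G x‖ₑ := by
    calc I = ‖∫ x, h x * G x‖ₑ := by
          simp_rw [hGh]
          rw [integral_complex_ofReal, hIe, ← ofReal_norm, Complex.norm_real, Real.norm_of_nonneg]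
          positivity
      _ = ‖∫ y, f y * cnv (fun x => κ (-x)) G y‖ₑ := by rw [hh, cnv_dual hκi hf hGc hGb]
      _ ≤ _ := by
        refine (enorm_integral_le_lintegral_enorm _).trans ?_
        simp_rw [enorm_mul]; exact le_rfl
  have hκn : Continuous (fun x => κ (-x)) := hκ.comp continuous_neg
  have h2 := ENNReal.lintegral_mul_le_Lp_mul_Lq volume hpq (f := fun x => ‖f x‖ₑ)
    (g := fun x => ‖cnv (fun x => κ (-x)) G x‖ₑ) hc.measurable.enorm.aemeasurable
    (cnv_meas hκn hGc.measurable).enorm.aemeasurable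
  have h3 := cz_lt2 hκn (fun x => hM _) (Horm_neg hH) (L2b_neg hL) hGc hGi hq1 hq2
  have h4 : ∫⁻ x, ‖G x‖ₑ ^ q = I := by
    rw [hI]; congr 1; ext x
    rw [← ofReal_norm, hGn, ← ENNReal.ofReal_rpow_of_nonneg (norm_nonneg _) (by linarith),
      ← ENNReal.rpow_mul, hpq1, ofReal_norm]
  rw [h4] at h3
  have h5 : I ≤ J ^ (1/p) * (ENNReal.ofReal (czC q) * I) ^ (1/q) := by
    refine (h1.trans h2).trans ?_
    show J ^ (1/p) * _ ≤ _
    gcongr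
  have h6 : I ^ p ≤ J * (ENNReal.ofReal (czC q) * I) ^ (p - 1) := by
    calc I ^ p ≤ (J ^ (1/p) * (ENNReal.ofReal (czC q) * I) ^ (1/q)) ^ p := by gcongr
      _ = _ := by
        rw [ENNReal.mul_rpow_of_nonneg _ _ hp0.le, ← ENNReal.rpow_mul, ← ENNReal.rpow_mul,
          one_div_mul_cancel hp0.ne', ENNReal.rpow_one]
        congr 2
        rw [one_div_mul_eq_div, div_eq_iff hq0.ne', hpq1]
  by_cases hI0 : I = 0
  · rw [hI0]; exact zero_le
  have h7 : I ^ p = I ^ (p - 1) * I := by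
    have := ENNReal.rpow_add (x := I) (p - 1) 1 hI0 hIt
    rw [ENNReal.rpow_one] at this
    rw [← this]; congr 1; ring
  rw [h7, ENNReal.mul_rpow_of_nonneg _ _ (by linarith), ← mul_assoc, mul_comm _ (I ^ (p-1)),
    ENNReal.mul_le_mul_iff_right] at h6
  · rwa [mul_comm]
  · simp [ENNReal.rpow_eq_zero_iff, hI0, hIt]
  · exact ENNReal.rpow_ne_top_of_nonneg (by linarith) hIt

theorem cz_Lp {p : ℝ} (hp : 1 < p) : ∃ C : NNReal, ∀ κ : ℝ → ℂ, Continuous κ → 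
    (∃ M, ∀ x, ‖κ x‖ ≤ M) → Integrable κ → Horm κ → L2b κ →
    ∀ f : ℝ → ℂ, Continuous f → Integrable f → (∃ M, ∀ x, ‖f x‖ ≤ M) →
    ∫⁻ x, ‖cnv κ f x‖ₑ ^ p ≤ C * ∫⁻ x, ‖f x‖ₑ ^ p := by
  rcases lt_trichotomy p 2 with h | h | h
  · refine ⟨(czC p).toNNReal, fun κ hκ ⟨M, hM⟩ hκi hH hL f hc hf _ => ?_⟩
    exact cz_lt2 hκ hM hH hL hc hf hp h
  · refine ⟨1, fun κ hκ _ hκi hH hL f hc hf hb => ?_⟩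
    have := hL f hc.measurable hf hb
    rw [h]; norm_cast; simpa using this
  · refine ⟨(czC (p.conjExponent)).toNNReal ^ (p - 1), fun κ hκ ⟨M, hM⟩ hκi hH hL f hc hf _ => ?_⟩
    have := cz_gt2 hκ hM hκi hH hL hf h (Real.HolderConjugate.conjExponent hp) hc
    rw [ENNReal.coe_rpow_of_nonneg _ (by linarith)]
    exact this

lemma l2_schwartz (κ s : SchwartzMap ℝ ℂ) (hκ : ∀ ξ, ‖𝓕 κ ξ‖ ≤ 1) :
    ∫⁻ x, ‖cnv κ s x‖ₑ ^ 2 ≤ ∫⁻ x, ‖s x‖ₑ ^ 2 := by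
  set w := SchwartzMap.convolution (ContinuousLinearMap.mul ℂ ℂ) s κ
  have e1 : ∀ x, cnv κ s x = w x := by
    intro x
    rw [SchwartzMap.convolution_apply, convolution, cnv]
    congr 1; ext y; simp [mul_comm]
  have conv2 : ∀ u : SchwartzMap ℝ ℂ, ∫⁻ x, ‖u x‖ₑ ^ 2 = ENNReal.ofReal (∫ x, ‖u x‖ ^ 2) := by
    intro u
    rw [ofReal_integral_eq_lintegral_ofReal]
    · congr 1; ext x; rw [← ofReal_norm, ENNReal.ofReal_pow (norm_nonneg _)]
    · exact (u.memLp 2 volume).integrable_norm_pow (by norm_num)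
    · exact Filter.Eventually.of_forall fun x => by positivity
  simp_rw [e1]
  rw [conv2, conv2, ← SchwartzMap.integral_norm_sq_fourier, ← SchwartzMap.integral_norm_sq_fourier s]
  apply ENNReal.ofReal_le_ofReal
  have hI : ∀ u : SchwartzMap ℝ ℂ, Integrable (fun x => ‖u x‖ ^ 2) := fun u => 
    (u.memLp 2 volume).integrable_norm_pow (by norm_num)
  apply integral_mono (hI _) (hI _)
  intro ξ
  beta_reduce
  have : (𝓕 w) ξ = 𝓕 s ξ * 𝓕 κ ξ := by
    rw [SchwartzMap.fourier_convolution]; rfl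
  rw [this, norm_mul, mul_pow]
  have h1 : ‖𝓕 κ ξ‖ ^ 2 ≤ 1 := pow_le_one₀ (norm_nonneg _) (hκ ξ)
  nlinarith [sq_nonneg ‖𝓕 s ξ‖]

lemma L2b_of_fourier (κ : SchwartzMap ℝ ℂ) (hκ : ∀ ξ, ‖𝓕 κ ξ‖ ≤ 1) : L2b κ := by
  intro g hgm hgi ⟨M, hM⟩
  have hg2 : MemLp g 2 := by
    have h1 : MemLp g ⊤ := memLp_top_of_bound hgm.aestronglyMeasurable M (Filter.Eventually.of_forall hM)
    have := memLp_one_iff_integrable.mpr hgi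
    refine (memLp_two_iff_integrable_sq_norm hgm.aestronglyMeasurable).mpr ?_
    simp_rw [sq]
    exact hgi.norm.mul_bdd (c := M) hgm.norm.aestronglyMeasurable (Filter.Eventually.of_forall fun x => by simpa using hM x)
  have hex : ∀ n : ℕ, ∃ s : SchwartzMap ℝ ℂ, eLpNorm (g - ⇑s) 2 volume ≤ ENNReal.ofReal (1 / (n + 1)) := by
    intro n
    obtain ⟨s, h1, h2, h3⟩ := MemLp.exist_eLpNorm_sub_le (μ := volume) (p := 2) (by norm_num) (by norm_num) hg2
      (ε := 1 / ((n:ℝ) + 1)) (by positivity)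
    exact ⟨h1.toSchwartzMap h2, h3⟩
  choose s hs using hex
  have hε : Filter.Tendsto (fun n : ℕ => ENNReal.ofReal (1 / ((n:ℝ) + 1))) Filter.atTop (nhds 0) := by
    rw [← ENNReal.ofReal_zero]
    exact (ENNReal.continuous_ofReal.tendsto 0).comp tendsto_one_div_add_atTop_nhds_zero_nat
  have hpow : ∀ u : ℝ → ℂ, ∫⁻ x, ‖u x‖ₑ ^ 2 = eLpNorm u 2 volume ^ 2 := by
    intro u
    rw [eLpNorm_eq_lintegral_rpow_enorm_toReal (by norm_num) (by norm_num)]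
    simp only [ENNReal.toReal_ofNat, ENNReal.rpow_ofNat, one_div]
    rw [← ENNReal.rpow_natCast, ← ENNReal.rpow_mul]; norm_num
  have hκM : ∃ K, ∀ x, ‖κ x‖ ≤ K := ⟨SchwartzMap.seminorm ℝ 0 0 κ, SchwartzMap.norm_le_seminorm ℝ κ⟩
  obtain ⟨K, hK⟩ := hκM
  have hpt : ∀ x, Filter.Tendsto (fun n => cnv κ (s n) x) Filter.atTop (nhds (cnv κ g x)) := by
    intro x
    rw [tendsto_iff_edist_tendsto_0]
    have hb : ∀ n, edist (cnv κ (s n) x) (cnv κ g x) ≤ 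
        eLpNorm κ 2 volume * ENNReal.ofReal (1 / ((n:ℝ) + 1)) := by
      intro n
      rw [edist_comm, edist_eq_enorm_sub, cnv, cnv, ← integral_sub (cnv_integrable κ.continuous hK hgi x)
        (cnv_integrable κ.continuous hK (s n).integrable x)]
      refine (enorm_integral_le_lintegral_enorm _).trans ?_
      have h1 := ENNReal.lintegral_mul_le_Lp_mul_Lq volume (p := 2) (q := 2) (by constructor <;> norm_num)
        (f := fun y => ‖κ (x - y)‖ₑ) (g := fun y => ‖g y - s n y‖ₑ) 
        (κ.continuous.comp (continuous_const.sub continuous_id)).measurable.enorm.aemeasurable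
        (hgm.sub (s n).continuous.measurable).enorm.aemeasurable
      have h2 : (∫⁻ y, ‖κ (x - y)‖ₑ ^ (2:ℝ)) ^ (1/2:ℝ) = eLpNorm κ 2 volume := by
        rw [eLpNorm_eq_lintegral_rpow_enorm_toReal (by norm_num) (by norm_num)]
        simp only [ENNReal.toReal_ofNat]
        rw [lintegral_sub_left_eq_self (fun y => ‖κ y‖ₑ ^ (2:ℝ)) x]
      have h3 : (∫⁻ y, ‖g y - s n y‖ₑ ^ (2:ℝ)) ^ (1/2:ℝ) = eLpNorm (g - ⇑(s n)) 2 volume := by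
        rw [eLpNorm_eq_lintegral_rpow_enorm_toReal (by norm_num) (by norm_num)]
        simp only [ENNReal.toReal_ofNat, Pi.sub_apply]
      calc _ = ∫⁻ y, ((fun y => ‖κ (x - y)‖ₑ) * (fun y => ‖g y - s n y‖ₑ)) y := by
            congr 1; ext y; rw [← mul_sub, enorm_mul]; rfl
        _ ≤ _ := h1
        _ = eLpNorm κ 2 volume * eLpNorm (g - ⇑(s n)) 2 volume := by rw [← h2, ← h3]
        _ ≤ _ := mul_le_mul_right (hs n) _
    have hz : Filter.Tendsto (fun n : ℕ => eLpNorm κ 2 volume * ENNReal.ofReal (1 / ((n:ℝ) + 1)))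
        Filter.atTop (nhds 0) := by
      have := ENNReal.Tendsto.const_mul (a := eLpNorm κ 2 volume) hε (Or.inr (κ.memLp 2 volume).eLpNorm_ne_top)
      rwa [mul_zero] at this
    exact tendsto_of_tendsto_of_tendsto_of_le_of_le tendsto_const_nhds hz (fun _ => zero_le) hb
  have hF := lintegral_liminf_le (μ := volume) (u := Filter.atTop) (f := fun n x => ‖cnv κ (s n) x‖ₑ ^ 2)
    (fun n => (cnv_meas κ.continuous (s n).continuous.measurable).enorm.pow_const 2)
  have e1 : ∀ x, Filter.liminf (fun n => ‖cnv κ (s n) x‖ₑ ^ 2) Filter.atTop = ‖cnv κ g x‖ₑ ^ 2 := by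
    intro x
    apply Filter.Tendsto.liminf_eq
    exact ENNReal.Tendsto.pow (hpt x).enorm
  simp_rw [e1] at hF
  refine hF.trans ?_
  have hub : ∀ n : ℕ, ∫⁻ x, ‖cnv κ (s n) x‖ₑ ^ 2 ≤ (eLpNorm g 2 volume + ENNReal.ofReal (1 / ((n:ℝ) + 1))) ^ 2 := by
    intro n
    refine (l2_schwartz κ (s n) hκ).trans ?_
    rw [hpow]
    gcongr
    calc eLpNorm (s n) 2 volume = eLpNorm (g - (g - ⇑(s n))) 2 volume := by congr 1; simp
      _ ≤ eLpNorm g 2 volume + eLpNorm (g - ⇑(s n)) 2 volume := 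
        eLpNorm_sub_le hgm.aestronglyMeasurable (hgm.sub (s n).continuous.measurable).aestronglyMeasurable (by norm_num)
      _ ≤ _ := by gcongr; exact hs n
  have hlim : Filter.Tendsto (fun n : ℕ => (eLpNorm g 2 volume + ENNReal.ofReal (1 / ((n:ℝ) + 1))) ^ 2)
      Filter.atTop (nhds (∫⁻ x, ‖g x‖ₑ ^ 2)) := by
    rw [hpow]
    have := (tendsto_const_nhds (x := eLpNorm g 2 volume)).add hε
    rw [add_zero] at this
    exact ENNReal.Tendsto.pow this
  rw [← hlim.liminf_eq]
  exact Filter.liminf_le_liminf (Filter.Eventually.of_forall hub)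

lemma diff_int (κ : SchwartzMap ℝ ℂ) (h : ℝ) :
    ∫⁻ v, ‖κ (v - h) - κ v‖ₑ ≤ ENNReal.ofReal |h| * ∫⁻ v, ‖deriv κ v‖ₑ := by
  have hd : ∀ x, HasDerivAt κ (deriv κ x) x := fun x => (κ.differentiable x).hasDerivAt
  have hdc : Continuous (deriv κ) := κ.smooth 1 |>.continuous_deriv (by norm_num)
  have hpt : ∀ v, ‖κ (v - h) - κ v‖ₑ ≤ ENNReal.ofReal |h| * ∫⁻ s in Set.Ioc (0:ℝ) 1, ‖deriv κ (v - s * h)‖ₑ := by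
    intro v
    have h1 : ∫ s in (0:ℝ)..1, deriv κ (v - s * h) * (-h) = κ (v - h) - κ v := by
      have := intervalIntegral.integral_eq_sub_of_hasDerivAt (a := (0:ℝ)) (b := 1)
        (f := fun s : ℝ => κ (v - s * h)) (f' := fun s => deriv κ (v - s * h) * (-h)) ?_ ?_
      · rw [this]; simp
      · intro s _
        have h2 : HasDerivAt (fun s : ℝ => v - s * h) (-h) s := by
          simpa using ((hasDerivAt_id s).mul_const h).const_sub v
        have := (hd (v - s * h)).scomp s h2
        simpa [mul_comm, Function.comp_def] using this
      · apply Continuous.intervalIntegrable; fun_prop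
    rw [← h1, intervalIntegral.integral_of_le zero_le_one, integral_mul_const, enorm_mul, mul_comm]
    have e : ‖(-h : ℂ)‖ₑ = ENNReal.ofReal |h| := by
      rw [← ofReal_norm]; simp
    rw [e]
    gcongr
    exact enorm_integral_le_lintegral_enorm _
  calc _ ≤ ∫⁻ v, ENNReal.ofReal |h| * ∫⁻ s in Set.Ioc (0:ℝ) 1, ‖deriv κ (v - s * h)‖ₑ := lintegral_mono hpt
    _ = ENNReal.ofReal |h| * ∫⁻ v, ∫⁻ s in Set.Ioc (0:ℝ) 1, ‖deriv κ (v - s * h)‖ₑ :=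
        lintegral_const_mul' _ _ ENNReal.ofReal_ne_top
    _ = ENNReal.ofReal |h| * ∫⁻ s in Set.Ioc (0:ℝ) 1, ∫⁻ v, ‖deriv κ (v - s * h)‖ₑ := by
        rw [lintegral_lintegral_swap]
        apply Measurable.aemeasurable
        exact (Continuous.measurable (by fun_prop : Continuous fun z : ℝ × ℝ => deriv κ (z.1 - z.2 * h))).enorm
    _ = _ := by
        have : ∀ s : ℝ, ∫⁻ v, ‖deriv κ (v - s * h)‖ₑ = ∫⁻ v, ‖deriv κ v‖ₑ := fun s =>
          lintegral_sub_right_eq_self (fun v => ‖deriv κ v‖ₑ) (s * h)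
        simp_rw [this]; simp

lemma tail_int (κ : SchwartzMap ℝ ℂ) {ε : ℝ} (hε : 0 < ε) {h : ℝ} (hh : h ≠ 0) :
    ∫⁻ v in {v | 2 * |h| ≤ |v|}, ‖κ (v - h) - κ v‖ₑ ≤
      2 * (ENNReal.ofReal (|h| ^ (-ε)) * ∫⁻ v, ENNReal.ofReal (|v| ^ ε) * ‖κ v‖ₑ) := by
  have hpos : 0 < |h| := abs_pos.mpr hh
  have hm : Measurable (fun v : ℝ => ENNReal.ofReal (|v| ^ ε) * ‖κ v‖ₑ) := by
    refine Measurable.mul (by fun_prop) κ.continuous.measurable.enorm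
  have hw : ∀ w : ℝ, |h| ≤ |w| → ‖κ w‖ₑ ≤ ENNReal.ofReal (|h| ^ (-ε)) * (ENNReal.ofReal (|w| ^ ε) * ‖κ w‖ₑ) := by
    intro w hw
    rw [← mul_assoc, ← ENNReal.ofReal_mul (by positivity)]
    conv_lhs => rw [← one_mul ‖κ w‖ₑ]
    gcongr
    rw [ENNReal.one_le_ofReal, Real.rpow_neg hpos.le, inv_mul_eq_div, one_le_div (by positivity)]
    gcongr
  have hms : MeasurableSet {v : ℝ | 2 * |h| ≤ |v|} := measurableSet_le measurable_const (by fun_prop)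
  calc _ ≤ ∫⁻ v in {v | 2 * |h| ≤ |v|}, ENNReal.ofReal (|h| ^ (-ε)) *
        (ENNReal.ofReal (|v - h| ^ ε) * ‖κ (v - h)‖ₑ + ENNReal.ofReal (|v| ^ ε) * ‖κ v‖ₑ) := by
        apply setLIntegral_mono' hms
        intro v hv
        replace hv : 2 * |h| ≤ |v| := hv
        refine enorm_sub_le.trans ?_
        rw [mul_add]
        refine add_le_add (hw _ ?_) (hw _ ?_)
        · have := abs_sub_abs_le_abs_sub v h; linarith
        · linarith
    _ ≤ ∫⁻ v, ENNReal.ofReal (|h| ^ (-ε)) *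
        (ENNReal.ofReal (|v - h| ^ ε) * ‖κ (v - h)‖ₑ + ENNReal.ofReal (|v| ^ ε) * ‖κ v‖ₑ) :=
        setLIntegral_le_lintegral _ _
    _ = _ := by
        rw [lintegral_const_mul' _ _ ENNReal.ofReal_ne_top, lintegral_add_right _ hm,
          lintegral_sub_right_eq_self (fun v => ENNReal.ofReal (|v| ^ ε) * ‖κ v‖ₑ) h]
        ring

noncomputable def gC (ε : ℝ) : ENNReal :=
  ENNReal.ofReal ((1024:ℝ) ^ ε) * ∑' k : ℤ, ENNReal.ofReal (((1024:ℝ) ^ (-ε)) ^ k.natAbs)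

lemma gC_fin {ε : ℝ} (hε : 0 < ε) : gC ε ≠ ⊤ := by
  apply ENNReal.mul_ne_top ENNReal.ofReal_ne_top
  have h1 : (1024:ℝ) ^ (-ε) < 1 := Real.rpow_lt_one_of_one_lt_of_neg (by norm_num) (by linarith)
  have hg := summable_geometric_of_lt_one (Real.rpow_nonneg (by norm_num : (0:ℝ) ≤ 1024) (-ε)) h1
  have : Summable (fun k : ℤ => ((1024:ℝ) ^ (-ε)) ^ k.natAbs) := by
    apply Summable.of_nat_of_neg <;> simpa using hg
  exact this.tsum_ofReal_ne_top

/-- dilated sum of kernels -/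
noncomputable def kS (κ : ℝ → ℂ) (S : Finset ℤ) (u : ℝ) : ℂ :=
  ∑ k ∈ S, (((1024:ℝ) ^ k : ℝ) : ℂ) * κ ((1024:ℝ) ^ k * u)

lemma lint_comp_mul {g : ℝ → ENNReal} (hg : Measurable g) {a : ℝ} (ha : a ≠ 0) :
    ∫⁻ x, g x = ENNReal.ofReal |a| * ∫⁻ x, g (a * x) := by
  conv_lhs => rw [← Real.smul_map_volume_mul_left ha]
  rw [lintegral_smul_measure, lintegral_map hg (measurable_const_mul a), smul_eq_mul]

lemma horm_term (κ : SchwartzMap ℝ ℂ) (y : ℝ) (k : ℤ) :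
    ∫⁻ x in {x | 2 * |y| ≤ |x|}, ‖(((1024:ℝ) ^ k : ℝ) : ℂ) * κ ((1024:ℝ) ^ k * (x - y)) -
      (((1024:ℝ) ^ k : ℝ) : ℂ) * κ ((1024:ℝ) ^ k * x)‖ₑ =
    ∫⁻ v in {v | 2 * |(1024:ℝ)^k * y| ≤ |v|}, ‖κ (v - (1024:ℝ)^k * y) - κ v‖ₑ := by
  have hb : (0:ℝ) < (1024:ℝ)^k := by positivity
  have hm : ∀ y : ℝ, MeasurableSet {x : ℝ | 2 * |y| ≤ |x|} := fun y =>
    measurableSet_le measurable_const (by fun_prop)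
  rw [← lintegral_indicator (hm _), ← lintegral_indicator (hm _)]
  have hκ := κ.continuous
  symm
  rw [lint_comp_mul (a := (1024:ℝ)^k) (Measurable.indicator (Continuous.measurable (by fun_prop)).enorm (hm _)) hb.ne',
    ← lintegral_const_mul' _ _ ENNReal.ofReal_ne_top]
  congr 1; ext x
  have e : (2 * |(1024:ℝ)^k * y| ≤ |(1024:ℝ)^k * x|) ↔ 2 * |y| ≤ |x| := by
    rw [abs_mul, abs_mul, abs_of_pos hb, mul_left_comm]
    exact mul_le_mul_iff_right₀ hb
  simp only [Set.indicator, Set.mem_ofPred_eq, e]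
  split_ifs
  · rw [← mul_sub, ← mul_sub, enorm_mul]
    congr 1
    rw [← ofReal_norm, Complex.norm_real]; rfl
  · simp

lemma horm_sum (κ : SchwartzMap ℝ ℂ) {ε : ℝ} (hε : 0 < ε) (hε1 : ε ≤ 1) (S : Finset ℤ) (y : ℝ) :
    ∫⁻ x in {x | 2 * |y| ≤ |x|}, ‖kS κ S (x - y) - kS κ S x‖ₑ ≤ 
      gC ε * ((∫⁻ v, ‖deriv κ v‖ₑ) + 2 * ∫⁻ v, ENNReal.ofReal (|v| ^ ε) * ‖κ v‖ₑ) := by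
  by_cases hy : y = 0
  · simp [hy]
  set D := ∫⁻ v, ‖deriv κ v‖ₑ
  set E := ∫⁻ v, ENNReal.ofReal (|v| ^ ε) * ‖κ v‖ₑ
  have hpos : 0 < |y| := abs_pos.mpr hy
  obtain ⟨k0, hk0, hk1⟩ := exists_mem_Ico_zpow (x := |y|⁻¹) (y := (1024:ℝ)) (by positivity) (by norm_num)
  have hterm : ∀ k : ℤ, ∫⁻ v in {v | 2 * |(1024:ℝ)^k * y| ≤ |v|}, ‖κ (v - (1024:ℝ)^k * y) - κ v‖ₑ ≤
      ENNReal.ofReal ((1024:ℝ) ^ ε) * (ENNReal.ofReal (((1024:ℝ) ^ (-ε)) ^ (k - k0).natAbs) * (D + 2 * E)) := by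
    intro k
    have hr : |(1024:ℝ)^k * y| = (1024:ℝ)^k * |y| := by
      rw [abs_mul, abs_of_pos (by positivity : (0:ℝ) < (1024:ℝ)^k)]
    have hpw : ((1024:ℝ) ^ (-ε)) ^ (k - k0).natAbs = (1024:ℝ) ^ (-ε * |((k - k0 : ℤ) : ℝ)|) := by
      rw [Real.rpow_mul (by norm_num), ← Real.rpow_natCast]
      congr 1; rw [← Int.cast_abs, Int.abs_eq_natAbs]; simp
    rw [← mul_assoc, ← ENNReal.ofReal_mul (by positivity), hpw, ← Real.rpow_add (by norm_num)]
    rcases le_or_gt k k0 with h | h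
    · calc _ ≤ ∫⁻ v, ‖κ (v - (1024:ℝ)^k * y) - κ v‖ₑ := setLIntegral_le_lintegral _ _
        _ ≤ _ := diff_int κ _
        _ ≤ ENNReal.ofReal ((1024:ℝ) ^ (ε + -ε * |((k - k0 : ℤ) : ℝ)|)) * D := by
            gcongr
            rw [hr]
            have h1 : (1024:ℝ)^k0 * |y| ≤ 1 := by
              rw [← le_div_iff₀ hpos, one_div]; exact hk0
            have h2 : (1024:ℝ)^k = (1024:ℝ) ^ ((k - k0 : ℤ):ℝ) * (1024:ℝ)^k0 := by
              rw [Real.rpow_intCast, ← zpow_add₀ (by norm_num)]; congr 1; ring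
            rw [h2, mul_assoc]
            have h3 : ((k - k0 : ℤ) : ℝ) ≤ 0 := by exact_mod_cast (by omega)
            calc (1024:ℝ) ^ ((k - k0 : ℤ):ℝ) * ((1024:ℝ)^k0 * |y|) ≤ (1024:ℝ) ^ ((k - k0 : ℤ):ℝ) * 1 := by gcongr
              _ ≤ _ := by
                rw [mul_one]
                apply Real.rpow_le_rpow_of_exponent_le (by norm_num)
                rw [abs_of_nonpos h3]; nlinarith
        _ ≤ _ := by gcongr; exact le_self_add
    · have hne : (1024:ℝ)^k * y ≠ 0 := mul_ne_zero (by positivity) hy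
      calc _ ≤ _ := tail_int κ hε hne
        _ ≤ 2 * (ENNReal.ofReal ((1024:ℝ) ^ (ε + -ε * |((k - k0 : ℤ) : ℝ)|)) * E) := by
            gcongr
            rw [hr]
            have h1 : 1 ≤ (1024:ℝ)^(k0+1) * |y| := by
              rw [← div_le_iff₀ hpos, one_div]; exact hk1.le
            have h2 : (1024:ℝ)^k = (1024:ℝ) ^ ((k - (k0 + 1) : ℤ):ℝ) * (1024:ℝ)^(k0+1) := by
              rw [Real.rpow_intCast, ← zpow_add₀ (by norm_num)]; congr 1; ring
            have h3 : (0:ℝ) ≤ ((k - k0 : ℤ) : ℝ) := by exact_mod_cast (by omega)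
            have h4 : (1024:ℝ) ^ ((k - (k0 + 1) : ℤ):ℝ) ≤ (1024:ℝ)^k * |y| := by
              rw [h2, mul_assoc]; exact le_mul_of_one_le_right (by positivity) h1
            calc ((1024:ℝ)^k * |y|) ^ (-ε) ≤ ((1024:ℝ) ^ ((k - (k0 + 1) : ℤ):ℝ)) ^ (-ε) :=
                  Real.rpow_le_rpow_of_nonpos (by positivity) h4 (by linarith)
              _ = _ := by
                rw [← Real.rpow_mul (by norm_num), abs_of_nonneg h3]; congr 1; push_cast; ring
        _ = ENNReal.ofReal ((1024:ℝ) ^ (ε + -ε * |((k - k0 : ℤ) : ℝ)|)) * (2 * E) := by ring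
        _ ≤ _ := by gcongr; exact le_add_self
  calc _ ≤ ∫⁻ x in {x | 2 * |y| ≤ |x|}, ∑ k ∈ S, ‖(((1024:ℝ) ^ k : ℝ) : ℂ) * κ ((1024:ℝ) ^ k * (x - y)) -
      (((1024:ℝ) ^ k : ℝ) : ℂ) * κ ((1024:ℝ) ^ k * x)‖ₑ := by
        apply lintegral_mono
        intro x
        beta_reduce
        rw [kS, kS, ← Finset.sum_sub_distrib]
        exact enorm_sum_le _ _
    _ = ∑ k ∈ S, ∫⁻ v in {v | 2 * |(1024:ℝ)^k * y| ≤ |v|}, ‖κ (v - (1024:ℝ)^k * y) - κ v‖ₑ := by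
        rw [lintegral_finsetSum]
        · exact Finset.sum_congr rfl fun k _ => horm_term κ y k
        · intro k _
          have := κ.continuous
          exact (Continuous.measurable (by fun_prop)).enorm
    _ ≤ ∑ k ∈ S, ENNReal.ofReal ((1024:ℝ) ^ ε) * (ENNReal.ofReal (((1024:ℝ) ^ (-ε)) ^ (k - k0).natAbs) * (D + 2 * E)) :=
        Finset.sum_le_sum fun k _ => hterm k
    _ ≤ ∑' k : ℤ, ENNReal.ofReal ((1024:ℝ) ^ ε) * (ENNReal.ofReal (((1024:ℝ) ^ (-ε)) ^ (k - k0).natAbs) * (D + 2 * E)) :=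
        ENNReal.sum_le_tsum _
    _ = _ := by
        rw [ENNReal.tsum_mul_left, ENNReal.tsum_mul_right, gC, mul_assoc]
        congr 2
        exact (Equiv.subRight k0).tsum_eq (fun k : ℤ => ENNReal.ofReal (((1024:ℝ) ^ (-ε)) ^ k.natAbs))

lemma scale_schwartz (a : SchwartzMap ℝ ℂ) (c : ℝ) (hc : 0 < c) :
    ∃ b : SchwartzMap ℝ ℂ, (∀ ξ, b ξ = a (c⁻¹ * ξ)) ∧ ∀ u, (𝓕⁻ b) u = (c : ℂ) * (𝓕⁻ a) (c * u) := by
  have hc' : c⁻¹ ≠ 0 := inv_ne_zero hc.ne'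
  refine ⟨SchwartzMap.compCLMOfContinuousLinearEquiv ℂ 
    (ContinuousLinearEquiv.unitsEquivAut ℝ (Units.mk0 c⁻¹ hc')) a, fun ξ => ?_, fun u => ?_⟩
  · simp [mul_comm]
  · rw [SchwartzMap.fourierInv_coe, SchwartzMap.fourierInv_coe, Real.fourierInv_eq, Real.fourierInv_eq]
    have := Measure.integral_comp_mul_left (fun v => Real.fourierChar (inner ℝ v (c * u)) • a v) c⁻¹
    rw [inv_inv, abs_of_pos hc] at this
    rw [← Complex.real_smul, ← this]
    congr 1; ext v
    simp only [SchwartzMap.compCLMOfContinuousLinearEquiv_apply, Function.comp]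
    congr 2
    · simp; field_simp
    · simp [mul_comm]

lemma kS_schwartz (a : SchwartzMap ℝ ℂ) (S : Finset ℤ) :
    ∃ b : SchwartzMap ℝ ℂ, (∀ ξ, b ξ = ∑ k ∈ S, a (((1024:ℝ)^k)⁻¹ * ξ)) ∧ 
      ∀ u, (𝓕⁻ b) u = kS ⇑(𝓕⁻ a : SchwartzMap ℝ ℂ) S u := by
  classical
  induction S using Finset.induction_on with
  | empty => refine ⟨0, fun ξ => by simp, fun u => ?_⟩; simp [kS]
  | insert k S hk ih =>
    obtain ⟨b, hb1, hb2⟩ := ih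
    obtain ⟨b', h1, h2⟩ := scale_schwartz a ((1024:ℝ)^k) (by positivity)
    refine ⟨b' + b, fun ξ => ?_, fun u => ?_⟩
    · rw [Finset.sum_insert hk, add_apply, h1, hb1]
    · rw [FourierTransform.fourierInv_add, add_apply, h2, hb2, kS, kS, Finset.sum_insert hk]

lemma cnv_smul (c : ℂ) (κ f : ℝ → ℂ) (x : ℝ) : cnv (fun u => c * κ u) f x = c * cnv κ f x := by
  rw [cnv, cnv, ← integral_const_mul]; congr 1; ext y; ring

theorem kernel_Lp {p : ℝ} (hp : 1 < p) {ε : ℝ} (hε : 0 < ε) (hε1 : ε ≤ 1) : ∃ C : NNReal, 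
    ∀ (a : SchwartzMap ℝ ℂ) (S : Finset ℤ) (A : ℝ), 0 < A →
    (∀ ξ, ‖∑ k ∈ S, a (((1024:ℝ)^k)⁻¹ * ξ)‖ ≤ A) →
    gC ε * ((∫⁻ v, ‖deriv (𝓕⁻ a : SchwartzMap ℝ ℂ) v‖ₑ) + 
      2 * ∫⁻ v, ENNReal.ofReal (|v| ^ ε) * ‖(𝓕⁻ a) v‖ₑ) ≤ ENNReal.ofReal A →
    ∀ f : ℝ → ℂ, Continuous f → Integrable f → (∃ M, ∀ x, ‖f x‖ ≤ M) →
    ∫⁻ x, ‖cnv (kS ⇑(𝓕⁻ a : SchwartzMap ℝ ℂ) S) f x‖ₑ ^ p ≤ C * ENNReal.ofReal A ^ p * ∫⁻ x, ‖f x‖ₑ ^ p := by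
  obtain ⟨C, hC⟩ := cz_Lp hp
  refine ⟨C, fun a S A hA h1 h2 f hc hf hb => ?_⟩
  obtain ⟨b, hb1, hb2⟩ := kS_schwartz a S
  set κ : SchwartzMap ℝ ℂ := (A⁻¹ : ℂ) • (𝓕⁻ b) with hκ
  have hκe : (κ : ℝ → ℂ) = fun u => (A⁻¹ : ℂ) * kS ⇑(𝓕⁻ a : SchwartzMap ℝ ℂ) S u := by
    ext u; rw [hκ, smul_apply, hb2, smul_eq_mul]
  have hH : Horm κ := by
    intro y
    have := horm_sum (𝓕⁻ a) hε hε1 S y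
    rw [hκe]
    calc _ = ∫⁻ x in {x | 2 * |y| ≤ |x|}, ENNReal.ofReal A⁻¹ * ‖kS ⇑(𝓕⁻ a : SchwartzMap ℝ ℂ) S (x - y) - kS ⇑(𝓕⁻ a : SchwartzMap ℝ ℂ) S x‖ₑ := by
          congr 1; ext x; rw [← mul_sub, enorm_mul]; congr 1
          rw [← ofReal_norm, norm_inv, Complex.norm_real, Real.norm_of_nonneg hA.le]
      _ = ENNReal.ofReal A⁻¹ * ∫⁻ x in {x | 2 * |y| ≤ |x|}, ‖kS ⇑(𝓕⁻ a : SchwartzMap ℝ ℂ) S (x - y) - kS ⇑(𝓕⁻ a : SchwartzMap ℝ ℂ) S x‖ₑ :=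
          lintegral_const_mul' _ _ ENNReal.ofReal_ne_top
      _ ≤ ENNReal.ofReal A⁻¹ * ENNReal.ofReal A := by gcongr; exact this.trans h2
      _ = 1 := by rw [← ENNReal.ofReal_mul (by positivity), inv_mul_cancel₀ hA.ne', ENNReal.ofReal_one]
  have hL : L2b κ := by
    apply L2b_of_fourier
    intro ξ
    rw [hκ, FourierTransform.fourier_smul, FourierTransform.fourier_fourierInv_eq, smul_apply, hb1, norm_smul,
      norm_inv, Complex.norm_real, Real.norm_of_nonneg hA.le, inv_mul_le_iff₀ hA, mul_one]
    exact h1 ξ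
  have := hC κ κ.continuous ⟨SchwartzMap.seminorm ℝ 0 0 κ, SchwartzMap.norm_le_seminorm ℝ κ⟩ κ.integrable
    hH hL f hc hf hb
  calc ∫⁻ x, ‖cnv (kS ⇑(𝓕⁻ a : SchwartzMap ℝ ℂ) S) f x‖ₑ ^ p = ∫⁻ x, ENNReal.ofReal A ^ p * ‖cnv κ f x‖ₑ ^ p := by
        congr 1; ext x
        rw [← ENNReal.mul_rpow_of_nonneg _ _ (by linarith), hκe, cnv_smul, enorm_mul, ← mul_assoc]
        have : ENNReal.ofReal A * ‖(A⁻¹ : ℂ)‖ₑ = 1 := by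
          rw [← ofReal_norm, norm_inv, Complex.norm_real, Real.norm_of_nonneg hA.le,
            ← ENNReal.ofReal_mul hA.le, mul_inv_cancel₀ hA.ne', ENNReal.ofReal_one]
        rw [this, one_mul]
    _ = ENNReal.ofReal A ^ p * ∫⁻ x, ‖cnv κ f x‖ₑ ^ p :=
        lintegral_const_mul' _ _ (ENNReal.rpow_ne_top_of_nonneg (by linarith) ENNReal.ofReal_ne_top)
    _ ≤ ENNReal.ofReal A ^ p * (C * ∫⁻ x, ‖f x‖ₑ ^ p) := by gcongr
    _ = _ := by ring

/-- convolution in the `j`th variable -/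
noncomputable def cnvJ {m : ℕ} (κ : ℝ → ℂ) (j : Fin (m+1)) (F : (Fin (m+1) → ℝ) → ℂ) (x : Fin (m+1) → ℝ) : ℂ :=
  ∫ y, κ (x j - y) * F (Function.update x j y)

lemma schwartz_decay {m : ℕ} (F : SchwartzMap (Fin (m+1) → ℝ) ℂ) :
    ∃ C, ∀ x, ‖F x‖ ≤ C * (1 + ‖x‖) ^ (-2:ℝ) := by
  refine ⟨2 ^ 2 * (((Finset.Iic (2, 0)).sup fun m => SchwartzMap.seminorm ℝ m.1 m.2) F), fun x => ?_⟩
  have := SchwartzMap.one_add_le_sup_seminorm_apply (𝕜 := ℝ) (m := (2,0)) le_rfl le_rfl F x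
  rw [norm_iteratedFDeriv_zero] at this
  rw [Real.rpow_neg (by positivity), ← div_eq_mul_inv, le_div_iff₀ (by positivity), mul_comm]
  exact_mod_cast this

lemma fiber_integrable {m : ℕ} (F : SchwartzMap (Fin (m+1) → ℝ) ℂ) (j : Fin (m+1)) (x : Fin (m+1) → ℝ) :
    Integrable (fun y => F (Function.update x j y)) := by
  obtain ⟨C, hC⟩ := schwartz_decay F
  have hC0 : 0 ≤ C := by
    have := (norm_nonneg _).trans (hC 0); simpa using this
  have h1 : Integrable (fun y : ℝ => C * (1 + ‖y‖) ^ (-2:ℝ)) :=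
    (integrable_one_add_norm (by simp)).const_mul C
  refine h1.mono' ?_ (Filter.Eventually.of_forall fun y => ?_)
  · exact (F.continuous.comp (continuous_const.update j continuous_id)).aestronglyMeasurable
  · refine (hC _).trans ?_
    refine mul_le_mul_of_nonneg_left ?_ hC0
    apply Real.rpow_le_rpow_of_nonpos (by positivity) _ (by norm_num)
    gcongr
    have := norm_le_pi_norm (Function.update x j y) j
    simpa using this

lemma lift_fiber {m : ℕ} {κ : ℝ → ℂ} (hκ : Continuous κ) {p : ℝ} {K : ENNReal}
    (h : ∀ f : ℝ → ℂ, Continuous f → Integrable f → (∃ M, ∀ x, ‖f x‖ ≤ M) →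
      ∫⁻ x, ‖cnv κ f x‖ₑ ^ p ≤ K * ∫⁻ x, ‖f x‖ₑ ^ p) (hK : K ≠ ⊤)
    (F : SchwartzMap (Fin (m+1) → ℝ) ℂ) (j : Fin (m+1)) (hm : Measurable (cnvJ κ j F)) :
    ∫⁻ x, ‖cnvJ κ j F x‖ₑ ^ p ≤ K * ∫⁻ x, ‖F x‖ₑ ^ p := by
  have hmp := (volume_preserving_piFinSuccAbove (fun _ : Fin (m+1) => ℝ) j).symm
  have key : ∀ g : (Fin (m+1) → ℝ) → ENNReal, Measurable g → 
      ∫⁻ x, g x = ∫⁻ w : Fin m → ℝ, ∫⁻ z : ℝ, g (j.insertNth z w) := by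
    intro g hg
    rw [← hmp.lintegral_comp hg, Measure.volume_eq_prod, lintegral_prod_symm']
    · rfl
    · exact hg.comp (MeasurableEquiv.measurable _)
  have hFm : Measurable (fun x => ‖F x‖ₑ ^ p) := F.continuous.measurable.enorm.pow_const p
  rw [key _ (hm.enorm.pow_const p), key _ hFm, ← lintegral_const_mul' _ _ hK]
  apply lintegral_mono
  intro w
  beta_reduce
  have hupd : ∀ y, (j.insertNth y w : Fin (m+1) → ℝ) = Function.update (j.insertNth 0 w : Fin (m+1) → ℝ) j y := by
    intro y; rw [Fin.update_insertNth]
  have hc : Continuous (fun y => F (j.insertNth y w)) := by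
    have := F.continuous.comp ((continuous_const (y := (j.insertNth 0 w : Fin (m+1) → ℝ))).update j continuous_id)
    refine this.congr fun y => ?_
    rw [hupd y]; rfl
  have hi : Integrable (fun y => F (j.insertNth y w)) := by
    have := fiber_integrable F j (j.insertNth 0 w)
    refine this.congr (Filter.Eventually.of_forall fun y => ?_)
    beta_reduce
    rw [hupd y]
  have := h (fun y => F (j.insertNth y w)) hc hi ⟨SchwartzMap.seminorm ℝ 0 0 F, fun x => SchwartzMap.norm_le_seminorm ℝ F _⟩
  refine le_trans (le_of_eq ?_) this
  congr 1; ext z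
  congr 2
  rw [cnvJ, cnv]
  congr 1; ext y
  rw [Fin.insertNth_apply_same, Fin.update_insertNth]

noncomputable def ex (x : ℝ) : ℂ := Complex.exp (((2 * Real.pi * x : ℝ) : ℂ) * Complex.I)

lemma ex_norm (x : ℝ) : ‖ex x‖ = 1 := Complex.norm_exp_ofReal_mul_I _

lemma ex_add (x y : ℝ) : ex (x + y) = ex x * ex y := by
  rw [ex, ex, ex, ← Complex.exp_add]; congr 1; push_cast; ring

lemma ex_zero : ex 0 = 1 := by simp [ex]

lemma ex_sum {ι : Type*} (s : Finset ι) (f : ι → ℝ) : ex (∑ i ∈ s, f i) = ∏ i ∈ s, ex (f i) := by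
  classical
  induction s using Finset.induction_on with
  | empty => simp [ex_zero]
  | insert a s ha ih => rw [Finset.sum_insert ha, Finset.prod_insert ha, ex_add, ih]

lemma ex_contDiff : ContDiff ℝ (⊤ : ℕ∞) ex := by
  unfold ex
  refine ContDiff.cexp (ContDiff.mul ?_ contDiff_const)
  exact Complex.ofRealCLM.contDiff.comp (contDiff_const.mul contDiff_id)

lemma ex_cont : Continuous ex := ex_contDiff.continuous

noncomputable def eqv (n : ℕ) : EuclideanSpace ℝ (Fin n) ≃L[ℝ] (Fin n → ℝ) := EuclideanSpace.equiv (Fin n) ℝ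

noncomputable def toE {n : ℕ} (F : SchwartzMap (Fin n → ℝ) ℂ) : SchwartzMap (EuclideanSpace ℝ (Fin n)) ℂ :=
  SchwartzMap.compCLMOfContinuousLinearEquiv ℂ (eqv n) F

noncomputable def ofE {n : ℕ} (F : SchwartzMap (EuclideanSpace ℝ (Fin n)) ℂ) : SchwartzMap (Fin n → ℝ) ℂ :=
  SchwartzMap.compCLMOfContinuousLinearEquiv ℂ (eqv n).symm F

lemma toE_apply {n : ℕ} (F : SchwartzMap (Fin n → ℝ) ℂ) (x) : toE F x = F (WithLp.ofLp x) := rfl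
lemma ofE_apply {n : ℕ} (F : SchwartzMap (EuclideanSpace ℝ (Fin n)) ℂ) (x) : ofE F x = F (WithLp.toLp 2 x) := rfl
lemma toE_ofE {n : ℕ} (F : SchwartzMap (EuclideanSpace ℝ (Fin n)) ℂ) : toE (ofE F) = F := by
  ext x; rfl

lemma integral_E {n : ℕ} (f : EuclideanSpace ℝ (Fin n) → ℂ) :
    ∫ x, f x = ∫ y : Fin n → ℝ, f (WithLp.toLp 2 y) := by
  rw [← (PiLp.volume_preserving_toLp (Fin n)).integral_comp
    (MeasurableEquiv.toLp 2 (Fin n → ℝ)).measurableEmbedding]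

lemma fourierT_eq {n : ℕ} (F : SchwartzMap (Fin n → ℝ) ℂ) (ξ : Fin n → ℝ) :
    fourierT n F ξ = ofE (𝓕 (toE F)) ξ := by
  rw [ofE_apply, SchwartzMap.fourier_coe, Real.fourier_eq', integral_E, fourierT]
  congr 1; ext x
  rw [toE_apply, smul_eq_mul]
  congr 5
  rw [PiLp.inner_apply]
  congr 1; ext j; simp [mul_comm]

lemma exists_fourierT {n : ℕ} (F : SchwartzMap (Fin n → ℝ) ℂ) :
    ∃ G : SchwartzMap (Fin n → ℝ) ℂ, (∀ ξ, fourierT n F ξ = G ξ) ∧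
      ∀ x, F x = ∫ ξ, ex (∑ j, x j * ξ j) * G ξ := by
  refine ⟨ofE (𝓕 (toE F)), fourierT_eq F, fun x => ?_⟩
  have h : 𝓕⁻ (𝓕 (toE F)) = toE F := FourierTransform.fourierInv_fourier_eq _
  have h2 : (𝓕⁻ (𝓕 (toE F))) (WithLp.toLp 2 x) = F x := by rw [h]; rfl
  rw [← h2, SchwartzMap.fourierInv_coe, Real.fourierInv_eq', integral_E]
  congr 1

lemma exists_inv {n : ℕ} (G : SchwartzMap (Fin n → ℝ) ℂ) :
    ∃ F : SchwartzMap (Fin n → ℝ) ℂ, ∀ ξ, fourierT n F ξ = G ξ := by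
  refine ⟨ofE (𝓕⁻ (toE G)), fun ξ => ?_⟩
  rw [fourierT_eq, toE_ofE, FourierTransform.fourier_fourierInv_eq]; rfl

lemma fourier_ex (A : SchwartzMap ℝ ℂ) (ξ : ℝ) :
    A ξ = ∫ u, ex (-(u * ξ)) * (𝓕⁻ A : SchwartzMap ℝ ℂ) u := by
  have h : 𝓕 (𝓕⁻ A) = A := FourierTransform.fourier_fourierInv_eq _
  conv_lhs => rw [← h]
  rw [SchwartzMap.fourier_coe, Real.fourier_eq']
  congr 1; ext u
  rw [smul_eq_mul, ex]
  congr 4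
  simp; ring

/-- one-coordinate Fourier multiplier -/
lemma exists_T {m : ℕ} (A : SchwartzMap ℝ ℂ) (j : Fin (m+1)) (F : SchwartzMap (Fin (m+1) → ℝ) ℂ) :
    ∃ F' : SchwartzMap (Fin (m+1) → ℝ) ℂ, (∀ ξ, fourierT (m+1) F' ξ = A (ξ j) * fourierT (m+1) F ξ) ∧
      ∀ x, F' x = cnvJ (𝓕⁻ A : SchwartzMap ℝ ℂ) j F x := by
  obtain ⟨G, hG, hF⟩ := exists_fourierT F
  have htg : (fun ξ : Fin (m+1) → ℝ => A (ξ j)).HasTemperateGrowth :=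
    Function.HasTemperateGrowth.comp (SchwartzMap.hasTemperateGrowth A)
      (ContinuousLinearMap.hasTemperateGrowth (ContinuousLinearMap.proj (R := ℝ) (φ := fun _ : Fin (m+1) => ℝ) j))
  obtain ⟨F', hF'⟩ := exists_inv (SchwartzMap.smulLeftCLM ℂ (fun ξ : Fin (m+1) → ℝ => A (ξ j)) G)
  obtain ⟨G', hG', hFF⟩ := exists_fourierT F'
  have hGG : ∀ ξ, G' ξ = A (ξ j) * G ξ := by
    intro ξ; rw [← hG', hF', SchwartzMap.smulLeftCLM_apply_apply htg, smul_eq_mul]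
  refine ⟨F', fun ξ => by rw [hG', hGG, hG], fun x => ?_⟩
  rw [hFF, cnvJ]
  set κ : SchwartzMap ℝ ℂ := 𝓕⁻ A with hκ
  have e1 : ∀ ξ, ex (∑ i, x i * ξ i) * G' ξ
      = ∫ u, ex (∑ i, x i * ξ i) * (ex (-(u * ξ j)) * κ u) * G ξ := by
    intro ξ
    rw [hGG, fourier_ex A, integral_mul_const, integral_const_mul]; ring
  simp_rw [e1]
  rw [integral_integral_swap]
  · have e2 : ∀ u, (∫ ξ : Fin (m+1) → ℝ, ex (∑ i, x i * ξ i) * (ex (-(u * ξ j)) * κ u) * G ξ)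
        = κ u * F (Function.update x j (x j - u)) := by
      intro u
      rw [hF, ← integral_const_mul]
      congr 1; ext ξ
      have : ∑ i, Function.update x j (x j - u) i * ξ i = ∑ i, x i * ξ i + (-(u * ξ j)) := by
        rw [← Finset.add_sum_erase _ _ (Finset.mem_univ j), ← Finset.add_sum_erase _ (fun i => x i * ξ i) (Finset.mem_univ j)]
        rw [Function.update_self]
        rw [Finset.sum_congr rfl (g := fun i => x i * ξ i)]
        · ring
        · intro i hi
          rw [Function.update_of_ne (Finset.ne_of_mem_erase hi)]
      rw [this, ex_add]; ring
    simp_rw [e2]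
    rw [← integral_sub_left_eq_self _ volume (x j)]
    simp
  · have hi := (G.integrable (μ := volume)).mul_prod (κ.integrable (μ := volume))
    refine hi.norm.mono' ?_ (Filter.Eventually.of_forall ?_)
    · apply Continuous.aestronglyMeasurable
      have := ex_cont; have := κ.continuous; have := G.continuous
      fun_prop
    · rintro ⟨ξ, u⟩
      simp [ex_norm, mul_comm]

lemma schw_top {n : ℕ} (F : SchwartzMap (Fin n → ℝ) ℂ) (q : ENNReal) : eLpNorm (⇑F) q volume ≠ ⊤ := by
  have h := SchwartzMap.memLp F q volume
  exact h.eLpNorm_ne_top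

lemma T_exists {m : ℕ} {p ε : ℝ} (hp : 1 < p) (hε : 0 < ε) (hε1 : ε ≤ 1) :
    ∃ C : ℝ, 0 ≤ C ∧ ∀ (a : SchwartzMap ℝ ℂ) (S : Finset ℤ) (A : ℝ), 0 < A →
      (∀ ξ, ‖∑ k ∈ S, a (((1024:ℝ) ^ k)⁻¹ * ξ)‖ ≤ A) →
      gC ε * ((∫⁻ v, ‖deriv (𝓕⁻ a : SchwartzMap ℝ ℂ) v‖ₑ) + 2 * ∫⁻ v, ENNReal.ofReal (|v| ^ ε) * ‖(𝓕⁻ a : SchwartzMap ℝ ℂ) v‖ₑ)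
        ≤ ENNReal.ofReal A →
      ∀ (j : Fin (m+1)) (F : SchwartzMap (Fin (m+1) → ℝ) ℂ), ∃ F' : SchwartzMap (Fin (m+1) → ℝ) ℂ,
        (∀ ξ, fourierT (m+1) F' ξ = (∑ k ∈ S, a (((1024:ℝ) ^ k)⁻¹ * ξ j)) * fourierT (m+1) F ξ) ∧
        (eLpNorm (⇑F') (ENNReal.ofReal p) volume).toReal
          ≤ C * A * (eLpNorm (⇑F) (ENNReal.ofReal p) volume).toReal := by
  obtain ⟨C, hC⟩ := kernel_Lp hp hε hε1
  have hp0 : 0 < p := by linarith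
  refine ⟨(C:ℝ) ^ (1/p), by positivity, fun a S A hA h1 h2 j F => ?_⟩
  obtain ⟨b, hb, hk⟩ := kS_schwartz a S
  obtain ⟨F', hF', hc⟩ := exists_T b j F
  refine ⟨F', fun ξ => by rw [hF', hb], ?_⟩
  have hk' : (⇑(𝓕⁻ b : SchwartzMap ℝ ℂ)) = kS ⇑(𝓕⁻ a : SchwartzMap ℝ ℂ) S := funext hk
  have hcc : Continuous (⇑(𝓕⁻ b : SchwartzMap ℝ ℂ)) := SchwartzMap.continuous _
  have hC' := hC a S A hA h1 h2
  have hc' : cnvJ (⇑(𝓕⁻ b : SchwartzMap ℝ ℂ)) j F = ⇑F' := (funext hc).symm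
  rw [← hk'] at hC'
  clear hk hk' hC hc
  generalize (⇑(𝓕⁻ b : SchwartzMap ℝ ℂ)) = κ at *
  have hKt : (C:ENNReal) * ENNReal.ofReal A ^ p ≠ ⊤ :=
    ENNReal.mul_ne_top ENNReal.coe_ne_top (ENNReal.rpow_ne_top_of_nonneg hp0.le ENNReal.ofReal_ne_top)
  have key := lift_fiber hcc hC' hKt F j (by rw [hc']; exact F'.continuous.measurable)
  rw [hc'] at key
  have hpp : ENNReal.ofReal p ≠ 0 := (ENNReal.ofReal_pos.2 hp0).ne'
  have : eLpNorm (⇑F') (ENNReal.ofReal p) volume ≤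
      (C:ENNReal) ^ (1/p) * ENNReal.ofReal A * eLpNorm (⇑F) (ENNReal.ofReal p) volume := by
    rw [eLpNorm_eq_lintegral_rpow_enorm_toReal hpp ENNReal.ofReal_ne_top,
      eLpNorm_eq_lintegral_rpow_enorm_toReal hpp ENNReal.ofReal_ne_top, ENNReal.toReal_ofReal hp0.le]
    refine (ENNReal.rpow_le_rpow key (by positivity)).trans (le_of_eq ?_)
    rw [ENNReal.mul_rpow_of_nonneg _ _ (by positivity), ENNReal.mul_rpow_of_nonneg _ _ (by positivity),
      ← ENNReal.rpow_mul, mul_one_div_cancel hp0.ne', ENNReal.rpow_one]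
  have h3 := ENNReal.toReal_mono (ENNReal.mul_ne_top (ENNReal.mul_ne_top
    (ENNReal.rpow_ne_top_of_nonneg (by positivity) ENNReal.coe_ne_top) ENNReal.ofReal_ne_top) (schw_top F _)) this
  rwa [ENNReal.toReal_mul, ENNReal.toReal_mul, ENNReal.toReal_ofReal hA.le, ← ENNReal.toReal_rpow,
    ENNReal.coe_toReal] at h3

lemma B_sep {z : ℝ} {k k' : ℤ} (h1 : 1/4 ≤ |((1024:ℝ)^k)⁻¹ * z|) (h2 : |((1024:ℝ)^k)⁻¹ * z| ≤ 4)
    (h1' : 1/4 ≤ |((1024:ℝ)^k')⁻¹ * z|) (h2' : |((1024:ℝ)^k')⁻¹ * z| ≤ 4) : k = k' := by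
  have aux : ∀ k k' : ℤ, 1/4 ≤ |((1024:ℝ)^k')⁻¹ * z| → |((1024:ℝ)^k)⁻¹ * z| ≤ 4 → k' ≤ k := by
    intro k k' h1 h2
    by_contra hlt
    push Not at hlt
    have h3 : (1024:ℝ)^k' ≥ 1024 * (1024:ℝ)^k := by
      rw [← zpow_one_add₀ (by norm_num)]
      exact zpow_le_zpow_right₀ (by norm_num) (by omega)
    have p1 : (0:ℝ) < 1024^k := by positivity
    have p2 : (0:ℝ) < 1024^k' := by positivity
    rw [abs_mul, abs_of_pos (inv_pos.2 p1), inv_mul_le_iff₀ p1] at h2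
    rw [abs_mul, abs_of_pos (inv_pos.2 p2), le_inv_mul_iff₀ p2] at h1
    nlinarith
  exact le_antisymm (aux k' k h1 h2') (aux k k' h1' h2)

lemma sum_ann_le {w : ℝ → ℂ} (hw : ∀ z, w z ≠ 0 → 1/4 ≤ |z| ∧ |z| ≤ 4) {M : ℝ} (hM : ∀ z, ‖w z‖ ≤ M)
    (S : Finset ℤ) (ξ : ℝ) : ‖∑ k ∈ S, w (((1024:ℝ) ^ k)⁻¹ * ξ)‖ ≤ M := by
  by_cases h : ∃ k ∈ S, w (((1024:ℝ) ^ k)⁻¹ * ξ) ≠ 0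
  · obtain ⟨k, hk, hne⟩ := h
    rw [Finset.sum_eq_single_of_mem k hk]
    · exact hM _
    · intro k' _ hkk
      by_contra h'
      exact hkk (B_sep (hw _ h').1 (hw _ h').2 (hw _ hne).1 (hw _ hne).2)
  · push Not at h
    rw [Finset.sum_eq_zero h, norm_zero]
    exact (norm_nonneg _).trans (hM 0)

lemma schwartz_lint_pow (κ : SchwartzMap ℝ ℂ) {ε : ℝ} (hε : 0 < ε) (hε1 : ε ≤ 1) :
    ∫⁻ v, ENNReal.ofReal (|v| ^ ε) * ‖κ v‖ₑ ≠ ⊤ := by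
  have h1 := κ.integrable (μ := volume)
  have h2 := κ.integrable_pow_mul (volume) 1
  have h3 : Integrable (fun v => |v|^ε * ‖κ v‖) := by
    refine (h1.norm.add h2).mono' ?_ (Filter.Eventually.of_forall fun v => ?_)
    · refine Continuous.aestronglyMeasurable ?_
      have := κ.continuous
      have h : Continuous fun v : ℝ => |v| ^ ε := continuous_abs.rpow_const fun x => Or.inr hε.le
      fun_prop
    · rw [Real.norm_of_nonneg (by positivity)]
      have : |v|^ε ≤ 1 + |v| := by
        rcases le_total |v| 1 with h | h
        · exact (Real.rpow_le_one (abs_nonneg _) h hε.le).trans (by linarith [abs_nonneg v])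
        · refine (Real.rpow_le_rpow_of_exponent_le h hε1).trans ?_
          rw [Real.rpow_one]; linarith
      simp only [Pi.add_apply, pow_one, Real.norm_eq_abs]
      nlinarith [norm_nonneg (κ v)]
  have h4 := h3.2
  rw [hasFiniteIntegral_iff_enorm] at h4
  refine ne_of_lt (lt_of_le_of_lt (le_of_eq ?_) h4)
  congr 1; ext v
  rw [enorm_mul, enorm_norm, Real.enorm_of_nonneg (by positivity)]

lemma T_mod {m : ℕ} {p ε : ℝ} (hp : 1 < p) (hε : 0 < ε) (hε1 : ε ≤ 1) {w : ℝ → ℂ}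
    (hw : ContDiff ℝ (⊤ : ℕ∞) w) (hs : ∀ z, w z ≠ 0 → 1/4 ≤ |z| ∧ |z| ≤ 4) :
    ∃ C : ℝ, 0 ≤ C ∧ ∀ (γ : ℝ) (S : Finset ℤ) 
      (j : Fin (m+1)) (F : SchwartzMap (Fin (m+1) → ℝ) ℂ), ∃ F' : SchwartzMap (Fin (m+1) → ℝ) ℂ,
        (∀ ξ, fourierT (m+1) F' ξ = (∑ k ∈ S, ex (γ * (((1024:ℝ) ^ k)⁻¹ * ξ j)) * w (((1024:ℝ) ^ k)⁻¹ * ξ j))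
            * fourierT (m+1) F ξ) ∧
        (eLpNorm (⇑F') (ENNReal.ofReal p) volume).toReal
          ≤ C * (1 + |γ|) ^ ε * (eLpNorm (⇑F) (ENNReal.ofReal p) volume).toReal := by
  obtain ⟨C, hC0, hC⟩ := T_exists (m := m) hp hε hε1
  have hcs : HasCompactSupport w := by
    refine HasCompactSupport.intro (isCompact_Icc (a := (-4:ℝ)) (b := 4)) fun x hx => ?_
    by_contra h
    exact hx (abs_le.1 (hs x h).2)
  have hsm : ∀ γ : ℝ, ContDiff ℝ (⊤ : ℕ∞) (fun z => ex (γ * z) * w z) := fun γ =>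
    (ex_contDiff.comp (contDiff_const.mul contDiff_id)).mul hw
  have hcs' : ∀ γ : ℝ, HasCompactSupport (fun z => ex (γ * z) * w z) := fun γ => hcs.mul_left
  let κ₀ : SchwartzMap ℝ ℂ := 𝓕⁻ (hcs.toSchwartzMap hw)
  let a : ℝ → SchwartzMap ℝ ℂ := fun γ => (hcs' γ).toSchwartzMap (hsm γ)
  have ha : ∀ γ z, a γ z = ex (γ * z) * w z := fun γ z => rfl
  have hκ : ∀ γ u, (𝓕⁻ (a γ) : SchwartzMap ℝ ℂ) u = κ₀ (u + γ) := by
    intro γ u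
    change _ = (𝓕⁻ (hcs.toSchwartzMap hw) : SchwartzMap ℝ ℂ) (u + γ)
    rw [SchwartzMap.fourierInv_coe, SchwartzMap.fourierInv_coe, Real.fourierInv_eq', Real.fourierInv_eq']
    congr 1; ext v
    rw [ha, smul_eq_mul, smul_eq_mul, ← mul_assoc]
    have : hcs.toSchwartzMap hw v = w v := rfl
    rw [this, ex, ← Complex.exp_add]
    congr 2
    simp; ring
  obtain ⟨M, hM⟩ := hcs.exists_bound_of_continuous hw.continuous
  set I0 := ∫⁻ v, ‖κ₀ v‖ₑ
  set I1 := ∫⁻ v, ‖deriv κ₀ v‖ₑ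
  set I2 := ∫⁻ v, ENNReal.ofReal (|v| ^ ε) * ‖κ₀ v‖ₑ
  have h0 : I0 ≠ ⊤ := (κ₀.integrable (μ := volume)).2.ne
  have h1 : I1 ≠ ⊤ := ((SchwartzMap.derivCLM ℝ ℂ κ₀).integrable (μ := volume)).2.ne
  have h2 : I2 ≠ ⊤ := schwartz_lint_pow κ₀ hε hε1
  have hgC := gC_fin hε
  set Q := gC ε * (I1 + 2 * (I2 + I0)) with hQ
  have hQt : Q ≠ ⊤ := by
    rw [hQ]
    exact ENNReal.mul_ne_top hgC (ENNReal.add_ne_top.2 ⟨h1, ENNReal.mul_ne_top (by norm_num) (ENNReal.add_ne_top.2 ⟨h2, h0⟩)⟩)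
  have hM0 : 0 ≤ M := (norm_nonneg _).trans (hM 0)
  have hq0 := ENNReal.toReal_nonneg (a := Q)
  set A0 := M + Q.toReal + 1
  refine ⟨C * A0, by positivity, fun γ S j F => ?_⟩
  have hge : 1 ≤ (1 + |γ|)^ε := Real.one_le_rpow (by linarith [abs_nonneg γ]) hε.le
  have := hC (a γ) S (A0 * (1+|γ|)^ε) (by positivity) ?_ ?_ j F
  · simp_rw [ha] at this
    simpa only [mul_assoc] using this
  · intro ξ
    refine (sum_ann_le (w := a γ) (M := M) ?_ ?_ S ξ).trans ?_
    · intro z hz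
      rw [ha] at hz
      exact hs z (right_ne_zero_of_mul hz)
    · intro z; rw [ha, norm_mul, ex_norm, one_mul]; exact hM z
    · calc M ≤ A0 := by simp only [A0]; linarith
        _ ≤ _ := le_mul_of_one_le_right (by positivity) hge
  · have e1 : ∫⁻ v, ‖deriv (𝓕⁻ (a γ) : SchwartzMap ℝ ℂ) v‖ₑ = I1 := by
      have : (⇑(𝓕⁻ (a γ) : SchwartzMap ℝ ℂ)) = fun u => κ₀ (u + γ) := funext (hκ γ)
      rw [this]
      simp_rw [deriv_comp_add_const]
      exact lintegral_add_right_eq_self (fun v => ‖deriv κ₀ v‖ₑ) γ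
    have e2 : ∫⁻ v, ENNReal.ofReal (|v| ^ ε) * ‖(𝓕⁻ (a γ) : SchwartzMap ℝ ℂ) v‖ₑ
        ≤ I2 + ENNReal.ofReal (|γ|^ε) * I0 := by
      simp_rw [hκ]
      rw [← lintegral_sub_right_eq_self _ γ]
      simp_rw [sub_add_cancel]
      rw [← lintegral_const_mul _ (κ₀.continuous.measurable.enorm), ← lintegral_add_right _ (by
        exact (κ₀.continuous.measurable.enorm).const_mul _)]
      apply lintegral_mono; intro v; beta_reduce
      rw [← add_mul, ← ENNReal.ofReal_add (by positivity) (by positivity)]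
      refine mul_le_mul_left (ENNReal.ofReal_le_ofReal ?_) _
      refine (Real.rpow_le_rpow (abs_nonneg _) (abs_sub _ _) hε.le).trans ?_
      exact Real.rpow_add_le_add_rpow (abs_nonneg _) (abs_nonneg _) hε.le hε1
    have hb : ENNReal.ofReal (|γ|^ε) ≤ ENNReal.ofReal ((1+|γ|)^ε) :=
      ENNReal.ofReal_le_ofReal (Real.rpow_le_rpow (abs_nonneg _) (by linarith [abs_nonneg γ]) hε.le)
    have hb1 : 1 ≤ ENNReal.ofReal ((1+|γ|)^ε) := by simpa using hge
    rw [e1]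
    set G := ENNReal.ofReal ((1+|γ|)^ε) with hG
    calc gC ε * (I1 + 2 * _) ≤ gC ε * (I1 * G + 2 * (I2 * G + G * I0)) := by
          gcongr
          · exact le_mul_of_one_le_right (zero_le) hb1
          · refine e2.trans ?_
            gcongr
            exact le_mul_of_one_le_right (zero_le) hb1
      _ = Q * G := by rw [hQ]; ring
      _ = ENNReal.ofReal Q.toReal * G := by rw [ENNReal.ofReal_toReal hQt]
      _ ≤ ENNReal.ofReal A0 * G := by
          gcongr; simp only [A0]; linarith
      _ = _ := by rw [ENNReal.ofReal_mul (by positivity)]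

noncomputable def nrm {n : ℕ} (p : ℕ → ℝ) (F : ℕ → SchwartzMap (Fin n → ℝ) ℂ) : ℝ :=
  ∏ j ∈ Finset.range (n+1), (eLpNorm (⇑(F j)) (ENNReal.ofReal (p j)) volume).toReal

lemma nrm_nonneg {n : ℕ} (p : ℕ → ℝ) (F : ℕ → SchwartzMap (Fin n → ℝ) ℂ) : 0 ≤ nrm p F :=
  Finset.prod_nonneg fun _ _ => ENNReal.toReal_nonneg

def Bd (n : ℕ) (p : ℕ → ℝ) (C : ℝ) (m : (Fin n → ℝ) → ℂ) : Prop :=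
  ∀ F : ℕ → SchwartzMap (Fin n → ℝ) ℂ, ‖formM n m (fun j => ⇑(F j))‖ ≤ C * nrm p F

lemma Bd.mono {n : ℕ} {p : ℕ → ℝ} {C C' : ℝ} {m : (Fin n → ℝ) → ℂ} (h : Bd n p C m) (hC : C ≤ C') :
    Bd n p C' m := fun F => (h F).trans (mul_le_mul_of_nonneg_right hC (nrm_nonneg p F))

noncomputable def kerF {n : ℕ} (F : ℕ → SchwartzMap (Fin n → ℝ) ℂ) (τ : Fin n → Fin n → ℝ) : ℂ :=
  fourierT n (F 0) (-(∑ j, τ j)) * (∏ j : Fin n, fourierT n (F (j.1 + 1)) (τ j))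

lemma formM_eq {n : ℕ} (m : (Fin n → ℝ) → ℂ) (F : ℕ → SchwartzMap (Fin n → ℝ) ℂ) :
    formM n m (fun j => ⇑(F j)) = ∫ τ : Fin n → Fin n → ℝ, kerF F τ * m (fun j => τ j j) := rfl

lemma kerF_int {n : ℕ} (F : ℕ → SchwartzMap (Fin n → ℝ) ℂ) : Integrable (kerF F) := by
  choose G hG _ using fun j => exists_fourierT (F j)
  have h1 : Integrable (fun τ : Fin n → Fin n → ℝ => ∏ j : Fin n, G (j.1+1) (τ j)) :=
    Integrable.fintype_prod (f := fun j : Fin n => ⇑(G (j.1+1))) fun j => (G (j.1+1)).integrable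
  have h2 : kerF F = fun τ => G 0 (-(∑ j, τ j)) * ∏ j : Fin n, G (j.1+1) (τ j) := by
    ext τ; simp only [kerF, hG]
  rw [h2]
  refine h1.bdd_mul (c := SchwartzMap.seminorm ℝ 0 0 (G 0)) ?_ (Filter.Eventually.of_forall fun τ => SchwartzMap.norm_le_seminorm ℝ (G 0) _)
  exact ((G 0).continuous.comp (by fun_prop)).aestronglyMeasurable

lemma diag_meas {n : ℕ} : Measurable (fun τ : Fin n → Fin n → ℝ => fun j => τ j j) := by fun_prop

lemma kerm_int {n : ℕ} (F : ℕ → SchwartzMap (Fin n → ℝ) ℂ) {m : (Fin n → ℝ) → ℂ} (hm : Measurable m)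
    {M : ℝ} (hM : ∀ ξ, ‖m ξ‖ ≤ M) : Integrable (fun τ => kerF F τ * m (fun j => τ j j)) :=
  (kerF_int F).mul_bdd (c := M) (hm.comp diag_meas).aestronglyMeasurable (Filter.Eventually.of_forall fun τ => hM _)

lemma Bd.sum {n : ℕ} {p : ℕ → ℝ} {ι : Type*} (s : Finset ι) {C : ι → ℝ} {m : ι → (Fin n → ℝ) → ℂ}
    (hm : ∀ i ∈ s, Measurable (m i)) (hM : ∀ i ∈ s, ∃ M, ∀ ξ, ‖m i ξ‖ ≤ M) (h : ∀ i ∈ s, Bd n p (C i) (m i)) :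
    Bd n p (∑ i ∈ s, C i) (fun ξ => ∑ i ∈ s, m i ξ) := by
  intro F
  rw [formM_eq]
  simp_rw [Finset.mul_sum]
  rw [integral_finsetSum]
  · rw [Finset.sum_mul]
    exact (norm_sum_le _ _).trans (Finset.sum_le_sum fun i hi => h i hi F)
  · intro i hi
    obtain ⟨M, hM⟩ := hM i hi
    exact kerm_int F (hm i hi) hM

lemma Bd.smul {n : ℕ} {p : ℕ → ℝ} {C : ℝ} {m : (Fin n → ℝ) → ℂ} (h : Bd n p C m) (c : ℂ) :
    Bd n p (‖c‖ * C) (fun ξ => c * m ξ) := by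
  intro F
  rw [formM_eq]
  have : ∀ τ : Fin n → Fin n → ℝ, kerF F τ * (c * m fun j => τ j j) = c * (kerF F τ * m fun j => τ j j) :=
    fun τ => by ring
  simp_rw [this]
  rw [integral_const_mul, norm_mul, mul_assoc]
  exact mul_le_mul_of_nonneg_left (h F) (norm_nonneg _)

lemma Bd.lim {n : ℕ} {p : ℕ → ℝ} {C : ℝ} {m : ℕ → (Fin n → ℝ) → ℂ} {m' : (Fin n → ℝ) → ℂ}
    (hm : ∀ i, Measurable (m i)) {M : ℝ} (hM : ∀ i ξ, ‖m i ξ‖ ≤ M) (h : ∀ i, Bd n p C (m i))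
    (hl : ∀ ξ, Filter.Tendsto (fun i => m i ξ) Filter.atTop (nhds (m' ξ))) : Bd n p C m' := by
  intro F
  have : Filter.Tendsto (fun i => formM n (m i) (fun j => ⇑(F j))) Filter.atTop
      (nhds (formM n m' (fun j => ⇑(F j)))) := by
    simp_rw [formM_eq]
    refine tendsto_integral_of_dominated_convergence (fun τ => ‖kerF F τ‖ * M) ?_ ?_ ?_ ?_
    · intro i; exact (kerm_int F (hm i) (hM i)).aestronglyMeasurable
    · exact (kerF_int F).norm.mul_const M
    · intro i; refine Filter.Eventually.of_forall fun τ => ?_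
      rw [norm_mul]; exact mul_le_mul_of_nonneg_left (hM i _) (norm_nonneg _)
    · exact Filter.Eventually.of_forall fun τ => (hl _).const_mul _
  exact le_of_tendsto this.norm (Filter.Eventually.of_forall fun i => h i F)

lemma Bd.avg {n : ℕ} {p : ℕ → ℝ} {Ω : Type*} [MeasurableSpace Ω] {ν : Measure Ω} [SFinite ν]
    {C A : Ω → ℝ} {m : Ω → (Fin n → ℝ) → ℂ} (hm : Measurable (Function.uncurry m))
    (hM : ∀ ω ξ, ‖m ω ξ‖ ≤ A ω) (hA : Integrable A ν) (hC : Integrable C ν)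
    (h : ∀ ω, Bd n p (C ω) (m ω)) :
    Bd n p (∫ ω, C ω ∂ν) (fun ξ => ∫ ω, m ω ξ ∂ν) := by
  intro F
  rw [formM_eq]
  simp_rw [← integral_const_mul]
  rw [integral_integral_swap]
  · rw [← integral_mul_const]
    refine norm_integral_le_of_norm_le (hC.mul_const _) (Filter.Eventually.of_forall fun ω => ?_)
    exact h ω F
  · refine ((kerF_int F).norm.mul_prod hA).mono' ?_ (Filter.Eventually.of_forall ?_)
    · refine (kerF_int F).aestronglyMeasurable.comp_fst.mul ?_
      refine (hm.comp (measurable_snd.prodMk (diag_meas.comp measurable_fst))).aestronglyMeasurable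
    · rintro ⟨τ, ω⟩
      simp only [Function.uncurry]
      rw [norm_mul]; exact mul_le_mul_of_nonneg_left (hM ω _) (norm_nonneg _)

lemma map_lin {E : Type*} [NormedAddCommGroup E] [NormedSpace ℝ E] [FiniteDimensional ℝ E]
    [MeasureSpace E] [BorelSpace E] [(volume : Measure E).IsAddHaarMeasure] (e : E ≃L[ℝ] E) :
    Measure.map e (volume : Measure E) = ENNReal.ofReal |(LinearMap.det (e.toLinearEquiv : E →ₗ[ℝ] E))⁻¹| • volume := by
  have := Measure.map_linearMap_addHaar_eq_smul_addHaar (volume : Measure E)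
    (f := (e.toLinearEquiv : E →ₗ[ℝ] E)) e.toLinearEquiv.isUnit_det'.ne_zero
  exact this

lemma int_lin {E : Type*} [NormedAddCommGroup E] [NormedSpace ℝ E] [FiniteDimensional ℝ E]
    [MeasureSpace E] [BorelSpace E] [(volume : Measure E).IsAddHaarMeasure] (e : E ≃L[ℝ] E) (f : E → ℂ) :
    ∫ x, f (e x) = (|(LinearMap.det (e.toLinearEquiv : E →ₗ[ℝ] E))⁻¹| : ℝ) * ∫ x, f x := by
  have h : ∫ y, f y ∂(Measure.map e volume) = ∫ x, f (e x) :=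
    (e.toHomeomorph.measurableEmbedding).integral_map f
  rw [← h, map_lin, integral_smul_measure, ENNReal.toReal_ofReal (abs_nonneg _), Complex.real_smul]

noncomputable def dil {n : ℕ} (D : Fin n → ℝ) (hD : ∀ j, 0 < D j) : (Fin n → ℝ) ≃L[ℝ] (Fin n → ℝ) :=
  ContinuousLinearEquiv.piCongrRight fun j =>
    ContinuousLinearEquiv.unitsEquivAut ℝ (Units.mk0 (D j) (hD j).ne')

lemma dil_apply {n : ℕ} (D : Fin n → ℝ) (hD : ∀ j, 0 < D j) (x : Fin n → ℝ) (j : Fin n) :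
    dil D hD x j = D j * x j := by
  simp [dil, mul_comm]

lemma Bd.dil {n : ℕ} {p : ℕ → ℝ} (hp : ∀ j ≤ n, 1 < p j)
    (hsum : ∑ j ∈ Finset.range (n + 1), 1 / p j = 1) {C : ℝ} {m : (Fin n → ℝ) → ℂ} (h : Bd n p C m)
    (D : Fin n → ℝ) (hD : ∀ j, 0 < D j) : Bd n p C (fun ξ => m (fun j => D j * ξ j)) := by
  intro F
  let δ := _root_.dil D hD
  let δ' : (Fin n → Fin n → ℝ) ≃L[ℝ] (Fin n → Fin n → ℝ) := ContinuousLinearEquiv.piCongrRight fun _ => δ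
  set c : ℝ := |(LinearMap.det (δ.toLinearEquiv : (Fin n → ℝ) →ₗ[ℝ] (Fin n → ℝ)))⁻¹| with hc
  have hc0 : 0 < c := abs_pos.2 (inv_ne_zero δ.toLinearEquiv.isUnit_det'.ne_zero)
  have hc' : |(LinearMap.det (δ'.toLinearEquiv : (Fin n → Fin n → ℝ) →ₗ[ℝ] (Fin n → Fin n → ℝ)))⁻¹| = c ^ n := by
    have := LinearMap.det_pi (fun _ : Fin n => (δ.toLinearEquiv : (Fin n → ℝ) →ₗ[ℝ] (Fin n → ℝ)))
    have h2 : (δ'.toLinearEquiv : (Fin n → Fin n → ℝ) →ₗ[ℝ] (Fin n → Fin n → ℝ))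
      = LinearMap.pi fun i => (δ.toLinearEquiv : (Fin n → ℝ) →ₗ[ℝ] (Fin n → ℝ)) ∘ₗ LinearMap.proj i := rfl
    rw [h2, this, hc]
    simp
  let F' : ℕ → SchwartzMap (Fin n → ℝ) ℂ := fun j => SchwartzMap.compCLMOfContinuousLinearEquiv ℂ δ (F j)
  have hFF : ∀ j x, F' j x = F j (δ x) := fun j x => rfl
  have hft : ∀ j τ, fourierT n (F j) τ = (c:ℂ)⁻¹ * fourierT n (F' j) (δ τ) := by
    intro j τ
    have := int_lin δ (fun y => Complex.exp (((-2 * Real.pi * ∑ j, y j * τ j : ℝ) : ℂ) * Complex.I) * F j y)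
    have hcc : (c:ℂ) ≠ 0 := by exact_mod_cast hc0.ne'
    rw [eq_inv_mul_iff_mul_eq₀ hcc, fourierT, ← this, fourierT]
    congr 1; ext x
    rw [hFF]
    congr 6
    ext i
    change (_root_.dil D hD x) i * _ = x i * (_root_.dil D hD τ) i
    rw [dil_apply, dil_apply]; ring
  have hker : ∀ τ, kerF F τ = ((c:ℂ)⁻¹) ^ (n+1) * kerF F' (δ' τ) := by
    intro τ
    simp only [kerF, hft, Finset.prod_mul_distrib, Finset.prod_const, Finset.card_univ, Fintype.card_fin]
    have : δ (-∑ j, τ j) = -∑ j, δ' τ j := by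
      rw [map_neg, map_sum]; rfl
    rw [this, pow_succ]
    have h3 : ∀ j, δ' τ j = δ (τ j) := fun j => rfl
    simp_rw [h3]; ring
  have hform : formM n (fun ξ => m (fun j => D j * ξ j)) (fun j => ⇑(F j))
      = (c:ℂ)⁻¹ * formM n m (fun j => ⇑(F' j)) := by
    rw [formM_eq, formM_eq]
    have := int_lin δ' (fun σ => kerF F' σ * m (fun j => σ j j))
    rw [hc'] at this
    have h4 : ∀ τ : Fin n → Fin n → ℝ, kerF F τ * m (fun j => D j * τ j j)
        = ((c:ℂ)⁻¹) ^ (n+1) * (kerF F' (δ' τ) * m (fun j => δ' τ j j)) := by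
      intro τ
      rw [hker, mul_assoc]
      congr 3
      ext j
      change _ = (_root_.dil D hD (τ j)) j
      rw [dil_apply]
    simp_rw [h4]
    rw [integral_const_mul, this, ← mul_assoc]
    congr 1
    have hcc : (c:ℂ) ≠ 0 := by exact_mod_cast hc0.ne'
    push_cast
    rw [pow_succ, mul_comm _ ((c:ℂ)⁻¹), mul_assoc, ← mul_pow, inv_mul_cancel₀ hcc, one_pow, mul_one]
  have hnorm : nrm p F' = c * nrm p F := by
    have h5 : ∀ j ∈ Finset.range (n+1), (eLpNorm (⇑(F' j)) (ENNReal.ofReal (p j)) volume).toReal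
        = c ^ (1 / p j) * (eLpNorm (⇑(F j)) (ENNReal.ofReal (p j)) volume).toReal := by
      intro j hj
      have hpj : 0 < p j := by have := hp j (by simpa [Nat.lt_succ_iff] using hj); linarith
      have h6 : (⇑(F' j)) = ⇑(F j) ∘ δ := rfl
      rw [h6, ← eLpNorm_map_measure (F j).continuous.aestronglyMeasurable δ.continuous.measurable.aemeasurable,
        map_lin, eLpNorm_smul_measure_of_ne_top ENNReal.ofReal_ne_top, smul_eq_mul, ENNReal.toReal_mul,
        ← ENNReal.toReal_rpow, ENNReal.toReal_ofReal (abs_nonneg _)]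
      congr 2
      rw [one_div, ENNReal.toReal_inv, ENNReal.toReal_ofReal hpj.le, one_div]
    rw [nrm, Finset.prod_congr rfl h5, Finset.prod_mul_distrib, ← Real.rpow_sum_of_pos hc0, hsum, Real.rpow_one]; rfl
  rw [hform, norm_mul]
  have := h F'
  rw [hnorm] at this
  rw [norm_inv, Complex.norm_real, Real.norm_of_nonneg hc0.le, inv_mul_le_iff₀ hc0]
  linarith

/-- composition with one-coordinate multipliers -/
lemma Bd.comp {n : ℕ} {p : ℕ → ℝ} {C : ℝ} (hC : 0 ≤ C) {m : (Fin n → ℝ) → ℂ} (h : Bd n p C m)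
    {A : Fin n → ℝ → ℂ} {K : Fin n → ℝ} 
    (hA : ∀ (j : Fin n) (F : SchwartzMap (Fin n → ℝ) ℂ), ∃ F' : SchwartzMap (Fin n → ℝ) ℂ,
      (∀ ξ, fourierT n F' ξ = A j (ξ j) * fourierT n F ξ) ∧
      (eLpNorm (⇑F') (ENNReal.ofReal (p (j.1+1))) volume).toReal
          ≤ K j * (eLpNorm (⇑F) (ENNReal.ofReal (p (j.1+1))) volume).toReal) :
    Bd n p (C * ∏ j, K j) (fun ξ => (∏ j, A j (ξ j)) * m ξ) := by
  intro F
  choose T hT hTn using hA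
  let F' : ℕ → SchwartzMap (Fin n → ℝ) ℂ := fun i => if hi : i - 1 < n ∧ i ≠ 0 then T ⟨i-1, hi.1⟩ (F i) else F i
  have h0 : F' 0 = F 0 := by simp [F']
  have h1 : ∀ j : Fin n, F' (j.1+1) = T j (F (j.1+1)) := by
    intro j; simp [F']
  have hform : formM n (fun ξ => (∏ j, A j (ξ j)) * m ξ) (fun j => ⇑(F j)) = formM n m (fun j => ⇑(F' j)) := by
    rw [formM_eq, formM_eq]
    congr 1; ext τ
    simp only [kerF, h0, h1, hT, Finset.prod_mul_distrib]
    ring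
  rw [hform]
  refine (h F').trans ?_
  rw [mul_assoc]
  refine mul_le_mul_of_nonneg_left ?_ hC
  rw [nrm, nrm, Finset.prod_range_succ', Finset.prod_range_succ', ← mul_assoc, h0]
  refine mul_le_mul_of_nonneg_right ?_ ENNReal.toReal_nonneg
  rw [Finset.prod_range, Finset.prod_range, ← Finset.prod_mul_distrib]
  refine Finset.prod_le_prod (fun _ _ => ENNReal.toReal_nonneg) fun j _ => ?_
  rw [h1]
  exact hTn j _

def Ann {n : ℕ} (Θ : (Fin n → ℝ) → ℂ) : Prop := ∀ ξ, Θ ξ ≠ 0 → 1/4 ≤ ‖ξ‖ ∧ ‖ξ‖ ≤ 4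

noncomputable def Mk {n : ℕ} (Θ : (Fin n → ℝ) → ℂ) (ξ : Fin n → ℝ) : ℂ :=
  ∑' k : ℤ, Θ (((1024:ℝ) ^ k)⁻¹ • ξ)

lemma Mk_zero {n : ℕ} {Θ : (Fin n → ℝ) → ℂ} (h : Ann Θ) : Mk Θ 0 = 0 := by
  have : Θ 0 = 0 := by
    by_contra h0
    have := (h 0 h0).1; simp at this; linarith
  simp [Mk, this]

lemma Mk_local {n : ℕ} (ξ : Fin n → ℝ) (hξ : ξ ≠ 0) : ∃ k₀ : ℤ, ‖ξ‖ ≤ 32 * (1024:ℝ) ^ k₀ ∧ ∃ U ∈ nhds ξ,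
    ∀ y ∈ U, ∀ Θ : (Fin n → ℝ) → ℂ, Ann Θ → ∀ k, k ≠ k₀ → Θ (((1024:ℝ) ^ k)⁻¹ • y) = 0 := by
  have h0 : 0 < ‖ξ‖ := norm_pos_iff.2 hξ
  obtain ⟨k₀, h1, h2⟩ := exists_mem_Ico_zpow (x := 32 * ‖ξ‖) (y := (1024:ℝ)) (by positivity) (by norm_num)
  rw [zpow_add_one₀ (by norm_num)] at h2
  have hp : (0:ℝ) < 1024 ^ k₀ := by positivity
  refine ⟨k₀, by linarith, {y | (1024:ℝ)^k₀ / 200 < ‖y‖ ∧ ‖y‖ < 200 * (1024:ℝ)^k₀}, ?_, ?_⟩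
  · apply IsOpen.mem_nhds
    · exact (isOpen_lt continuous_const continuous_norm).inter (isOpen_lt continuous_norm continuous_const)
    · constructor <;> linarith
  · rintro y ⟨hy1, hy2⟩ Θ hΘ k hk
    by_contra hne
    obtain ⟨h3, h4⟩ := hΘ _ hne
    have hpk : (0:ℝ) < 1024 ^ k := by positivity
    rw [norm_smul, Real.norm_of_nonneg (by positivity)] at h3 h4
    rw [le_inv_mul_iff₀ hpk] at h3
    rw [inv_mul_le_iff₀ hpk] at h4
    rcases lt_or_gt_of_ne hk with h | h
    · have : (1024:ℝ) * 1024^k ≤ 1024 ^ k₀ := by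
        rw [← zpow_one_add₀ (by norm_num)]
        exact zpow_le_zpow_right₀ (by norm_num) (by omega)
      linarith
    · have : (1024:ℝ) * 1024^k₀ ≤ 1024 ^ k := by
        rw [← zpow_one_add₀ (by norm_num)]
        exact zpow_le_zpow_right₀ (by norm_num) (by omega)
      linarith

lemma Mk_finite {n : ℕ} {Θ : (Fin n → ℝ) → ℂ} (h : Ann Θ) (ξ : Fin n → ℝ) :
    ∃ k₀ : ℤ, ∀ k, k ≠ k₀ → Θ (((1024:ℝ) ^ k)⁻¹ • ξ) = 0 := by
  by_cases hξ : ξ = 0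
  · refine ⟨0, fun k _ => ?_⟩
    by_contra h0
    have := (h _ h0).1
    rw [hξ, smul_zero, norm_zero] at this; linarith
  · obtain ⟨k₀, _, U, hU, H⟩ := Mk_local ξ hξ
    exact ⟨k₀, H ξ (mem_of_mem_nhds hU) Θ h⟩

lemma Mk_bdd {n : ℕ} {Θ : (Fin n → ℝ) → ℂ} (h : Ann Θ) {M : ℝ} (hM : ∀ ξ, ‖Θ ξ‖ ≤ M) (ξ) : ‖Mk Θ ξ‖ ≤ M := by
  obtain ⟨k₀, H⟩ := Mk_finite h ξ
  rw [Mk, tsum_eq_single k₀ H]; exact hM _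

lemma Mk_meas {n : ℕ} {Θ : (Fin n → ℝ) → ℂ} (h : Ann Θ) (hm : Continuous Θ) : Measurable (Mk Θ) := by
  refine measurable_of_tendsto_metrizable (f := fun (N : ℕ) ξ => ∑ k ∈ Finset.Icc (-(N:ℤ)) N, Θ (((1024:ℝ) ^ k)⁻¹ • ξ)) ?_ ?_
  · intro N
    have : Continuous fun ξ => ∑ k ∈ Finset.Icc (-(N:ℤ)) N, Θ (((1024:ℝ) ^ k)⁻¹ • ξ) := by fun_prop
    exact this.measurable
  · rw [tendsto_pi_nhds]
    intro ξ
    obtain ⟨k₀, H⟩ := Mk_finite h ξ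
    have : Summable (fun k : ℤ => Θ (((1024:ℝ) ^ k)⁻¹ • ξ)) :=
      summable_of_ne_finset_zero (s := {k₀}) fun k hk => H k (by simpa using hk)
    exact this.hasSum.comp Finset.tendsto_Icc_neg

lemma Ann_cpt {n : ℕ} {Θ : (Fin n → ℝ) → ℂ} (h : Ann Θ) : HasCompactSupport Θ := by
  refine HasCompactSupport.intro (isCompact_closedBall (0 : Fin n → ℝ) 4) fun x hx => ?_
  by_contra h0
  exact hx (by simpa using (h x h0).2)

lemma Mk_std {n : ℕ} {Θ : (Fin n → ℝ) → ℂ} (h : Ann Θ) (hs : ContDiff ℝ (⊤ : ℕ∞) Θ) :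
    IsStandardSymbol n (Mk Θ) := by
  have hc := Ann_cpt h
  have hloc : ∀ ξ : Fin n → ℝ, ξ ≠ 0 → ∃ k₀ : ℤ, ‖ξ‖ ≤ 32 * (1024:ℝ) ^ k₀ ∧ 
      Mk Θ =ᶠ[nhds ξ] fun y => Θ ((((1024:ℝ) ^ k₀)⁻¹ • ContinuousLinearMap.id ℝ (Fin n → ℝ)) y) := by
    intro ξ hξ
    obtain ⟨k₀, h1, U, hU, H⟩ := Mk_local ξ hξ
    refine ⟨k₀, h1, Filter.mem_of_superset hU fun y hy => ?_⟩
    change Mk Θ y = _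
    rw [Mk, tsum_eq_single k₀ (H y hy Θ h)]; rfl
  refine ⟨?_, ?_, ?_⟩
  · obtain ⟨C, hC⟩ := hc.exists_bound_of_continuous hs.continuous
    exact ⟨C, Mk_bdd h hC⟩
  · intro ξ hξ
    obtain ⟨k₀, _, he⟩ := hloc ξ hξ
    refine ContDiffAt.contDiffWithinAt (ContDiffAt.congr_of_eventuallyEq ?_ he)
    exact (hs.comp (ContinuousLinearMap.contDiff _)).contDiffAt
  · intro k
    obtain ⟨C, hC⟩ := (hc.iteratedFDeriv (𝕜 := ℝ) k).exists_bound_of_continuous (hs.continuous_iteratedFDeriv (m := k) (by exact_mod_cast le_top))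
    have hC0 : 0 ≤ C := (norm_nonneg _).trans (hC 0)
    refine ⟨(C+1) * 32 ^ k, by positivity, fun ξ hξ => ?_⟩
    obtain ⟨k₀, h1, he⟩ := hloc ξ hξ
    rw [iteratedFDerivWithin_of_isOpen k isOpen_compl_singleton hξ, (he.iteratedFDeriv ℝ k).eq_of_nhds]
    change ‖iteratedFDeriv ℝ k (Θ ∘ ⇑(((1024:ℝ)^k₀)⁻¹ • ContinuousLinearMap.id ℝ (Fin n → ℝ))) ξ‖ ≤ _
    rw [ContinuousLinearMap.iteratedFDeriv_comp_right _ hs ξ (by exact_mod_cast le_top)]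
    refine (ContinuousMultilinearMap.norm_compContinuousLinearMap_le _ _).trans ?_
    have h0 : 0 < ‖ξ‖ := norm_pos_iff.2 hξ
    have hp : (0:ℝ) < 1024 ^ k₀ := by positivity
    have h2 : ‖((1024:ℝ) ^ k₀)⁻¹ • ContinuousLinearMap.id ℝ (Fin n → ℝ)‖ ≤ 32 * ‖ξ‖⁻¹ := by
      rw [norm_smul, norm_inv, Real.norm_of_nonneg hp.le]
      calc ((1024:ℝ) ^ k₀)⁻¹ * _ ≤ ((1024:ℝ) ^ k₀)⁻¹ * 1 := by gcongr; exact ContinuousLinearMap.norm_id_le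
        _ ≤ _ := by
          rw [mul_one, ← div_eq_mul_inv, le_div_iff₀ h0, inv_mul_le_iff₀ hp]; linarith
    rw [Finset.prod_const, Finset.card_univ, Fintype.card_fin, Real.rpow_neg h0.le, Real.rpow_natCast]
    calc _ ≤ (C+1) * (32 * ‖ξ‖⁻¹)^k := by
          gcongr
          exact (hC _).trans (by linarith)
      _ = _ := by rw [mul_pow, inv_pow]; ring

def Hyp (n : ℕ) (p : ℕ → ℝ) : Prop := ∀ m' : (Fin n → ℝ) → ℂ, IsStandardSymbol n m' → ∃ c : ℝ, 0 < c ∧ Bd n p c m'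

noncomputable def fun1 (z : ℕ → ℂ) (Z : ℝ) (hz : ∀ i, ‖z i‖ ≤ Z) : lp (fun _ : ℕ => ℂ) 1 →L[ℂ] ℂ :=
  have hsm : ∀ a : lp (fun _ : ℕ => ℂ) 1, Summable fun i => ‖a i‖ := fun a => by
    have := (lp.memℓp a).summable (by norm_num); simpa using this
  have hs : ∀ a : lp (fun _ : ℕ => ℂ) 1, Summable fun i => a i * z i := fun a =>
    Summable.of_norm_bounded ((hsm a).mul_right Z) fun i => by
      rw [norm_mul]; exact mul_le_mul_of_nonneg_left (hz i) (norm_nonneg _)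
  LinearMap.mkContinuous
    { toFun := fun a => ∑' i, a i * z i
      map_add' := fun a b => by
        rw [← (hs a).tsum_add (hs b)]; congr 1; ext i
        simp [add_mul]
      map_smul' := fun c a => by
        simp only [RingHom.id_apply, smul_eq_mul]
        rw [← tsum_mul_left]; congr 1; ext i
        simp [mul_assoc] } Z fun a => by
      have h1 : ‖a‖ = ∑' i, ‖a i‖ := by
        rw [lp.norm_eq_tsum_rpow (by norm_num)]; simp
      rw [h1, mul_comm, ← tsum_mul_right]
      refine (norm_tsum_le_tsum_norm (hs a).norm).trans ?_
      refine Summable.tsum_le_tsum (fun i => ?_) (hs a).norm ((hsm a).mul_right Z)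
      rw [norm_mul]; exact mul_le_mul_of_nonneg_left (hz i) (norm_nonneg _)

lemma fun1_apply (z : ℕ → ℂ) (Z : ℝ) (hz : ∀ i, ‖z i‖ ≤ Z) (a) : fun1 z Z hz a = ∑' i, a i * z i := rfl

lemma ubp_seq {n : ℕ} {p : ℕ → ℝ} (hyp : Hyp n p) {Θ : ℕ → (Fin n → ℝ) → ℂ} (hA : ∀ i, Ann (Θ i))
    (hs : ∀ i, ContDiff ℝ (⊤ : ℕ∞) (Θ i))
    (hb : ∀ k : ℕ, ∃ C : ℝ, ∀ i ξ, ‖iteratedFDeriv ℝ k (Θ i) ξ‖ ≤ C) :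
    ∃ C : ℝ, ∀ i, Bd n p C (Mk (Θ i)) := by
  choose B hB using hb
  have hB0 : ∀ i ξ, ‖Θ i ξ‖ ≤ B 0 := fun i ξ => by simpa using hB 0 i ξ
  have hMb : ∀ i ξ, ‖Mk (Θ i) ξ‖ ≤ B 0 := fun i ξ => Mk_bdd (hA i) (hB0 i) ξ
  have hMm : ∀ i, Measurable (Mk (Θ i)) := fun i => Mk_meas (hA i) (hs i).continuous
  set Fam := ℕ → SchwartzMap (Fin n → ℝ) ℂ
  let z : Fam → ℕ → ℂ := fun F i => ((nrm p F)⁻¹ : ℝ) * formM n (Mk (Θ i)) (fun j => ⇑(F j))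
  let I : Fam → ℝ := fun F => ∫ τ, ‖kerF F τ‖ * B 0
  have hfb : ∀ (F : Fam) i, ‖formM n (Mk (Θ i)) (fun j => ⇑(F j))‖ ≤ I F := by
    intro F i
    rw [formM_eq]
    refine norm_integral_le_of_norm_le ((kerF_int F).norm.mul_const _) (Filter.Eventually.of_forall fun τ => ?_)
    rw [norm_mul]; exact mul_le_mul_of_nonneg_left (hMb i _) (norm_nonneg _)
  have hz : ∀ F i, ‖z F i‖ ≤ (nrm p F)⁻¹ * I F := by
    intro F i
    simp only [z]
    rw [norm_mul, Complex.norm_real, Real.norm_of_nonneg (inv_nonneg.2 (nrm_nonneg p F))]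
    exact mul_le_mul_of_nonneg_left (hfb F i) (inv_nonneg.2 (nrm_nonneg p F))
  let g : Fam → (lp (fun _ : ℕ => ℂ) 1 →L[ℂ] ℂ) := fun F => fun1 (z F) _ (hz F)
  have hbs : ∃ C', ∀ F, ‖g F‖ ≤ C' := by
    apply banach_steinhaus
    intro a
    have hsa : Summable fun i => ‖a i‖ := by
      have := (lp.memℓp a).summable (by norm_num); simpa using this
    let Θa : (Fin n → ℝ) → ℂ := fun ξ => ∑' i, a i * Θ i ξ
    have hAa : Ann Θa := by
      intro ξ hξ
      by_contra hcon
      apply hξ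
      have : ∀ i, a i * Θ i ξ = 0 := fun i => by
        by_contra h; exact hcon (hA i ξ (right_ne_zero_of_mul h))
      simp only [Θa, this, tsum_zero]
    have hsa' : ContDiff ℝ (⊤ : ℕ∞) Θa := by
      refine contDiff_tsum (v := fun k i => ‖a i‖ * B k) (fun i => contDiff_const.mul (hs i)) (fun k _ => hsa.mul_right _) ?_
      intro k i ξ _
      have e : (fun ξ => a i * Θ i ξ) = (a i) • (Θ i) := rfl
      rw [e, iteratedFDeriv_const_smul_apply ((hs i).contDiffAt.of_le (by exact_mod_cast le_top)), norm_smul]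
      exact mul_le_mul_of_nonneg_left (hB k i ξ) (norm_nonneg _)
    obtain ⟨c, hc, hbd⟩ := hyp _ (Mk_std hAa hsa')
    refine ⟨c, fun F => ?_⟩
    have hM : ∀ ξ, Mk Θa ξ = ∑' i, a i * Mk (Θ i) ξ := by
      intro ξ
      by_cases hξ : ξ = 0
      · rw [hξ, Mk_zero hAa]; simp [fun i => Mk_zero (hA i)]
      · obtain ⟨k₀, _, U, hU, H⟩ := Mk_local ξ hξ
        have this : ∀ Θ : (Fin n→ℝ)→ℂ, Ann Θ → ∑' k:ℤ, Θ (((1024:ℝ)^k)⁻¹ • ξ) = Θ (((1024:ℝ)^k₀)⁻¹ • ξ) := fun Θ h => tsum_eq_single k₀ (H ξ (mem_of_mem_nhds hU) Θ h)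
        simp only [Mk]
        rw [this _ hAa]
        simp_rw [this _ (hA _)]
        rfl
    have hform : formM n (Mk Θa) (fun j => ⇑(F j)) = ∑' i, a i * formM n (Mk (Θ i)) (fun j => ⇑(F j)) := by
      rw [formM_eq]
      have e : ∀ i, a i * formM n (Mk (Θ i)) (fun j => ⇑(F j))
          = ∫ τ : Fin n → Fin n → ℝ, a i * (kerF F τ * Mk (Θ i) (fun j => τ j j)) := fun i => by
        rw [formM_eq, integral_const_mul]
      simp_rw [e]
      have hint : ∀ i, Integrable fun τ : Fin n → Fin n → ℝ => a i * (kerF F τ * Mk (Θ i) (fun j => τ j j)) :=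
        fun i => (kerm_int F (hMm i) (hMb i)).const_mul _
      rw [integral_tsum_of_summable_integral_norm hint]
      · congr 1; ext τ
        rw [hM, ← tsum_mul_left]
        congr 1; ext i; ring
      · refine Summable.of_nonneg_of_le (fun i => integral_nonneg fun τ => norm_nonneg _) (fun i => ?_) (hsa.mul_right (I F))
        simp only [I]
        rw [← integral_const_mul]
        refine integral_mono (hint i).norm (((kerF_int F).norm.mul_const _).const_mul _) fun τ => ?_
        simp only [norm_mul]
        exact mul_le_mul_of_nonneg_left (mul_le_mul_of_nonneg_left (hMb i _) (norm_nonneg _)) (norm_nonneg _)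
    have hg : g F a = ((nrm p F)⁻¹ : ℝ) * formM n (Mk Θa) (fun j => ⇑(F j)) := by
      rw [hform, ← tsum_mul_left]
      change ∑' i, a i * z F i = _
      congr 1; ext i; simp only [z]; ring
    rw [hg, norm_mul, Complex.norm_real, Real.norm_of_nonneg (inv_nonneg.2 (nrm_nonneg p F))]
    rcases (nrm_nonneg p F).eq_or_lt with h0 | h0
    · rw [← h0]; simp [hc.le]
    · rw [inv_mul_le_iff₀ h0, mul_comm]; exact hbd F
  obtain ⟨C, hC⟩ := hbs
  refine ⟨C, fun i F => ?_⟩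
  rcases (nrm_nonneg p F).eq_or_lt with h0 | h0
  · obtain ⟨c, hc, hbd⟩ := hyp _ (Mk_std (hA i) (hs i))
    have := hbd F
    rw [← h0, mul_zero] at this ⊢; exact this
  · have h1 := (g F).le_opNorm (lp.single 1 i (1:ℂ))
    have h2 : g F (lp.single 1 i (1:ℂ)) = z F i := by
      change ∑' i', (lp.single 1 i (1:ℂ) : lp (fun _ : ℕ => ℂ) 1) i' * z F i' = _
      rw [tsum_eq_single i]
      · simp
      · intro i' hi'
        simp [hi']
    rw [h2, lp.norm_single (by norm_num), norm_one, mul_one] at h1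
    have h3 := h1.trans (hC F)
    simp only [z] at h3
    rw [norm_mul, Complex.norm_real, Real.norm_of_nonneg (inv_nonneg.2 (nrm_nonneg p F)), inv_mul_le_iff₀ h0, mul_comm] at h3
    exact h3

lemma ubp {n : ℕ} {p : ℕ → ℝ} (hyp : Hyp n p) {ι : Type*} {Θ : ι → (Fin n → ℝ) → ℂ} (hA : ∀ i, Ann (Θ i))
    (hs : ∀ i, ContDiff ℝ (⊤ : ℕ∞) (Θ i))
    (hb : ∀ k : ℕ, ∃ C : ℝ, ∀ i ξ, ‖iteratedFDeriv ℝ k (Θ i) ξ‖ ≤ C) :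
    ∃ C : ℝ, 0 ≤ C ∧ ∀ i, Bd n p C (Mk (Θ i)) := by
  by_contra hcon
  push Not at hcon
  choose i hi using fun N : ℕ => hcon N (Nat.cast_nonneg N)
  obtain ⟨C, hC⟩ := ubp_seq hyp (Θ := fun N => Θ (i N)) (fun N => hA _) (fun N => hs _) (fun k => by
    obtain ⟨C, hC⟩ := hb k; exact ⟨C, fun N => hC (i N)⟩)
  obtain ⟨N, hN⟩ := exists_nat_ge C
  exact hi N ((hC N).mono hN)

lemma ex_family {n : ℕ} {p : ℕ → ℝ} (hyp : Hyp n p) {Θ : (Fin n → ℝ) → ℂ} (hA : Ann Θ)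
    (hs : ContDiff ℝ (⊤ : ℕ∞) Θ) :
    ∃ C : ℝ, 0 ≤ C ∧ ∀ θ : Fin n → ℝ, (∀ j, |θ j| ≤ 1) →
      Bd n p C (Mk (fun ξ => Θ ξ * ex (∑ j, θ j * ξ j))) := by
  let H : (Fin n → ℝ) × (Fin n → ℝ) → ℂ := fun x => Θ x.2 * ex (∑ j, x.1 j * x.2 j)
  have hH : ContDiff ℝ (⊤ : ℕ∞) H := by
    have h1 : ContDiff ℝ (⊤ : ℕ∞) (fun x : (Fin n → ℝ) × (Fin n → ℝ) => ∑ j, x.1 j * x.2 j) := by fun_prop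
    exact (hs.comp contDiff_snd).mul (ex_contDiff.comp h1)
  have hA' : ∀ θ : Fin n → ℝ, Ann (fun ξ => H (θ, ξ)) := fun θ ξ hξ => hA ξ (left_ne_zero_of_mul hξ)
  have hb : ∀ k : ℕ, ∃ C : ℝ, ∀ (θ : {θ : Fin n → ℝ // ∀ j, |θ j| ≤ 1}) (ξ : Fin n → ℝ),
      ‖iteratedFDeriv ℝ k (fun ξ => H (θ.1, ξ)) ξ‖ ≤ C := by
    intro k
    have hK : IsCompact ((Metric.closedBall (0 : Fin n → ℝ) 1) ×ˢ (Metric.closedBall (0 : Fin n → ℝ) 4)) :=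
      (isCompact_closedBall _ _).prod (isCompact_closedBall _ _)
    obtain ⟨C, hC⟩ := hK.exists_bound_of_continuousOn (f := iteratedFDeriv ℝ k H)
      (hH.continuous_iteratedFDeriv (m := k) (by exact_mod_cast le_top)).continuousOn
    have hC0 : 0 ≤ C := (norm_nonneg _).trans (hC (0,0) (by simp))
    refine ⟨C, fun θ ξ => ?_⟩
    by_cases hξ : ξ ∈ Metric.closedBall (0 : Fin n → ℝ) 4
    · have e : (fun ξ => H (θ.1, ξ)) = (fun x => H ((θ.1, 0) + x)) ∘ ⇑(ContinuousLinearMap.inr ℝ (Fin n → ℝ) (Fin n → ℝ)) := by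
        ext ξ; simp
      have hH2 : ContDiff ℝ (⊤ : ℕ∞) (fun x => H ((θ.1, 0) + x)) := hH.comp (contDiff_const.add contDiff_id)
      rw [e, ContinuousLinearMap.iteratedFDeriv_comp_right _ hH2 ξ (by exact_mod_cast le_top),
        iteratedFDeriv_comp_add_left]
      refine (ContinuousMultilinearMap.norm_compContinuousLinearMap_le _ _).trans ?_
      have h1 := hC ((θ.1, 0) + ContinuousLinearMap.inr ℝ (Fin n → ℝ) (Fin n → ℝ) ξ) (by
        simp only [ContinuousLinearMap.inr_apply, Prod.mk_add_mk, add_zero, zero_add]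
        refine ⟨?_, hξ⟩
        rw [mem_closedBall_zero_iff, pi_norm_le_iff_of_nonneg (by norm_num)]
        exact θ.2)
      calc _ ≤ C * ∏ i : Fin k, 1 := by
            gcongr
            exact ContinuousLinearMap.norm_inr_le_one _ _ _
        _ = C := by simp
    · have : ξ ∉ tsupport (fun ξ => H (θ.1, ξ)) := by
        intro h
        apply hξ
        have hsub : tsupport (fun ξ => H (θ.1, ξ)) ⊆ Metric.closedBall (0 : Fin n → ℝ) 4 := by
          apply closure_minimal _ Metric.isClosed_closedBall
          intro y hy
          rw [mem_closedBall_zero_iff]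
          exact (hA' θ.1 y hy).2
        exact hsub h
      have h2 : iteratedFDeriv ℝ k (fun ξ => H (θ.1, ξ)) ξ = 0 := by
        by_contra h
        exact this (support_iteratedFDeriv_subset k h)
      rw [h2, norm_zero]; exact hC0
  obtain ⟨C, hC, h⟩ := ubp hyp (ι := {θ : Fin n → ℝ // ∀ j, |θ j| ≤ 1}) (Θ := fun θ ξ => H (θ.1, ξ))
    (fun θ => hA' θ.1) (fun θ => hH.comp (contDiff_const.prodMk contDiff_id)) hb
  exact ⟨C, hC, fun θ hθ => h ⟨θ, hθ⟩⟩

noncomputable def cb : ContDiffBump (0:ℝ) := ⟨1, 2, by norm_num, by norm_num⟩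
noncomputable def c0 (x : ℝ) : ℂ := ((cb x : ℝ) : ℂ)
noncomputable def c1 (x : ℝ) : ℂ := c0 x - c0 (2*x)
noncomputable def c2 (x : ℝ) : ℂ := c0 (x/2) - c0 (4*x)

lemma c0_smooth : ContDiff ℝ (⊤ : ℕ∞) c0 := Complex.ofRealCLM.contDiff.comp cb.contDiff
lemma c1_smooth : ContDiff ℝ (⊤ : ℕ∞) c1 := by
  have := c0_smooth
  unfold c1; exact this.sub (this.comp (contDiff_const.mul contDiff_id))
lemma c2_smooth : ContDiff ℝ (⊤ : ℕ∞) c2 := by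
  have := c0_smooth
  unfold c2; exact (this.comp (contDiff_id.div_const _)).sub (this.comp (contDiff_const.mul contDiff_id))
lemma c0_one {x : ℝ} (h : |x| ≤ 1) : c0 x = 1 := by
  rw [c0, cb.one_of_mem_closedBall (by rw [mem_closedBall_zero_iff]; exact h)]; rfl
lemma c0_zero {x : ℝ} (h : 2 ≤ |x|) : c0 x = 0 := by
  rw [c0, cb.zero_of_le_dist (by rw [dist_zero_right]; exact h)]; rfl
lemma c0_norm (x : ℝ) : ‖c0 x‖ ≤ 1 := by
  rw [c0, Complex.norm_real, Real.norm_of_nonneg cb.nonneg]; exact cb.le_one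
lemma c0_supp {x : ℝ} (h : c0 x ≠ 0) : |x| ≤ 2 := by
  by_contra h'; exact h (c0_zero (by linarith))
lemma c1_norm (x : ℝ) : ‖c1 x‖ ≤ 2 := by
  refine (norm_sub_le _ _).trans ?_
  linarith [c0_norm x, c0_norm (2*x)]
lemma c1_supp {x : ℝ} (h : c1 x ≠ 0) : 1/2 ≤ |x| ∧ |x| ≤ 2 := by
  constructor
  · by_contra h'; apply h
    rw [c1, c0_one (by linarith), c0_one (by rw [abs_mul]; norm_num; linarith), sub_self]
  · by_contra h'; apply h
    rw [c1, c0_zero (by linarith), c0_zero (by rw [abs_mul]; norm_num; linarith), sub_self]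
lemma c2_supp {x : ℝ} (h : c2 x ≠ 0) : 1/4 ≤ |x| ∧ |x| ≤ 4 := by
  constructor
  · by_contra h'; apply h
    rw [c2, c0_one (by rw [abs_div]; norm_num; linarith), c0_one (by rw [abs_mul]; norm_num; linarith), sub_self]
  · by_contra h'; apply h
    rw [c2, c0_zero (by rw [abs_div]; norm_num; linarith), c0_zero (by rw [abs_mul]; norm_num; linarith), sub_self]
lemma c2_one {x : ℝ} (h : 1/2 ≤ |x|) (h' : |x| ≤ 2) : c2 x = 1 := by
  rw [c2, c0_one (by rw [abs_div]; norm_num; linarith), c0_zero (by rw [abs_mul]; norm_num; linarith), sub_zero]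

/-- the pieces -/
noncomputable def pc (θ : ℝ) (l : ℕ) (z : ℝ) : ℂ := if l = 0 then ex (θ * z) * c0 z else ex (θ * 2^l * z) * c1 z

lemma pc_cont (θ l) : Continuous (pc θ l) := by
  have h0 := c0_smooth.continuous
  have h1 := c1_smooth.continuous
  have := ex_cont
  unfold pc
  split_ifs <;> fun_prop
lemma pc_norm (θ l z) : ‖pc θ l z‖ ≤ 2 := by
  unfold pc
  split_ifs <;> rw [norm_mul, ex_norm, one_mul]
  · linarith [c0_norm z]
  · exact c1_norm z

lemma pc_sum (θ : ℝ) (L : ℕ) (x : ℝ) :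
    c0 x * ex (θ * 2^L * x) = ∑ l ∈ Finset.range (L+1), pc θ l (2^(L-l) * x) := by
  rw [Finset.sum_range_succ']
  have e : ∀ l ∈ Finset.range L, pc θ (l+1) (2^(L-(l+1)) * x) =
      ex (θ * 2^L * x) * (c0 (2^(L-(l+1)) * x) - c0 (2^(L-l) * x)) := by
    intro l hl
    rw [Finset.mem_range] at hl
    have h1 : (2:ℝ)^L = 2^(l+1) * 2^(L-(l+1)) := by rw [← pow_add]; congr 1; omega
    have h2 : (2:ℝ)^(L-l) = 2 * 2^(L-(l+1)) := by rw [← pow_succ']; congr 1; omega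
    rw [pc, if_neg (by omega), c1, h2, h1]
    congr 2 <;> ring_nf
  rw [Finset.sum_congr rfl e, ← Finset.mul_sum, Finset.sum_range_sub (f := fun l => c0 (2^(L-l) * x)) L]
  simp only [pc, if_true, Nat.sub_self, pow_zero, one_mul, Nat.sub_zero]
  have : θ * (2^L * x) = θ * 2^L * x := by ring
  rw [this]; ring

/-- generic finite-scale symbol -/
noncomputable def sy {N : ℕ} (S : Finset ℤ) (ψ : ℝ → ℂ) (A : Fin N → ℝ → ℂ) (ξ : Fin (N+1) → ℝ) : ℂ :=
  ∑ k ∈ S, ψ (((1024:ℝ)^k)⁻¹ * ξ 0) * ∏ j, A j (((1024:ℝ)^k)⁻¹ * ξ j.succ)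

lemma sy_cont {N : ℕ} (S : Finset ℤ) {ψ : ℝ → ℂ} {A : Fin N → ℝ → ℂ} (hψ : Continuous ψ) (hA : ∀ j, Continuous (A j)) :
    Continuous (sy S ψ A) := by
  unfold sy
  refine continuous_finsetSum _ fun k _ => ?_
  refine (hψ.comp (by fun_prop)).mul (continuous_finsetProd _ fun j _ => (hA j).comp (by fun_prop))

lemma sy_bdd {N : ℕ} (S : Finset ℤ) {ψ : ℝ → ℂ} {A : Fin N → ℝ → ℂ} {M M' : ℝ}
    (hψ : ∀ z, ‖ψ z‖ ≤ M) (hs : ∀ z, ψ z ≠ 0 → 1/4 ≤ |z| ∧ |z| ≤ 4) (hA : ∀ j z, ‖A j z‖ ≤ M') (ξ) :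
    ‖sy S ψ A ξ‖ ≤ M * M' ^ N := by
  have hM : 0 ≤ M := (norm_nonneg _).trans (hψ 0)
  have h1 : ∀ k : ℤ, ‖∏ j, A j (((1024:ℝ)^k)⁻¹ * ξ j.succ)‖ ≤ M' ^ N := by
    intro k
    rw [norm_prod]
    calc _ ≤ ∏ j : Fin N, M' := Finset.prod_le_prod (fun _ _ => norm_nonneg _) fun j _ => hA j _
      _ = _ := by simp
  unfold sy
  by_cases h : ∃ k ∈ S, ψ (((1024:ℝ)^k)⁻¹ * ξ 0) ≠ 0
  · obtain ⟨k₀, hk₀, hne⟩ := h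
    rw [Finset.sum_eq_single_of_mem k₀ hk₀]
    · rw [norm_mul]; exact mul_le_mul (hψ _) (h1 _) (norm_nonneg _) hM
    · intro k _ hk
      have : ψ (((1024:ℝ)^k)⁻¹ * ξ 0) = 0 := by
        by_contra h'
        exact hk (B_sep (hs _ h').1 (hs _ h').2 (hs _ hne).1 (hs _ hne).2)
      rw [this, zero_mul]
  · push Not at h
    rw [Finset.sum_eq_zero, norm_zero]
    · exact mul_nonneg hM ((norm_nonneg _).trans (h1 0))
    · intro k hk; rw [h k hk, zero_mul]

lemma sy_factor {N : ℕ} (S : Finset ℤ) {ψ : ℝ → ℂ} (hs : ∀ z, ψ z ≠ 0 → 1/2 ≤ |z| ∧ |z| ≤ 2)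
    (A : Fin N → ℝ → ℂ) (b : Fin N → Prop) [DecidablePred b]
    (hA : ∀ j, b j → ∀ z, A j z ≠ 0 → 1/2 ≤ |z| ∧ |z| ≤ 2) (ξ : Fin (N+1) → ℝ) :
    sy S ψ A ξ = (∏ i, (Fin.cons (fun z => ∑ k ∈ S, ψ (((1024:ℝ)^k)⁻¹ * z))
        (fun j => if b j then fun z => ∑ k ∈ S, A j (((1024:ℝ)^k)⁻¹ * z) else fun _ => 1) : Fin (N+1) → ℝ → ℂ) i (ξ i)) *
      Mk (fun ξ => c2 (ξ 0) * ∏ j : Fin N, if b j then c2 (ξ j.succ) else A j (ξ j.succ)) ξ := by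
  rw [Fin.prod_univ_succ]
  simp only [Fin.cons_zero, Fin.cons_succ]
  by_cases h : ∃ k ∈ S, ψ (((1024:ℝ)^k)⁻¹ * ξ 0) ≠ 0
  · obtain ⟨k₀, hk₀, hne⟩ := h
    have h0 := hs _ hne
    have hz : ∀ k, k ≠ k₀ → ψ (((1024:ℝ)^k)⁻¹ * ξ 0) = 0 := by
      intro k hk
      by_contra h'
      have h3 := hs _ h'
      exact hk (B_sep (z := ξ 0) (by linarith) (by linarith) (by linarith [h0.1]) (by linarith [h0.2]))
    have hz2 : ∀ k, k ≠ k₀ → c2 (((1024:ℝ)^k)⁻¹ * ξ 0) = 0 := by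
      intro k hk
      by_contra h'
      have h3 := c2_supp h'
      exact hk (B_sep h3.1 h3.2 (by linarith [h0.1]) (by linarith [h0.2]))
    rw [sy, Finset.sum_eq_single_of_mem k₀ hk₀ (fun k _ hk => by rw [hz k hk, zero_mul]),
      Finset.sum_eq_single_of_mem k₀ hk₀ (fun k _ hk => hz k hk), Mk,
      tsum_eq_single k₀ (fun k hk => by simp only [Pi.smul_apply, smul_eq_mul, hz2 k hk, zero_mul])]
    simp only [Pi.smul_apply, smul_eq_mul]
    rw [c2_one h0.1 h0.2, one_mul, mul_assoc, ← Finset.prod_mul_distrib]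
    congr 1
    refine Finset.prod_congr rfl fun j _ => ?_
    by_cases hb : b j
    · simp only [if_pos hb]
      by_cases hc : c2 (((1024:ℝ)^k₀)⁻¹ * ξ j.succ) = 0
      · rw [hc, mul_zero]
        by_contra h'
        have h3 := hA j hb _ h'
        rw [c2_one h3.1 h3.2] at hc
        exact one_ne_zero hc
      · have h4 := c2_supp hc
        rw [Finset.sum_eq_single_of_mem k₀ hk₀]
        · by_cases h' : A j (((1024:ℝ)^k₀)⁻¹ * ξ j.succ) = 0
          · rw [h', zero_mul]
          · have h3 := hA j hb _ h'
            rw [c2_one h3.1 h3.2, mul_one]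
        · intro k _ hk
          by_contra h'
          have h3 := hA j hb _ h'
          exact hk (B_sep (z := ξ j.succ) (by linarith) (by linarith) h4.1 h4.2)
    · simp only [if_neg hb, one_mul]
  · push Not at h
    rw [sy, Finset.sum_eq_zero (fun k hk => by rw [h k hk, zero_mul]), Finset.sum_eq_zero h, zero_mul, zero_mul]

lemma piece {N : ℕ} {p : ℕ → ℝ} (hp : ∀ j ≤ N+1, 1 < p j) (hyp : Hyp (N+1) p) {ε : ℝ} (hε : 0 < ε) (hε1 : ε ≤ 1)
    {ψ : ℝ → ℂ} (hψ : ContDiff ℝ (⊤ : ℕ∞) ψ) (hs : ∀ z, ψ z ≠ 0 → 1/2 ≤ |z| ∧ |z| ≤ 2) :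
    ∃ C : ℝ, 0 ≤ C ∧ ∀ (S : Finset ℤ) (θ : Fin N → ℝ), (∀ j, |θ j| ≤ 1) → ∀ (L : ℕ) (l : Fin N → ℕ), (∀ j, l j ≤ L) →
      Bd (N+1) p (C * ((1 + 2^L : ℝ)^ε)^N) (sy S ψ (fun j => pc (θ j) (l j))) := by
  classical
  let Θ0 : (Fin N → Bool) → (Fin (N+1) → ℝ) → ℂ := fun b ξ =>
    c2 (ξ 0) * ∏ j : Fin N, if b j then c2 (ξ j.succ) else c0 (ξ j.succ)
  have hA0 : ∀ b, Ann (Θ0 b) := by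
    intro b ξ hξ
    have h0 := c2_supp (left_ne_zero_of_mul hξ)
    refine ⟨h0.1.trans (norm_le_pi_norm ξ 0), ?_⟩
    rw [pi_norm_le_iff_of_nonneg (by norm_num)]
    refine Fin.cases h0.2 fun j => ?_
    have h1 := Finset.prod_ne_zero_iff.1 (right_ne_zero_of_mul hξ) j (Finset.mem_univ _)
    split_ifs at h1 with hb
    · exact (c2_supp h1).2
    · exact (c0_supp h1).trans (by norm_num)
  have hs0 : ∀ b, ContDiff ℝ (⊤ : ℕ∞) (Θ0 b) := by
    intro b
    refine (c2_smooth.comp (contDiff_apply ℝ ℝ _)).mul (contDiff_prod fun j _ => ?_)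
    split_ifs
    · exact c2_smooth.comp (contDiff_apply ℝ ℝ _)
    · exact c0_smooth.comp (contDiff_apply ℝ ℝ _)
  choose C1 hC1 hB1 using fun b => ex_family hyp (hA0 b) (hs0 b)
  choose C2 hC2 hB2 using fun j : Fin (N+1) => T_mod (m := N) (hp (j.1+1) (by omega)) hε hε1 c1_smooth
    (fun z hz => by have := c1_supp hz; constructor <;> linarith)
  obtain ⟨C3, hC3, hB3⟩ := T_mod (m := N) (hp 1 (by omega)) hε hε1 hψ
    (fun z hz => by have := hs z hz; constructor <;> linarith)
  refine ⟨(∑ b, C1 b) * (C3 * ∏ j : Fin N, (1 + C2 j.succ)), 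
    mul_nonneg (Finset.sum_nonneg fun b _ => hC1 b) (mul_nonneg hC3 (Finset.prod_nonneg fun j _ => by linarith [hC2 j.succ])), ?_⟩
  intro S θ hθ L l hl
  let b : Fin N → Bool := fun j => decide (l j ≠ 0)
  have hfac := sy_factor (N := N) S hs (fun j => pc (θ j) (l j)) (fun j => b j = true) (by
    intro j hb z hz
    have hl0 : l j ≠ 0 := by simpa [b] using hb
    simp only [pc, if_neg hl0] at hz
    exact c1_supp (right_ne_zero_of_mul hz))
  have hX1 : (1:ℝ) ≤ (1 + 2^L : ℝ)^ε := Real.one_le_rpow (by linarith [show (0:ℝ) ≤ 2^L by positivity]) hε.le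
  have hmk : Bd (N+1) p (∑ b, C1 b) (Mk (fun ξ => c2 (ξ 0) * ∏ j : Fin N, if b j = true then c2 (ξ j.succ) else pc (θ j) (l j) (ξ j.succ))) := by
    have := (hB1 b (Fin.cons 0 fun j => if b j then 0 else θ j) (by
      refine Fin.cases (by simp) fun j => ?_
      simp only [Fin.cons_succ]
      split_ifs
      · simp
      · exact hθ j)).mono (Finset.single_le_sum (f := C1) (fun b _ => hC1 b) (Finset.mem_univ b))
    convert this using 3 with ξ
    rw [Fin.sum_univ_succ]
    simp only [Fin.cons_zero, Fin.cons_succ, zero_mul, zero_add]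
    rw [ex_sum, mul_assoc, ← Finset.prod_mul_distrib]
    congr 1
    refine Finset.prod_congr rfl fun j _ => ?_
    by_cases hb : b j
    · simp [hb, ex_zero]
    · have hl0 : l j = 0 := by simpa [b] using hb
      simp only [hb, pc, hl0, if_true]
      simp [mul_comm]
  have key := Bd.comp (Finset.sum_nonneg fun b _ => hC1 b) hmk
    (A := Fin.cons (fun z => ∑ k ∈ S, ψ (((1024:ℝ)^k)⁻¹ * z))
        (fun j => if b j = true then fun z => ∑ k ∈ S, pc (θ j) (l j) (((1024:ℝ)^k)⁻¹ * z) else fun _ => 1))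
    (K := Fin.cons C3 fun j => (1 + C2 j.succ) * (1 + 2^L : ℝ)^ε) (by
      refine Fin.cases ?_ fun j => ?_
      · intro F
        obtain ⟨F', h1, h2⟩ := hB3 0 S 0 F
        refine ⟨F', ?_, ?_⟩
        · simpa [ex_zero] using h1
        · simpa using h2
      · intro F
        simp only [Fin.cons_succ]
        by_cases hb : b j
        · obtain ⟨F', h1, h2⟩ := hB2 j.succ (θ j * 2^(l j)) S j.succ F
          have hl0 : l j ≠ 0 := by simpa [b] using hb
          refine ⟨F', ?_, ?_⟩
          · intro ξ; rw [h1, if_pos hb]; simp only [pc, if_neg hl0]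
          · refine h2.trans (mul_le_mul_of_nonneg_right ?_ ENNReal.toReal_nonneg)
            have : |θ j * 2^(l j)| ≤ 2^L := by
              rw [abs_mul, abs_of_pos (show (0:ℝ) < 2^(l j) by positivity)]
              calc _ ≤ 1 * (2:ℝ)^L := by
                    gcongr
                    · exact hθ j
                    · norm_num
                    · exact hl j
                _ = _ := one_mul _
            have hc := hC2 j.succ
            gcongr
            linarith
        · refine ⟨F, ?_, ?_⟩
          · intro ξ; rw [if_neg hb, one_mul]
          · refine le_mul_of_one_le_left ENNReal.toReal_nonneg ?_
            have hc := hC2 j.succ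
            nlinarith)
  have e : sy S ψ (fun j => pc (θ j) (l j)) = _ := funext hfac
  rw [e]
  refine key.mono (le_of_eq ?_)
  rw [Fin.prod_univ_succ]
  simp only [Fin.cons_zero, Fin.cons_succ]
  rw [Finset.prod_mul_distrib, Finset.prod_const, Finset.card_univ, Fintype.card_fin]
  ring

lemma bdd_of {ψ : ℝ → ℂ} (hψ : Continuous ψ) (hs : ∀ z, ψ z ≠ 0 → |z| ≤ 2) : ∃ M, 0 ≤ M ∧ ∀ z, ‖ψ z‖ ≤ M := by
  have hcs : HasCompactSupport ψ := by
    refine HasCompactSupport.intro (isCompact_Icc (a := (-2:ℝ)) (b := 2)) fun x hx => ?_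
    by_contra h
    exact hx (abs_le.1 (hs x h))
  obtain ⟨M, hM⟩ := hcs.exists_bound_of_continuous hψ
  exact ⟨M, (norm_nonneg _).trans (hM 0), hM⟩

lemma modS {N : ℕ} {p : ℕ → ℝ} (hp : ∀ j ≤ N+1, 1 < p j)
    (hsum : ∑ j ∈ Finset.range (N + 1 + 1), 1 / p j = 1) (hyp : Hyp (N+1) p)
    {ψ : ℝ → ℂ} (hψ : ContDiff ℝ (⊤ : ℕ∞) ψ) (hs : ∀ z, ψ z ≠ 0 → 1/2 ≤ |z| ∧ |z| ≤ 2) :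
    ∃ C : ℝ, 0 ≤ C ∧ ∀ (S : Finset ℤ) (R : ℝ), 1 ≤ R → ∀ (β : Fin N → ℝ), (∀ j, |β j| ≤ R) → 
      Bd (N+1) p (C * R ^ (1/2 : ℝ)) (sy S ψ (fun j x => c0 x * ex (β j * x))) := by
  set ε : ℝ := 1 / (4 * (N+1)) with hεd
  have hε : 0 < ε := by positivity
  have hε1 : ε ≤ 1 := by rw [hεd, div_le_one (by positivity)]; linarith [show (0:ℝ) ≤ N by positivity]
  obtain ⟨C, hC, h⟩ := piece hp hyp hε hε1 hψ hs
  obtain ⟨M, hM0, hM⟩ := bdd_of hψ.continuous fun z hz => (hs z hz).2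
  set a : ℝ := 2^ε - 1 with had
  have ha : 0 < a := by
    have := Real.one_lt_rpow (x := 2) (by norm_num) hε; linarith
  have ha1 : a ≤ 1 := by
    have := Real.rpow_le_rpow_of_exponent_le (x := 2) (by norm_num) hε1
    rw [Real.rpow_one] at this; linarith
  refine ⟨C * (a⁻¹)^N * 2, by positivity, ?_⟩
  intro S R hR β hβ
  obtain ⟨L, hL1, hL2⟩ := exists_nat_pow_near hR (by norm_num : (1:ℝ) < 2)
  -- use exponent L+1
  set θ : Fin N → ℝ := fun j => β j / 2^(L+1) with hθd
  have hθ : ∀ j, |θ j| ≤ 1 := by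
    intro j
    rw [hθd]; simp only
    rw [abs_div, abs_of_pos (show (0:ℝ) < 2^(L+1) by positivity), div_le_one (by positivity)]
    exact (hβ j).trans hL2.le
  set K := L + 1 with hK
  have e : sy S ψ (fun j x => c0 x * ex (β j * x)) = fun ξ => ∑ l ∈ Fintype.piFinset (fun _ : Fin N => Finset.range (K+1)),
      sy S ψ (fun j => pc (θ j) (l j)) (fun i => (Fin.cons 1 (fun j => 2^(K - l j)) : Fin (N+1) → ℝ) i * ξ i) := by
    ext ξ
    simp only [sy]
    rw [Finset.sum_comm]
    refine Finset.sum_congr rfl fun k _ => ?_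
    simp only [Fin.cons_zero, Fin.cons_succ, one_mul]
    rw [← Finset.mul_sum]
    congr 1
    have e1 : ∀ j : Fin N, c0 (((1024:ℝ)^k)⁻¹ * ξ j.succ) * ex (β j * (((1024:ℝ)^k)⁻¹ * ξ j.succ))
        = ∑ l ∈ Finset.range (K+1), pc (θ j) l (((1024:ℝ)^k)⁻¹ * (2^(K-l) * ξ j.succ)) := by
      intro j
      have := pc_sum (θ j) K (((1024:ℝ)^k)⁻¹ * ξ j.succ)
      have h2 : θ j * 2^K = β j := by rw [hθd]; simp only; field_simp
      rw [h2] at this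
      rw [this]
      refine Finset.sum_congr rfl fun l _ => ?_
      congr 1; ring
    simp_rw [e1]
    rw [Finset.prod_univ_sum]
  have hX1 : (1:ℝ) ≤ (1 + 2^K : ℝ) := by linarith [show (0:ℝ) ≤ 2^K by positivity]
  have hb : Bd (N+1) p (∑ l ∈ Fintype.piFinset (fun _ : Fin N => Finset.range (K+1)), C * ((1 + 2^K : ℝ)^ε)^N)
      (sy S ψ (fun j x => c0 x * ex (β j * x))) := by
    rw [e]
    refine Bd.sum _ ?_ ?_ ?_
    · intro l _
      have := (sy_cont S hψ.continuous (fun j => pc_cont (θ j) (l j))).measurable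
      refine this.comp ?_
      fun_prop
    · intro l _
      refine ⟨M * 2^N, fun ξ => sy_bdd S hM (fun z hz => ?_) (fun j z => pc_norm _ _ _) _⟩
      have := hs z hz; constructor <;> linarith
    · intro l hl
      refine Bd.dil hp hsum (h S θ hθ K l fun j => ?_) _ ?_
      · have := Fintype.mem_piFinset.1 hl j
        rw [Finset.mem_range] at this; omega
      · refine Fin.cases (by simp) fun j => ?_
        simp
  refine hb.mono ?_
  rw [Finset.sum_const, Fintype.card_piFinset, Finset.prod_const, Finset.card_univ, Fintype.card_fin, Finset.card_range, nsmul_eq_mul]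
  have hK1 : ((K+1 : ℕ) : ℝ) ≤ a⁻¹ * (1 + 2^K : ℝ)^ε := by
    have h1 := one_add_mul_le_pow (a := a) (by linarith) K
    have h2 : (1 + a)^K = ((2:ℝ)^K)^ε := by
      rw [had, add_sub_cancel, ← Real.rpow_natCast, ← Real.rpow_mul (by norm_num), ← Real.rpow_natCast, ← Real.rpow_mul (by norm_num), mul_comm]
    have h3 : ((2:ℝ)^K)^ε ≤ (1 + 2^K : ℝ)^ε := Real.rpow_le_rpow (by positivity) (by linarith) hε.le
    rw [le_inv_mul_iff₀ ha]
    push_cast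
    nlinarith
  have h4 : ((1 + 2^K : ℝ)^ε)^N * ((1 + 2^K : ℝ)^ε)^N ≤ 2 * R ^ (1/2:ℝ) + 0 := by
    rw [← mul_pow, ← Real.rpow_add (by positivity), ← Real.rpow_natCast, ← Real.rpow_mul (by positivity)]
    calc (1 + 2^K : ℝ) ^ ((ε + ε) * N) ≤ (1 + 2^K : ℝ)^(1/2:ℝ) := by
          apply Real.rpow_le_rpow_of_exponent_le hX1
          rw [hεd]; field_simp; linarith
      _ ≤ (4 * R)^(1/2:ℝ) := by
          apply Real.rpow_le_rpow (by positivity) _ (by norm_num)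
          rw [hK, pow_succ]; linarith
      _ = 2 * R^(1/2:ℝ) + 0 := by
          rw [Real.mul_rpow (by norm_num) (by linarith), add_zero]
          congr 1
          rw [← Real.sqrt_eq_rpow, show (4:ℝ) = 2^2 by norm_num, Real.sqrt_sq (by norm_num)]
  rw [add_zero] at h4
  push_cast at hK1 ⊢
  calc ((K:ℝ)+1)^N * (C * ((1 + 2^K : ℝ)^ε)^N) ≤ (a⁻¹ * (1 + 2^K : ℝ)^ε)^N * (C * ((1 + 2^K : ℝ)^ε)^N) := by gcongr
    _ = C * (a⁻¹)^N * (((1 + 2^K : ℝ)^ε)^N * ((1 + 2^K : ℝ)^ε)^N) := by rw [mul_pow]; ring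
    _ ≤ C * (a⁻¹)^N * (2 * R ^ (1/2:ℝ)) := by gcongr
    _ = _ := by ring

lemma modPhi_id {N : ℕ} {ψ φ : ℝ → ℂ} (hφs : ∀ z, φ z ≠ 0 → |z| ≤ 1) (κ : SchwartzMap ℝ ℂ)
    (hA : ∀ x, φ x = ∫ u, ex (-(u * x)) * κ u) (S : Finset ℤ) (η : ℝ) (α : Fin N → ℝ) (ξ : Fin (N+1) → ℝ) :
    sy S ψ (fun j x => φ x * ex (η * α j * x)) ξ = ∫ u : Fin N → ℝ,
      (∏ j, κ (u j)) * sy S ψ (fun j x => c0 x * ex ((η * α j - u j) * x)) ξ := by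
  have hint : ∀ k : ℤ, Integrable fun u : Fin N → ℝ => ∏ j, (κ (u j) * (c0 (((1024:ℝ)^k)⁻¹ * ξ j.succ) * ex ((η * α j - u j) * (((1024:ℝ)^k)⁻¹ * ξ j.succ)))) := by
    intro k
    refine Integrable.fintype_prod (f := fun j => fun u : ℝ => κ u * (c0 (((1024:ℝ)^k)⁻¹ * ξ j.succ) * ex ((η * α j - u) * (((1024:ℝ)^k)⁻¹ * ξ j.succ)))) fun j => ?_
    refine (κ.integrable (μ := volume)).mul_bdd (c := 1) ?_ (Filter.Eventually.of_forall fun u => ?_)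
    · have := ex_cont
      exact Continuous.aestronglyMeasurable (by fun_prop)
    · rw [norm_mul, ex_norm, mul_one]; exact c0_norm _
  have e2 : ∀ u : Fin N → ℝ, (∏ j, κ (u j)) * sy S ψ (fun j x => c0 x * ex ((η * α j - u j) * x)) ξ = ∑ k ∈ S, ψ (((1024:ℝ)^k)⁻¹ * ξ 0) * ∏ j, (κ (u j) * (c0 (((1024:ℝ)^k)⁻¹ * ξ j.succ) * ex ((η * α j - u j) * (((1024:ℝ)^k)⁻¹ * ξ j.succ)))) := by
    intro u
    simp only [sy, Finset.mul_sum, Finset.prod_mul_distrib]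
    refine Finset.sum_congr rfl fun k _ => ?_
    ring
  simp_rw [e2]
  rw [integral_finsetSum _ fun k _ => (hint k).const_mul _, sy]
  refine Finset.sum_congr rfl fun k _ => ?_
  rw [integral_const_mul]
  congr 1
  rw [integral_fintype_prod_volume_eq_prod (f := fun j => fun u : ℝ => κ u * (c0 (((1024:ℝ)^k)⁻¹ * ξ j.succ) * ex ((η * α j - u) * (((1024:ℝ)^k)⁻¹ * ξ j.succ))))]
  refine Finset.prod_congr rfl fun j _ => ?_
  set x := ((1024:ℝ)^k)⁻¹ * ξ j.succ
  have e3 : ∀ u, κ u * (c0 x * ex ((η * α j - u) * x)) = (c0 x * ex (η * α j * x)) * (ex (-(u * x)) * κ u) := by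
    intro u
    rw [show (η * α j - u) * x = η * α j * x + -(u*x) by ring, ex_add]; ring
  simp_rw [e3]
  rw [integral_const_mul, ← hA]
  by_cases h0 : φ x = 0
  · simp [h0]
  · rw [c0_one (hφs x h0)]; ring

lemma exists_kappa {φ : ℝ → ℂ} (hφ : ContDiff ℝ (⊤ : ℕ∞) φ) (hφs : ∀ z, φ z ≠ 0 → |z| ≤ 1) :
    ∃ κ : SchwartzMap ℝ ℂ, ∀ x, φ x = ∫ u, ex (-(u * x)) * κ u := by
  have hcs : HasCompactSupport φ := by
    refine HasCompactSupport.intro (isCompact_Icc (a := (-1:ℝ)) (b := 1)) fun x hx => ?_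
    by_contra h
    exact hx (abs_le.1 (hφs x h))
  refine ⟨𝓕⁻ (hcs.toSchwartzMap hφ), fun x => ?_⟩
  rw [← fourier_ex]
  rfl

lemma one_le_prod_abs {ι : Type*} (s : Finset ι) (u : ι → ℝ) : 1 ≤ ∏ j ∈ s, (1 + |u j|) := by
  have := Finset.prod_le_prod (s := s) (f := fun _ => (1:ℝ)) (g := fun j => 1 + |u j|) (fun _ _ => by norm_num)
    fun j _ => by linarith [abs_nonneg (u j)]
  rwa [Finset.prod_const_one] at this

lemma modPhi {N : ℕ} {p : ℕ → ℝ} (hp : ∀ j ≤ N+1, 1 < p j)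
    (hsum : ∑ j ∈ Finset.range (N + 1 + 1), 1 / p j = 1) (hyp : Hyp (N+1) p)
    {ψ : ℝ → ℂ} (hψ : ContDiff ℝ (⊤ : ℕ∞) ψ) (hs : ∀ z, ψ z ≠ 0 → 1/2 ≤ |z| ∧ |z| ≤ 2)
    {φ : ℝ → ℂ} (hφ : ContDiff ℝ (⊤ : ℕ∞) φ) (hφs : ∀ z, φ z ≠ 0 → |z| ≤ 1) :
    ∃ C : ℝ, 0 ≤ C ∧ ∀ (S : Finset ℤ) (η : ℝ) (α : Fin N → ℝ), (∀ j, |α j| ≤ 1) → 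
      Bd (N+1) p (C * (1 + |η|) ^ (1/2 : ℝ)) (sy S ψ (fun j x => φ x * ex (η * α j * x))) := by
  obtain ⟨C, hC, h⟩ := modS hp hsum hyp hψ hs
  obtain ⟨M, hM0, hM⟩ := bdd_of hψ.continuous fun z hz => (hs z hz).2
  obtain ⟨κ, hA⟩ := exists_kappa hφ hφs
  have hi1 : Integrable (fun u => ‖κ u‖ * (1 + |u|)) := by
    have h1 := (κ.integrable (μ := volume)).norm
    have h2 := κ.integrable_pow_mul (volume) 1
    refine (h1.add h2).congr (Filter.Eventually.of_forall fun u => ?_)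
    simp only [Pi.add_apply, pow_one, Real.norm_eq_abs]; ring
  have hI0 : Integrable (fun u : Fin N → ℝ => ∏ j, ‖κ (u j)‖) :=
    Integrable.fintype_prod (f := fun _ => fun u : ℝ => ‖κ u‖) fun _ => (κ.integrable (μ := volume)).norm
  have hI1 : Integrable (fun u : Fin N → ℝ => ∏ j, (‖κ (u j)‖ * (1 + |u j|))) :=
    Integrable.fintype_prod (f := fun _ => fun u : ℝ => ‖κ u‖ * (1 + |u|)) fun _ => hi1
  obtain ⟨I, hId⟩ : ∃ I : ℝ, I = ∫ u : Fin N → ℝ, ∏ j, (‖κ (u j)‖ * (1 + |u j|)) := ⟨_, rfl⟩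
  have hI : 0 ≤ I := by
    rw [hId]; exact integral_nonneg fun u => Finset.prod_nonneg fun j _ => by positivity
  refine ⟨C * I, by positivity, ?_⟩
  intro S η α hα
  let m : (Fin N → ℝ) → (Fin (N+1) → ℝ) → ℂ := fun u ξ =>
    (∏ j, κ (u j)) * sy S ψ (fun j x => c0 x * ex ((η * α j - u j) * x)) ξ
  have e : sy S ψ (fun j x => φ x * ex (η * α j * x)) = fun ξ => ∫ u, m u ξ :=
    funext fun ξ => modPhi_id hφs κ hA S η α ξ
  rw [e]
  have hIA : Integrable (fun u : Fin N → ℝ => (∏ j, ‖κ (u j)‖) * (M * 1^N)) := hI0.mul_const _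
  have hIC : Integrable (fun u : Fin N → ℝ => (∏ j, (‖κ (u j)‖ * (1 + |u j|))) * (C * (1 + |η|)^(1/2:ℝ))) := hI1.mul_const _
  have hmeas : Measurable (Function.uncurry m) := by
    have hc : Continuous (Function.uncurry m) := by
      have h1 := ex_cont
      have h2 := c0_smooth.continuous
      have h3 := hψ.continuous
      have h4 := κ.continuous
      simp only [m, sy, Function.uncurry_def]
      fun_prop
    exact hc.measurable
  have hmb : ∀ u ξ, ‖m u ξ‖ ≤ (∏ j, ‖κ (u j)‖) * (M * 1^N) := by
    intro u ξ
    simp only [m, norm_mul, norm_prod]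
    gcongr
    refine sy_bdd S hM (fun z hz => ?_) (fun j z => ?_) _
    · have := hs z hz; constructor <;> linarith
    · rw [norm_mul, ex_norm, mul_one]; exact c0_norm _
  have hmB : ∀ u : Fin N → ℝ, Bd (N+1) p ((∏ j, (‖κ (u j)‖ * (1 + |u j|))) * (C * (1 + |η|)^(1/2:ℝ))) (m u) := by
    intro u
    have hP : (1:ℝ) ≤ ∏ j, (1 + |u j|) := by
      exact one_le_prod_abs _ _
    have hη : 1 ≤ 1 + |η| := by linarith [abs_nonneg η]
    have hb := (h S ((1 + |η|) * ∏ j, (1 + |u j|)) (by nlinarith) (fun j => η * α j - u j) (by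
      intro j
      have h1 : 1 + |u j| ≤ ∏ j, (1 + |u j|) := by
        rw [← Finset.mul_prod_erase Finset.univ (fun j => 1 + |u j|) (Finset.mem_univ j)]
        refine le_mul_of_one_le_right (by positivity) ?_
        exact one_le_prod_abs _ _
      have h2 : |η * α j| ≤ |η| := by
        rw [abs_mul]; exact mul_le_of_le_one_right (abs_nonneg _) (hα j)
      have h3 := abs_sub (η * α j) (u j)
      nlinarith [abs_nonneg η, abs_nonneg (u j)])).smul (∏ j, κ (u j))
    refine hb.mono ?_
    rw [norm_prod, Finset.prod_mul_distrib, Real.mul_rpow (by positivity) (by positivity)]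
    have h5 : (∏ j, (1 + |u j|))^(1/2:ℝ) ≤ ∏ j, (1 + |u j|) := by
      conv_rhs => rw [← Real.rpow_one (∏ j, (1 + |u j|))]
      exact Real.rpow_le_rpow_of_exponent_le hP (by norm_num)
    calc (∏ j, ‖κ (u j)‖) * (C * ((1 + |η|)^(1/2:ℝ) * (∏ j, (1 + |u j|))^(1/2:ℝ)))
        ≤ (∏ j, ‖κ (u j)‖) * (C * ((1 + |η|)^(1/2:ℝ) * (∏ j, (1 + |u j|)))) := by gcongr
      _ = _ := by ring
  have := Bd.avg hmeas hmb hIA hIC hmB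
  refine this.mono ?_
  rw [integral_mul_const]
  exact le_of_eq (by rw [hId]; ring)

def ExpSer (D : ℝ) (g : ℝ → ℂ) : Prop := ∃ (ι : Type) (_ : Countable ι) (c : ι → ℂ) (η : ι → ℝ),
  Summable (fun i => ‖c i‖ * (1 + |η i|) ^ (1/2:ℝ)) ∧ ∀ r, |r| ≤ D → HasSum (fun i => c i * ex (η i * r)) (g r)

lemma ExpSer.add {D : ℝ} {g h : ℝ → ℂ} (hg : ExpSer D g) (hh : ExpSer D h) : ExpSer D (fun r => g r + h r) := by
  obtain ⟨ι, hι, c, η, h1, h2⟩ := hg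
  obtain ⟨ι', hι', c', η', h1', h2'⟩ := hh
  refine ⟨ι ⊕ ι', inferInstance, Sum.elim c c', Sum.elim η η', ?_, fun r hr => ?_⟩
  · exact (HasSum.sum (f := fun i => ‖Sum.elim c c' i‖ * (1 + |Sum.elim η η' i|) ^ (1/2:ℝ)) h1.hasSum h1'.hasSum).summable
  · exact HasSum.sum (f := fun i => Sum.elim c c' i * ex (Sum.elim η η' i * r)) (h2 r hr) (h2' r hr)

lemma ExpSer.smul {D : ℝ} {g : ℝ → ℂ} (hg : ExpSer D g) (a : ℂ) : ExpSer D (fun r => a * g r) := by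
  obtain ⟨ι, hι, c, η, h1, h2⟩ := hg
  refine ⟨ι, hι, fun i => a * c i, η, ?_, fun r hr => ?_⟩
  · simpa only [norm_mul, mul_assoc] using h1.mul_left ‖a‖
  · simpa only [mul_assoc] using (h2 r hr).mul_left a

lemma ExpSer.congr {D : ℝ} {g h : ℝ → ℂ} (hg : ExpSer D g) (hh : ∀ r, |r| ≤ D → g r = h r) : ExpSer D h := by
  obtain ⟨ι, hι, c, η, h1, h2⟩ := hg
  exact ⟨ι, hι, c, η, h1, fun r hr => hh r hr ▸ h2 r hr⟩

lemma ExpSer.shift {D D' t : ℝ} {g : ℝ → ℂ} (hg : ExpSer D g) (hD : ∀ r, |r| ≤ D' → |r + t| ≤ D) :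
    ExpSer D' (fun r => g (r + t)) := by
  obtain ⟨ι, hι, c, η, h1, h2⟩ := hg
  refine ⟨ι, hι, fun i => c i * ex (η i * t), η, ?_, fun r hr => ?_⟩
  · simpa only [norm_mul, ex_norm, mul_one] using h1
  · have := h2 _ (hD r hr)
    convert this using 1
    ext i; rw [mul_add, ex_add]; ring

lemma ExpSer.one (D : ℝ) : ExpSer D (fun _ => 1) := by
  refine ⟨Unit, inferInstance, fun _ => 1, fun _ => 0, (hasSum_fintype _).summable, fun r _ => ?_⟩
  have := hasSum_fintype (fun _ : Unit => (1:ℂ) * ex (0 * r))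
  simpa [ex_zero] using this

lemma bern (r : ℝ) (hr : |r| ≤ 1) : HasSum (fun n : ℤ => 1 / (n:ℂ)^2 * ex (n * r)) ((2 * Real.pi^2 * (r^2 - |r| + 6⁻¹) : ℝ) : ℂ) := by
  have key : ∀ x : ℝ, x ∈ Set.Icc (0:ℝ) 1 → HasSum (fun n : ℤ => 1 / (n:ℂ)^2 * ex (n * x)) ((2 * Real.pi^2 * (x^2 - x + 6⁻¹) : ℝ) : ℂ) := by
    intro x hx
    have h := hasSum_one_div_pow_mul_fourier_mul_bernoulliFun (k := 2) le_rfl hx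
    convert h using 1
    · ext n
      rw [fourier_coe_apply, ex]
      congr 2; push_cast; ring
    · rw [bernoulliFun_two]
      push_cast
      rw [mul_pow, mul_pow, Complex.I_sq]
      simp only [Nat.factorial]
      push_cast
      ring
  rcases le_total 0 r with h | h
  · rw [abs_of_nonneg h] at hr ⊢; exact key r ⟨h, hr⟩
  · rw [abs_of_nonpos h] at hr ⊢
    have h2 := key (-r) ⟨by linarith, hr⟩
    have h3 := (Equiv.neg ℤ).hasSum_iff.2 h2
    convert h3 using 1
    · ext n; simp
    · congr 2; ring

lemma bern_sum (t : ℝ) (ht : 1 ≤ t) : Summable (fun n : ℤ => ‖1 / (n:ℂ)^2‖ * (1 + |t * n|) ^ (1/2:ℝ)) := by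
  have h := (Real.summable_abs_int_rpow (b := 3/2) (by norm_num)).mul_left ((2 * t)^(1/2:ℝ))
  refine Summable.of_nonneg_of_le (fun n => by positivity) (fun n => ?_) h
  by_cases hn : n = 0
  · simp only [hn]
    simp
  · have h1 : (1:ℝ) ≤ |(n:ℝ)| := by exact_mod_cast Int.one_le_abs hn
    have h0 : (0:ℝ) < |(n:ℝ)| := by linarith
    have e1 : ‖1 / (n:ℂ)^2‖ = |(n:ℝ)|^(-2:ℝ) := by
      rw [norm_div, norm_one, norm_pow, Complex.norm_intCast, Real.rpow_neg h0.le]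
      norm_num
    have e2 : (1 + |t * n|) ^ (1/2:ℝ) ≤ (2 * t)^(1/2:ℝ) * |(n:ℝ)|^(1/2:ℝ) := by
      rw [← Real.mul_rpow (by linarith) h0.le]
      apply Real.rpow_le_rpow (by positivity) _ (by norm_num)
      rw [abs_mul, abs_of_nonneg (by linarith : (0:ℝ) ≤ t)]
      nlinarith
    rw [e1]
    calc _ ≤ |(n:ℝ)|^(-2:ℝ) * ((2 * t)^(1/2:ℝ) * |(n:ℝ)|^(1/2:ℝ)) := by gcongr
      _ = (2 * t)^(1/2:ℝ) * (|(n:ℝ)|^(-2:ℝ) * |(n:ℝ)|^(1/2:ℝ)) := by ring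
      _ = _ := by rw [← Real.rpow_add h0]; norm_num

lemma ExpSer.abs : ExpSer (1/2) (fun r => ((|r| : ℝ) : ℂ)) := by
  have h1 : ExpSer (1/2) (fun r => ((2 * Real.pi^2 * (r^2 - |r| + 6⁻¹) : ℝ) : ℂ)) :=
    ⟨ℤ, inferInstance, fun n => 1 / (n:ℂ)^2, fun n => n, by simpa using bern_sum 1 le_rfl, fun r hr => bern r (by linarith)⟩
  have h2 : ExpSer (1/2) (fun r => ((2 * Real.pi^2 * ((2*r)^2 - |2*r| + 6⁻¹) : ℝ) : ℂ)) :=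
    ⟨ℤ, inferInstance, fun n => 1 / (n:ℂ)^2, fun n => 2 * n, bern_sum 2 (by norm_num), fun r hr => by
      have := bern (2*r) (by rw [abs_mul]; norm_num; linarith)
      convert this using 1
      ext n; congr 2; ring⟩
  refine (((ExpSer.one _).smul (1/4)).add ((h2.add (h1.smul (-4))).smul (1/(4 * Real.pi^2)))).congr fun r hr => ?_
  have : (Real.pi : ℂ) ≠ 0 := by exact_mod_cast Real.pi_ne_zero
  rw [abs_mul, abs_two]
  push_cast
  field_simp
  ring

lemma ExpSer.id : ExpSer (1/4) (fun r => (r : ℂ)) := by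
  have := (ExpSer.abs.shift (t := 1/4) (D' := 1/4) (fun r hr => (abs_add_le _ _).trans (by rw [abs_of_pos (by norm_num : (0:ℝ) < 1/4)]; linarith))).add ((ExpSer.one _).smul (-1/4))
  refine this.congr fun r hr => ?_
  rw [abs_of_nonneg (by linarith [(abs_le.1 hr).1])]
  push_cast; ring

lemma ExpSer.abs' : ExpSer (1/4) (fun r => ((|r| : ℝ) : ℂ)) := by
  have := ExpSer.abs.shift (t := 0) (D' := 1/4) (fun r hr => by rw [add_zero]; linarith)
  simpa using this

noncomputable def sg {N : ℕ} (S : Finset ℤ) (ψ φ : ℝ → ℂ) (g : ℝ → ℂ) (α : Fin N → ℝ) (ξ : Fin (N+1) → ℝ) : ℂ :=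
  ∑ k ∈ S, ψ (((1024:ℝ)^k)⁻¹ * ξ 0) * ((∏ j : Fin N, φ (((1024:ℝ)^k)⁻¹ * ξ j.succ)) * g (∑ j : Fin N, α j * (((1024:ℝ)^k)⁻¹ * ξ j.succ)))

lemma modG {N : ℕ} {p : ℕ → ℝ} (hp : ∀ j ≤ N+1, 1 < p j)
    (hsum : ∑ j ∈ Finset.range (N + 1 + 1), 1 / p j = 1) (hyp : Hyp (N+1) p)
    {ψ : ℝ → ℂ} (hψ : ContDiff ℝ (⊤ : ℕ∞) ψ) (hs : ∀ z, ψ z ≠ 0 → 1/2 ≤ |z| ∧ |z| ≤ 2)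
    {φ : ℝ → ℂ} (hφ : ContDiff ℝ (⊤ : ℕ∞) φ) {δ : ℝ} (hδ : δ ≤ 1) (hNδ : N * δ ≤ 1/4) (hφs : ∀ z, φ z ≠ 0 → |z| ≤ δ)
    {g : ℝ → ℂ} (hg : ExpSer (1/4) g) :
    ∃ C : ℝ, 0 ≤ C ∧ ∀ (S : Finset ℤ) (α : Fin N → ℝ), (∀ j, |α j| ≤ 1) → Bd (N+1) p C (sg S ψ φ g α) := by
  have hφs1 : ∀ z, φ z ≠ 0 → |z| ≤ 1 := fun z hz => (hφs z hz).trans hδ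
  obtain ⟨C, hC, h⟩ := modPhi hp hsum hyp hψ hs hφ hφs1
  obtain ⟨M, hM0, hM⟩ := bdd_of hψ.continuous fun z hz => (hs z hz).2
  obtain ⟨M', hM0', hM'⟩ := bdd_of hφ.continuous fun z hz => (hφs1 z hz).trans (by norm_num)
  obtain ⟨ι, hι, c, η, h1, h2⟩ := hg
  have hc : Summable (fun i => ‖c i‖) := by
    refine Summable.of_nonneg_of_le (fun i => norm_nonneg _) (fun i => ?_) h1
    exact le_mul_of_one_le_right (norm_nonneg _) (Real.one_le_rpow (by linarith [abs_nonneg (η i)]) (by norm_num))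
  refine ⟨(∑' i, ‖c i‖ * (1 + |η i|)^(1/2:ℝ)) * C, mul_nonneg (tsum_nonneg fun i => by positivity) hC, ?_⟩
  intro S α hα
  letI : MeasurableSpace ι := ⊤
  haveI : MeasurableSingletonClass ι := ⟨fun _ => trivial⟩
  let m : ι → (Fin (N+1) → ℝ) → ℂ := fun i ξ => c i * sy S ψ (fun j x => φ x * ex (η i * α j * x)) ξ
  have hmb : ∀ i ξ, ‖m i ξ‖ ≤ ‖c i‖ * (M * M'^N) := by
    intro i ξ
    simp only [m, norm_mul]
    gcongr
    refine sy_bdd S hM (fun z hz => ?_) (fun j z => ?_) _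
    · have := hs z hz; constructor <;> linarith
    · rw [norm_mul, ex_norm, mul_one]; exact hM' _
  have hmm : Measurable (Function.uncurry m) := by
    refine measurable_from_prod_countable_right fun i => ?_
    have hcont : Continuous (sy S ψ (fun j x => φ x * ex (η i * α j * x))) := sy_cont S hψ.continuous fun j => by
      have := ex_cont
      have := hφ.continuous
      fun_prop
    have h3 : Measurable (m i) := hcont.measurable.const_mul (c i)
    exact h3
  have hIA : Integrable (fun i => ‖c i‖ * (M * M'^N)) Measure.count := by
    rw [integrable_count_iff]; exact (hc.mul_right _).norm
  have hIC : Integrable (fun i => (‖c i‖ * (1 + |η i|)^(1/2:ℝ)) * C) Measure.count := by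
    rw [integrable_count_iff]; exact (h1.mul_right _).norm
  have hBd : ∀ i, Bd (N+1) p ((‖c i‖ * (1 + |η i|)^(1/2:ℝ)) * C) (m i) := fun i =>
    ((h S (η i) α hα).smul (c i)).mono (le_of_eq (by ring))
  have key := Bd.avg hmm hmb hIA hIC hBd
  have e1 : ∫ i, (‖c i‖ * (1 + |η i|)^(1/2:ℝ)) * C ∂(Measure.count : Measure ι) = (∑' i, ‖c i‖ * (1 + |η i|)^(1/2:ℝ)) * C := by
    rw [integral_countable hIC, ← tsum_mul_right]; simp
  rw [e1] at key
  convert key using 1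
  ext ξ
  have hI : Integrable (fun i => m i ξ) Measure.count := by
    rw [integrable_count_iff]
    exact Summable.of_nonneg_of_le (fun i => norm_nonneg _) (fun i => hmb i ξ) (hc.mul_right _)
  rw [integral_countable hI]
  simp only [Measure.real, Measure.count_singleton, ENNReal.toReal_one, one_smul]
  symm
  apply HasSum.tsum_eq
  simp only [m, sy, sg, Finset.mul_sum]
  refine hasSum_sum fun k _ => ?_
  by_cases h0 : ∏ j : Fin N, φ (((1024:ℝ)^k)⁻¹ * ξ j.succ) = 0
  · rw [h0]
    simp only [Finset.prod_mul_distrib, h0, zero_mul, mul_zero]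
    exact hasSum_zero
  · have hx : ∀ j : Fin N, |((1024:ℝ)^k)⁻¹ * ξ j.succ| ≤ δ := fun j =>
      hφs _ (Finset.prod_ne_zero_iff.1 h0 j (Finset.mem_univ _))
    have hr : |∑ j : Fin N, α j * (((1024:ℝ)^k)⁻¹ * ξ j.succ)| ≤ 1/4 := by
      refine (Finset.abs_sum_le_sum_abs _ _).trans (le_trans (Finset.sum_le_sum (g := fun _ => δ) fun j _ => ?_) ?_)
      · rw [abs_mul]
        exact (mul_le_of_le_one_left (abs_nonneg _) (hα j)).trans (hx j)
      · simpa using hNδ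
    have := (h2 _ hr).mul_left (ψ (((1024:ℝ)^k)⁻¹ * ξ 0) * ∏ j : Fin N, φ (((1024:ℝ)^k)⁻¹ * ξ j.succ))
    rw [← mul_assoc]
    refine Eq.mp (congrArg (fun f : ι → ℂ => HasSum f _) (funext fun i => ?_)) this
    rw [Finset.mul_sum, ex_sum, Finset.prod_mul_distrib]
    have : ∀ j : Fin N, η i * α j * (((1024:ℝ)^k)⁻¹ * ξ j.succ) = η i * (α j * (((1024:ℝ)^k)⁻¹ * ξ j.succ)) := fun j => by ring
    simp_rw [this]; ring

lemma sign_meas : Measurable Real.sign := by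
  have : Real.sign = fun r : ℝ => if r < 0 then -1 else if 0 < r then 1 else 0 := by ext r; rfl
  rw [this]
  exact Measurable.ite measurableSet_Iio measurable_const (Measurable.ite measurableSet_Ioi measurable_const measurable_const)

lemma sign_bdd (r : ℝ) : ‖Real.sign r‖ ≤ 1 := by
  rcases Real.sign_apply_eq r with h | h | h <;> rw [h] <;> norm_num

lemma sign_int1 (x r : ℝ) (hx : x ≠ 0) (hr : |r| ≤ |x|) :
    ∫ a in Set.Icc (0:ℝ) 1, Real.sign (a * x + r) = Real.sign x + r / |x| - |r| / x := by
  rw [integral_Icc_eq_integral_Ioc, ← intervalIntegral.integral_of_le zero_le_one]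
  have hI : IntervalIntegrable (fun a => Real.sign (a * x + r)) volume 0 1 := by
    rw [intervalIntegrable_iff]
    refine Measure.integrableOn_of_bounded (M := 1) (by simp) ?_ (Filter.Eventually.of_forall fun a => sign_bdd _)
    exact (sign_meas.comp (by fun_prop)).aestronglyMeasurable
  rw [MeasureTheory.integral_eq_of_hasDerivAt_off_countable (fun a => |a * x + r| / x) _ (s := {-r / x}) (Set.countable_singleton _) (by fun_prop) ?_ hI]
  · simp only [one_mul, zero_mul, zero_add]
    rcases lt_or_gt_of_ne hx with h | h
    · rw [abs_of_neg h] at hr ⊢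
      rw [Real.sign_of_neg h, abs_of_nonpos (by linarith [(abs_le.1 hr).2] : x + r ≤ 0)]
      field_simp
      ring
    · rw [abs_of_pos h] at hr ⊢
      rw [Real.sign_of_pos h, abs_of_nonneg (by linarith [(abs_le.1 hr).1] : 0 ≤ x + r)]
      field_simp
  · intro a ha
    have hne : a * x + r ≠ 0 := by
      intro h
      apply ha.2
      rw [Set.mem_singleton_iff, eq_div_iff hx]; linarith
    have h1 : HasDerivAt (fun a => a * x + r) x a := by
      simpa using ((hasDerivAt_id a).mul_const x).add_const r
    have h2 := ((hasDerivAt_abs hne).comp a h1).div_const x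
    have e : ((SignType.sign (a * x + r) : SignType) : ℝ) * x / x = Real.sign (a * x + r) := by
      rw [mul_div_cancel_right₀ _ hx]
      rcases lt_or_gt_of_ne hne with h | h
      · rw [Real.sign_of_neg h, sign_neg h]; simp
      · rw [Real.sign_of_pos h, sign_pos h]; simp
    rw [e] at h2
    exact h2

noncomputable def rr {d : ℕ} (a : Fin d → ℝ) (x : Fin (d+2) → ℝ) : ℝ :=
  (∑ j : Fin d, a j * x j.castSucc.succ) + x (Fin.last (d+1))

abbrev cube (d : ℕ) : Set (Fin d → ℝ) := Set.univ.pi fun _ : Fin d => Set.Icc (0:ℝ) 1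

lemma cube_meas (d : ℕ) : MeasurableSet (cube d) := MeasurableSet.univ_pi fun _ => measurableSet_Icc
lemma cube_vol (d : ℕ) : volume (cube d) = 1 := by
  rw [cube, volume_pi_pi]; simp

lemma rr_bd {d : ℕ} {a : Fin d → ℝ} (ha : a ∈ cube d) (x : Fin (d+2) → ℝ) : |rr a x| ≤ ∑ j : Fin (d+1), |x j.succ| := by
  rw [Fin.sum_univ_castSucc]
  refine (abs_add_le _ _).trans (add_le_add ((Finset.abs_sum_le_sum_abs _ _).trans (Finset.sum_le_sum fun j _ => ?_)) le_rfl)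
  rw [abs_mul]
  have := ha j (Set.mem_univ _)
  rw [abs_of_nonneg this.1]
  exact mul_le_of_le_one_left (abs_nonneg _) this.2

lemma mu_formula {d : ℕ} (x : Fin (d+2) → ℝ) (h0 : x 0 ≠ 0) (hx : ∑ j : Fin (d+1), |x j.succ| ≤ |x 0|) :
    muSymbol (d+1) x = ∫ a in cube d, (Real.sign (x 0) + rr a x / |x 0| - |rr a x| / x 0) := by
  have hmp := volume_preserving_piFinSuccAbove (fun _ : Fin (d+1) => ℝ) 0
  have e1 : (MeasurableEquiv.piFinSuccAbove (fun _ : Fin (d+1) => ℝ) 0) ⁻¹' (Set.Icc (0:ℝ) 1 ×ˢ cube d) = cube (d+1) := by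
    ext a
    simp only [Set.mem_preimage, Set.mem_prod, cube, Set.mem_univ_pi, MeasurableEquiv.piFinSuccAbove_apply, Fin.forall_fin_succ (n := d)]
    rfl
  let f : ℝ × (Fin d → ℝ) → ℝ := fun q => Real.sign (q.1 * x 0 + rr q.2 x)
  have hf : Measurable f := by
    refine sign_meas.comp ?_
    unfold rr
    fun_prop
  have e2 : muSymbol (d+1) x = ∫ q in Set.Icc (0:ℝ) 1 ×ˢ cube d, f q := by
    rw [← hmp.setIntegral_preimage_emb (MeasurableEquiv.measurableEmbedding _), e1, muSymbol]
    congr 1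
    ext a
    simp only [f, rr, MeasurableEquiv.piFinSuccAbove_apply]
    rw [Fin.sum_univ_succ, add_assoc]
    rfl
  rw [e2, Measure.volume_eq_prod, ← Measure.prod_restrict, integral_prod_symm]
  · refine setIntegral_congr_fun (cube_meas d) fun a ha => ?_
    exact sign_int1 _ _ h0 ((rr_bd ha x).trans hx)
  · rw [Measure.prod_restrict]
    refine Measure.integrableOn_of_bounded (M := 1) ?_ hf.aestronglyMeasurable (Filter.Eventually.of_forall fun a => sign_bdd _)
    rw [Measure.prod_prod, cube_vol]; simp

lemma mu_hom {m : ℕ} (x : Fin (m+1) → ℝ) {c : ℝ} (hc : 0 < c) : muSymbol m (fun j => c * x j) = muSymbol m x := by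
  unfold muSymbol
  congr 1
  ext a
  have : (∑ j : Fin m, a j * (c * x j.castSucc)) + c * x (Fin.last m) = c * ((∑ j : Fin m, a j * x j.castSucc) + x (Fin.last m)) := by
    rw [mul_add, Finset.mul_sum]; congr 1; exact Finset.sum_congr rfl fun j _ => by ring
  rw [this]
  set t := (∑ j : Fin m, a j * x j.castSucc) + x (Fin.last m)
  rcases lt_trichotomy t 0 with h | h | h
  · rw [Real.sign_of_neg h, Real.sign_of_neg (mul_neg_of_pos_of_neg hc h)]
  · rw [h, mul_zero]
  · rw [Real.sign_of_pos h, Real.sign_of_pos (mul_pos hc h)]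

lemma rr_sg {d : ℕ} (a : Fin d → ℝ) (x : Fin (d+2) → ℝ) :
    rr a x = ∑ j : Fin (d+1), (Fin.snoc (α := fun _ => ℝ) a 1 : Fin (d+1) → ℝ) j * x j.succ := by
  rw [Fin.sum_univ_castSucc]
  simp [rr]

lemma sg_bdd {N : ℕ} (S : Finset ℤ) {ψ φ g : ℝ → ℂ} {M M' δ : ℝ} (hM : ∀ z, ‖ψ z‖ ≤ M) (hM' : ∀ z, ‖φ z‖ ≤ M')
    (hNδ : N * δ ≤ 1/4) (hφs : ∀ z, φ z ≠ 0 → |z| ≤ δ) (hg : ∀ r, |r| ≤ 1/4 → ‖g r‖ ≤ 1)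
    {α : Fin N → ℝ} (hα : ∀ j, |α j| ≤ 1) (ξ) : ‖sg S ψ φ g α ξ‖ ≤ ∑ k ∈ S, M * M'^N := by
  have hM0 : 0 ≤ M := (norm_nonneg _).trans (hM 0)
  have hM0' : 0 ≤ M' := (norm_nonneg _).trans (hM' 0)
  unfold sg
  refine (norm_sum_le _ _).trans (Finset.sum_le_sum fun k _ => ?_)
  by_cases h0 : ∏ j : Fin N, φ (((1024:ℝ)^k)⁻¹ * ξ j.succ) = 0
  · rw [h0]; simp; positivity
  · have hx : ∀ j : Fin N, |((1024:ℝ)^k)⁻¹ * ξ j.succ| ≤ δ := fun j =>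
      hφs _ (Finset.prod_ne_zero_iff.1 h0 j (Finset.mem_univ _))
    have hr : |∑ j : Fin N, α j * (((1024:ℝ)^k)⁻¹ * ξ j.succ)| ≤ 1/4 := by
      refine (Finset.abs_sum_le_sum_abs _ _).trans (le_trans (Finset.sum_le_sum (g := fun _ => δ) fun j _ => ?_) ?_)
      · rw [abs_mul]
        exact (mul_le_of_le_one_left (abs_nonneg _) (hα j)).trans (hx j)
      · simpa using hNδ
    rw [norm_mul, norm_mul, norm_prod]
    have h1 : ∏ j : Fin N, ‖φ (((1024:ℝ)^k)⁻¹ * ξ j.succ)‖ ≤ M'^N := by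
      calc _ ≤ ∏ j : Fin N, M' := Finset.prod_le_prod (fun _ _ => norm_nonneg _) fun j _ => hM' _
        _ = _ := by simp
    refine mul_le_mul (hM _) ?_ (by positivity) hM0
    calc _ ≤ M'^N * 1 := mul_le_mul h1 (hg _ hr) (norm_nonneg _) (by positivity)
      _ = _ := mul_one _

def clp {d : ℕ} (a : Fin d → ℝ) : Fin (d+1) → ℝ := Fin.snoc (α := fun _ => ℝ) (fun j => max 0 (min 1 (a j))) 1

lemma clp_le {d : ℕ} (a : Fin d → ℝ) (j : Fin (d+1)) : |clp a j| ≤ 1 := by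
  refine Fin.lastCases ?_ (fun j => ?_) j
  · simp [clp]
  · simp only [clp, Fin.snoc_castSucc]
    rw [abs_of_nonneg (le_max_left _ _)]
    exact max_le zero_le_one (min_le_left _ _)

lemma clp_cont {d : ℕ} (j : Fin (d+1)) : Continuous (fun a : Fin d → ℝ => clp a j) := by
  refine Fin.lastCases ?_ (fun j => ?_) j
  · simp only [clp, Fin.snoc_last]; fun_prop
  · simp only [clp, Fin.snoc_castSucc]; fun_prop

lemma clp_rr {d : ℕ} {a : Fin d → ℝ} (ha : a ∈ cube d) (x : Fin (d+2) → ℝ) :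
    rr a x = ∑ j : Fin (d+1), clp a j * x j.succ := by
  rw [rr_sg]
  have : (fun j => max 0 (min 1 (a j))) = a := by
    ext j
    have := ha j (Set.mem_univ _)
    rw [min_eq_right this.2, max_eq_right this.1]
  rw [clp, this]

lemma sg_cont {d : ℕ} (S : Finset ℤ) {ψ φ g : ℝ → ℂ} (hψ : Continuous ψ) (hφ : Continuous φ) (hg : Continuous g) :
    Continuous (fun q : (Fin d → ℝ) × (Fin (d+2) → ℝ) => sg S ψ φ g (clp q.1) q.2) := by
  unfold sg
  refine continuous_finsetSum _ fun k _ => (hψ.comp (by fun_prop)).mul (Continuous.mul ?_ (hg.comp ?_))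
  · exact continuous_finsetProd _ fun j _ => hφ.comp (by fun_prop)
  · refine continuous_finsetSum _ fun j _ => ?_
    have := (clp_cont (d := d) j).comp (continuous_fst (X := Fin d → ℝ) (Y := Fin (d+2) → ℝ))
    exact this.mul (by fun_prop)

lemma Bd.add {n : ℕ} {p : ℕ → ℝ} {C C' : ℝ} {m m' : (Fin n → ℝ) → ℂ} (hm : Measurable m) (hm' : Measurable m')
    {M M' : ℝ} (hM : ∀ ξ, ‖m ξ‖ ≤ M) (hM' : ∀ ξ, ‖m' ξ‖ ≤ M') (h : Bd n p C m) (h' : Bd n p C' m') :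
    Bd n p (C + C') (fun ξ => m ξ + m' ξ) := by
  intro F
  rw [formM_eq]
  simp_rw [mul_add]
  rw [integral_add (kerm_int F hm hM) (kerm_int F hm' hM'), add_mul]
  exact (norm_add_le _ _).trans (add_le_add (h F) (h' F))

lemma smooth_mul {ψ : ℝ → ℂ} (hψ : ContDiff ℝ (⊤ : ℕ∞) ψ) (hs : ∀ z, ψ z ≠ 0 → 1/2 ≤ |z| ∧ |z| ≤ 2)
    {h : ℝ → ℝ} (hh : ∀ z ≠ 0, ContDiffAt ℝ (⊤ : ℕ∞) h z) : ContDiff ℝ (⊤ : ℕ∞) (fun z => ψ z * (h z : ℂ)) := by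
  rw [contDiff_iff_contDiffAt]
  intro z
  by_cases hz : z = 0
  · subst hz
    have : (fun z => ψ z * (h z : ℂ)) =ᶠ[nhds 0] fun _ => 0 := by
      filter_upwards [Metric.ball_mem_nhds (0:ℝ) (by norm_num : (0:ℝ) < 1/2)] with z hz
      have : ψ z = 0 := by
        by_contra h0
        have := (hs z h0).1
        rw [Metric.mem_ball, Real.dist_eq, sub_zero] at hz
        linarith
      rw [this, zero_mul]
    exact contDiffAt_const.congr_of_eventuallyEq this
  · exact hψ.contDiffAt.mul (Complex.ofRealCLM.contDiff.contDiffAt.comp z (hh z hz))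

lemma smooth_inv_abs (z : ℝ) (hz : z ≠ 0) : ContDiffAt ℝ (⊤ : ℕ∞) (fun z : ℝ => |z|⁻¹) z :=
  (contDiffAt_abs hz).inv (abs_ne_zero.2 hz)

lemma mu_meas (m : ℕ) : Measurable (muSymbol m) := by
  have : StronglyMeasurable (Function.uncurry fun (ξ : Fin (m+1) → ℝ) (α : Fin m → ℝ) => Real.sign ((∑ j : Fin m, α j * ξ j.castSucc) + ξ (Fin.last m))) := by
    refine Measurable.stronglyMeasurable (sign_meas.comp (f := fun q : (Fin (m+1) → ℝ) × (Fin m → ℝ) => (∑ j : Fin m, q.2 j * q.1 j.castSucc) + q.1 (Fin.last m)) ?_)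
    fun_prop
  exact (this.integral_prod_right (ν := volume.restrict (Set.univ.pi fun _ : Fin m => Set.Icc (0:ℝ) 1))).measurable

lemma mu_bdd (m : ℕ) (ξ) : |muSymbol m ξ| ≤ 1 := by
  have := norm_setIntegral_le_of_norm_le_const (μ := volume) (s := cube m) (C := 1) (f := fun α : Fin m → ℝ => Real.sign ((∑ j : Fin m, α j * ξ j.castSucc) + ξ (Fin.last m))) (by rw [cube_vol]; simp) (fun x _ => sign_bdd _)
  rw [Measure.real, cube_vol, ENNReal.toReal_one, mul_one] at this
  exact this

set_option maxHeartbeats 1000000 in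
lemma muS {d : ℕ} {p : ℕ → ℝ} (hp : ∀ j ≤ d+2, 1 < p j)
    (hsum : ∑ j ∈ Finset.range (d + 3), 1 / p j = 1) (hyp : Hyp (d+2) p)
    {ψ : ℝ → ℂ} (hψ : ContDiff ℝ (⊤ : ℕ∞) ψ) (hs : ∀ z, ψ z ≠ 0 → 1/2 ≤ |z| ∧ |z| ≤ 2)
    {φ : ℝ → ℂ} (hφ : ContDiff ℝ (⊤ : ℕ∞) φ) {δ : ℝ} (hδ : δ ≤ 1) (hNδ : (d+1:ℕ) * δ ≤ 1/4) (hφs : ∀ z, φ z ≠ 0 → |z| ≤ δ) :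
    ∃ C : ℝ, 0 ≤ C ∧ ∀ (S : Finset ℤ), Bd (d+2) p C (fun ξ => (muSymbol (d+1) ξ : ℂ) * sy S ψ (fun _ : Fin (d+1) => φ) ξ) := by
  have sup : ∀ (h : ℝ → ℝ) (z : ℝ), ψ z * (h z : ℂ) ≠ 0 → 1/2 ≤ |z| ∧ |z| ≤ 2 := fun h z hz => hs z (left_ne_zero_of_mul hz)
  have hψa := smooth_mul hψ hs (h := fun z => z * |z|⁻¹) fun z hz => contDiffAt_id.mul (smooth_inv_abs z hz)
  have hψb := smooth_mul hψ hs (h := fun z => |z|⁻¹) smooth_inv_abs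
  have hψc := smooth_mul hψ hs (h := fun z => -z⁻¹) fun z hz => (contDiffAt_inv ℝ hz).neg
  obtain ⟨Ca, hCa, ha⟩ := modG (N := d+1) hp hsum hyp hψa (sup _) hφ hδ hNδ hφs (ExpSer.one (1/4))
  obtain ⟨Cb, hCb, hb⟩ := modG (N := d+1) hp hsum hyp hψb (sup _) hφ hδ hNδ hφs ExpSer.id
  obtain ⟨Cc, hCc, hc⟩ := modG (N := d+1) hp hsum hyp hψc (sup _) hφ hδ hNδ hφs ExpSer.abs'
  obtain ⟨Ma, -, hMa⟩ := bdd_of hψa.continuous fun z hz => (hs z (left_ne_zero_of_mul hz)).2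
  obtain ⟨Mb, -, hMb⟩ := bdd_of hψb.continuous fun z hz => (hs z (left_ne_zero_of_mul hz)).2
  obtain ⟨Mc, -, hMc⟩ := bdd_of hψc.continuous fun z hz => (hs z (left_ne_zero_of_mul hz)).2
  obtain ⟨M', hM0', hM'⟩ := bdd_of hφ.continuous fun z hz => ((hφs z hz).trans hδ).trans (by norm_num)
  refine ⟨(Ca + Cb) + Cc, by positivity, fun S => ?_⟩
  let ma : (Fin d → ℝ) → (Fin (d+2) → ℝ) → ℂ := fun a ξ => sg S (fun z => ψ z * ((z * |z|⁻¹ : ℝ) : ℂ)) φ (fun _ => 1) (clp a) ξ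
  let mb : (Fin d → ℝ) → (Fin (d+2) → ℝ) → ℂ := fun a ξ => sg S (fun z => ψ z * ((|z|⁻¹ : ℝ) : ℂ)) φ (fun r => (r : ℂ)) (clp a) ξ
  let mc : (Fin d → ℝ) → (Fin (d+2) → ℝ) → ℂ := fun a ξ => sg S (fun z => ψ z * ((-z⁻¹ : ℝ) : ℂ)) φ (fun r => ((|r| : ℝ) : ℂ)) (clp a) ξ
  have ca : Continuous (Function.uncurry ma) := sg_cont S hψa.continuous hφ.continuous continuous_const
  have cb : Continuous (Function.uncurry mb) := sg_cont S hψb.continuous hφ.continuous Complex.continuous_ofReal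
  have cc : Continuous (Function.uncurry mc) := sg_cont S hψc.continuous hφ.continuous (Complex.continuous_ofReal.comp continuous_abs)
  have ba : ∀ a ξ, ‖ma a ξ‖ ≤ ∑ k ∈ S, Ma * M'^(d+1) := fun a ξ =>
    sg_bdd S hMa hM' hNδ hφs (fun r _ => by simp) (clp_le a) ξ
  have bb : ∀ a ξ, ‖mb a ξ‖ ≤ ∑ k ∈ S, Mb * M'^(d+1) := fun a ξ =>
    sg_bdd S hMb hM' hNδ hφs (fun r hr => by rw [Complex.norm_real, Real.norm_eq_abs]; linarith) (clp_le a) ξ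
  have bc : ∀ a ξ, ‖mc a ξ‖ ≤ ∑ k ∈ S, Mc * M'^(d+1) := fun a ξ =>
    sg_bdd S hMc hM' hNδ hφs (fun r hr => by rw [Complex.norm_real, Real.norm_eq_abs, abs_abs]; linarith) (clp_le a) ξ
  let m : (Fin d → ℝ) → (Fin (d+2) → ℝ) → ℂ := fun a ξ => (ma a ξ + mb a ξ) + mc a ξ
  have hm : Measurable (Function.uncurry m) := ((ca.add cb).add cc).measurable
  have sl : ∀ {f : (Fin d → ℝ) → (Fin (d+2) → ℝ) → ℂ}, Continuous (Function.uncurry f) → ∀ a, Measurable (f a) := fun hf a =>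
    (hf.comp (Continuous.prodMk_right a)).measurable
  have bab : ∀ a ξ, ‖ma a ξ + mb a ξ‖ ≤ (∑ k ∈ S, Ma * M'^(d+1)) + ∑ k ∈ S, Mb * M'^(d+1) := fun a ξ =>
    (norm_add_le _ _).trans (add_le_add (ba a ξ) (bb a ξ))
  have hmb : ∀ a ξ, ‖m a ξ‖ ≤ ((∑ k ∈ S, Ma * M'^(d+1)) + ∑ k ∈ S, Mb * M'^(d+1)) + ∑ k ∈ S, Mc * M'^(d+1) := fun a ξ =>
    (norm_add_le _ _).trans (add_le_add (bab a ξ) (bc a ξ))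
  have hBd : ∀ a, Bd (d+2) p ((Ca + Cb) + Cc) (m a) := by
    intro a
    have h1 : Bd (d+2) p Ca (ma a) := ha S (clp a) (clp_le a)
    have h2 : Bd (d+2) p Cb (mb a) := hb S (clp a) (clp_le a)
    have h3 : Bd (d+2) p Cc (mc a) := hc S (clp a) (clp_le a)
    have h4 := Bd.add (sl ca a) (sl cb a) (ba a) (bb a) h1 h2
    exact Bd.add ((sl ca a).add (sl cb a)) (sl cc a) (bab a) (bc a) h4 h3
  have hfin : IsFiniteMeasure (volume.restrict (cube d)) := ⟨by rw [Measure.restrict_apply_univ, cube_vol]; simp⟩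
  have key := Bd.avg (ν := volume.restrict (cube d)) hm hmb (integrable_const _) (integrable_const _) hBd
  have e1 : ∫ _ in cube d, ((Ca + Cb) + Cc) = (Ca + Cb) + Cc := by
    rw [setIntegral_const, Measure.real, cube_vol]; simp
  rw [e1] at key
  convert key using 1
  ext ξ
  let t : ℤ → (Fin d → ℝ) → ℂ := fun k a => 
    ((ψ (((1024:ℝ)^k)⁻¹ * ξ 0) * ∏ j : Fin (d+1), φ (((1024:ℝ)^k)⁻¹ * ξ j.succ))) *
    ((((((1024:ℝ)^k)⁻¹ * ξ 0) * |((1024:ℝ)^k)⁻¹ * ξ 0|⁻¹ : ℝ) : ℂ) +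
     ((|((1024:ℝ)^k)⁻¹ * ξ 0|⁻¹ : ℝ) : ℂ) * ((∑ j : Fin (d+1), clp a j * (((1024:ℝ)^k)⁻¹ * ξ j.succ) : ℝ) : ℂ) +
      ((-(((1024:ℝ)^k)⁻¹ * ξ 0)⁻¹ : ℝ) : ℂ) * ((|∑ j : Fin (d+1), clp a j * (((1024:ℝ)^k)⁻¹ * ξ j.succ)| : ℝ) : ℂ))
  have et : ∀ a, m a ξ = ∑ k ∈ S, t k a := by
    intro a
    simp only [m, ma, mb, mc, sg, t]
    rw [← Finset.sum_add_distrib, ← Finset.sum_add_distrib]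
    exact Finset.sum_congr rfl fun k _ => by ring
  simp_rw [et]
  have tc : ∀ k, Continuous (t k) := by
    intro k
    have := clp_cont (d := d)
    simp only [t]
    fun_prop
  rw [integral_finsetSum]
  · rw [sy, Finset.mul_sum]
    refine Finset.sum_congr rfl fun k _ => ?_
    set x : Fin (d+2) → ℝ := fun j => ((1024:ℝ)^k)⁻¹ * ξ j with hx
    have hpos : (0:ℝ) < ((1024:ℝ)^k)⁻¹ := by positivity
    rw [← mu_hom ξ hpos]
    simp only [t]
    rw [integral_const_mul, mul_comm]
    by_cases hz : ψ (((1024:ℝ)^k)⁻¹ * ξ 0) * ∏ j : Fin (d+1), φ (((1024:ℝ)^k)⁻¹ * ξ j.succ) = 0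
    · rw [hz, zero_mul, zero_mul]
    congr 1
    have h0 := (hs _ (left_ne_zero_of_mul hz)).1
    have hx0 : x 0 ≠ 0 := by
      intro h; simp only [hx] at h; rw [h, abs_zero] at h0; norm_num at h0
    have hxj : ∑ j : Fin (d+1), |x j.succ| ≤ |x 0| := by
      have : ∑ j : Fin (d+1), |x j.succ| ≤ ∑ j : Fin (d+1), δ := Finset.sum_le_sum fun j _ =>
        hφs _ (Finset.prod_ne_zero_iff.1 (right_ne_zero_of_mul hz) j (Finset.mem_univ _))
      refine this.trans ?_
      rw [Finset.sum_const, Finset.card_univ, Fintype.card_fin, nsmul_eq_mul]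
      have : 1/2 ≤ |x 0| := h0
      linarith
    rw [mu_formula x hx0 hxj, ← integral_complex_ofReal]
    refine setIntegral_congr_fun (cube_meas d) fun a ha => ?_
    have hsg : Real.sign (x 0) = x 0 * |x 0|⁻¹ := by
      rcases lt_or_gt_of_ne hx0 with h | h
      · rw [Real.sign_of_neg h, abs_of_neg h]; field_simp
      · rw [Real.sign_of_pos h, abs_of_pos h]; field_simp
    have hrr : ∑ j : Fin (d+1), clp a j * (((1024:ℝ)^k)⁻¹ * ξ j.succ) = rr a x := (clp_rr ha x).symm
    rw [hrr, hsg]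
    push_cast
    simp only [hx]
    push_cast
    ring
  · intro k _
    have : IntegrableOn (t k) (cube d) := (tc k).continuousOn.integrableOn_compact (isCompact_univ_pi fun _ => isCompact_Icc)
    exact this

lemma fin_k (y : ℝ) : {k : ℤ | 1/2 ≤ |(2:ℝ)^(-k) * y| ∧ |(2:ℝ)^(-k) * y| ≤ 2}.Finite := by
  by_cases hy : y = 0
  · subst hy
    have : {k : ℤ | 1/2 ≤ |(2:ℝ)^(-k) * 0| ∧ |(2:ℝ)^(-k) * 0| ≤ 2} = ∅ := by
      ext k; simp
    rw [this]; exact Set.finite_empty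
  · obtain ⟨n, hn⟩ := exists_mem_Ico_zpow (abs_pos.2 hy) (by norm_num : (1:ℝ) < 2)
    refine (Set.finite_Icc (n-1) (n+2)).subset fun k hk => ?_
    obtain ⟨h1, h2⟩ := hk
    have hp : (0:ℝ) < 2^k := by positivity
    have e : |(2:ℝ)^(-k) * y| = |y| / 2^k := by
      rw [abs_mul, abs_of_pos (by positivity), zpow_neg]; field_simp
    rw [e] at h1 h2
    rw [le_div_iff₀ hp] at h1
    rw [div_le_iff₀ hp] at h2
    have h3 : (2:ℝ)^k < 2^(n+2) := by
      have : (2:ℝ)^(n+2) = 2 * 2^(n+1) := by rw [show n+2 = 1 + (n+1) by ring, zpow_add₀ (by norm_num), zpow_one]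
      rw [this]; linarith [hn.2]
    have h4 : (2:ℝ)^n ≤ 2^(k+1) := by
      rw [zpow_add₀ (by norm_num), zpow_one]; linarith [hn.1]
    have h5 := (zpow_lt_zpow_iff_right₀ (by norm_num : (1:ℝ) < 2)).1 h3
    have h6 := (zpow_le_zpow_iff_right₀ (by norm_num : (1:ℝ) < 2)).1 h4
    constructor <;> linarith

lemma ell_bd (d ℓ₀ : ℕ) (h : 100 * Real.log (d + 2) ≤ (ℓ₀ : ℝ)) :
    (2:ℝ) ^ (-(ℓ₀ : ℤ) + 1) ≤ 1 ∧ ((d+1:ℕ):ℝ) * (2:ℝ) ^ (-(ℓ₀ : ℤ) + 1) ≤ 1/4 := by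
  have hl2 : 1/2 < Real.log 2 := by linarith [Real.log_two_gt_d9]
  have hd : Real.log 2 ≤ Real.log (d+2) := Real.log_le_log (by norm_num) (by linarith [(Nat.cast_nonneg d : (0:ℝ) ≤ d)])
  have h1 : (8 * (d+2) : ℝ) ≤ 2^ℓ₀ := by
    rw [← Real.log_le_log_iff (by positivity) (by positivity), Real.log_mul (by norm_num) (by positivity), Real.log_pow, show (8:ℝ) = 2^3 by norm_num, Real.log_pow]
    push_cast
    nlinarith [(Nat.cast_nonneg ℓ₀ : (0:ℝ) ≤ ℓ₀)]
  have e : (2:ℝ) ^ (-(ℓ₀ : ℤ) + 1) = 2 / 2^ℓ₀ := by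
    rw [zpow_add₀ (by norm_num), zpow_neg, zpow_natCast, zpow_one]; field_simp
  have hp : (0:ℝ) < 2^ℓ₀ := by positivity
  have := (Nat.cast_nonneg d : (0:ℝ) ≤ d)
  rw [e]
  constructor
  · rw [div_le_one hp]; linarith
  · rw [← mul_div_assoc, div_le_iff₀ hp]; push_cast; linarith

lemma final {d : ℕ} {p : ℕ → ℝ} (hp : ∀ j ≤ d+2, 1 < p j)
    (hsum : ∑ j ∈ Finset.range (d + 3), 1 / p j = 1) (hyp : Hyp (d+2) p)
    {ψ : ℝ → ℂ} (hψ : ContDiff ℝ (⊤ : ℕ∞) ψ) (hs : ∀ z, ψ z ≠ 0 → 1/2 ≤ |z| ∧ |z| ≤ 2)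
    {φ : ℝ → ℂ} (hφ : ContDiff ℝ (⊤ : ℕ∞) φ) {δ : ℝ} (hδ : δ ≤ 1) (hNδ : (d+1:ℕ) * δ ≤ 1/4) (hφs : ∀ z, φ z ≠ 0 → |z| ≤ δ) :
    ∃ C : ℝ, 0 ≤ C ∧ Bd (d+2) p C (fun ξ => ∑' k : ℤ, (muSymbol (d+1) ξ : ℂ) * ψ ((2:ℝ)^(-k) * ξ 0) * ∏ j : Fin (d+1), φ ((2:ℝ)^(-k) * ξ j.succ)) := by
  obtain ⟨C, hC, h⟩ := muS hp hsum hyp hψ hs hφ hδ hNδ hφs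
  obtain ⟨M, hM0, hM⟩ := bdd_of hψ.continuous fun z hz => (hs z hz).2
  obtain ⟨M', hM0', hM'⟩ := bdd_of hφ.continuous fun z hz => ((hφs z hz).trans hδ).trans (by norm_num)
  let f : (Fin (d+2) → ℝ) → ℤ → ℂ := fun ξ k => (muSymbol (d+1) ξ : ℂ) * ψ ((2:ℝ)^(-k) * ξ 0) * ∏ j : Fin (d+1), φ ((2:ℝ)^(-k) * ξ j.succ)
  have hfin : ∀ ξ, Summable (f ξ) := fun ξ => by
    refine summable_of_finite_support ((fin_k (ξ 0)).subset fun k hk => ?_)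
    exact hs _ (right_ne_zero_of_mul (left_ne_zero_of_mul hk))
  let m : Fin 10 → ℕ → (Fin (d+2) → ℝ) → ℂ := fun ρ K ξ => ∑ q ∈ Finset.Icc (-K:ℤ) K, f ξ (10 * q + ρ)
  have em : ∀ ρ K, m ρ K = fun ξ => (fun ξ => (muSymbol (d+1) ξ : ℂ) * sy (Finset.Icc (-K:ℤ) K) ψ (fun _ : Fin (d+1) => φ) ξ) (fun j => ((2:ℝ)^(ρ:ℕ))⁻¹ * ξ j) := by
    intro ρ K
    ext ξ
    simp only [m, f, sy]
    rw [mu_hom ξ (by positivity : (0:ℝ) < ((2:ℝ)^(ρ:ℕ))⁻¹), Finset.mul_sum]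
    refine Finset.sum_congr rfl fun q _ => ?_
    have e : (2:ℝ)^(-(10 * q + (ρ:ℕ) : ℤ)) = ((1024:ℝ)^q)⁻¹ * ((2:ℝ)^(ρ:ℕ))⁻¹ := by
      rw [neg_add, zpow_add₀ (by norm_num), zpow_neg, zpow_neg, zpow_natCast, zpow_mul]; norm_num
    rw [e, mul_assoc]
    simp only [mul_assoc]
  have hmeas0 : ∀ S : Finset ℤ, Measurable (fun ξ : Fin (d+2) → ℝ => (muSymbol (d+1) ξ : ℂ) * sy S ψ (fun _ : Fin (d+1) => φ) ξ) := fun S =>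
    (Complex.measurable_ofReal.comp (mu_meas (d+1))).mul (sy_cont S hψ.continuous fun _ => hφ.continuous).measurable
  have hbdd0 : ∀ (S : Finset ℤ) (ξ : Fin (d+2) → ℝ), ‖(muSymbol (d+1) ξ : ℂ) * sy S ψ (fun _ : Fin (d+1) => φ) ξ‖ ≤ M * M'^(d+1) := by
    intro S ξ
    rw [norm_mul, Complex.norm_real]
    have h1 := sy_bdd S (A := fun _ : Fin (d+1) => φ) hM (fun z hz => by have := hs z hz; constructor <;> linarith) (fun _ => hM') ξ
    exact (mul_le_of_le_one_left (norm_nonneg _) (mu_bdd _ _)).trans h1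
  have hmeas : ∀ ρ K, Measurable (m ρ K) := fun ρ K => by
    rw [em]; exact (hmeas0 _).comp (by fun_prop)
  have hbdd : ∀ ρ K ξ, ‖m ρ K ξ‖ ≤ M * M'^(d+1) := fun ρ K ξ => by
    rw [em]; exact hbdd0 _ _
  have hBd : ∀ ρ K, Bd (d+2) p C (m ρ K) := fun ρ K => by
    rw [em]
    exact (h (Finset.Icc (-K:ℤ) K)).dil hp hsum (fun _ => ((2:ℝ)^(ρ:ℕ))⁻¹) (fun _ => by positivity)
  let t : ℕ → (Fin (d+2) → ℝ) → ℂ := fun K ξ => ∑ ρ : Fin 10, m ρ K ξ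
  have tBd : ∀ K, Bd (d+2) p (∑ _ρ : Fin 10, C) (t K) := fun K =>
    Bd.sum Finset.univ (fun ρ _ => hmeas ρ K) (fun ρ _ => ⟨_, hbdd ρ K⟩) fun ρ _ => hBd ρ K
  have tmeas : ∀ K, Measurable (t K) := fun K => Finset.measurable_fun_sum _ fun ρ _ => hmeas ρ K
  have tbdd : ∀ K ξ, ‖t K ξ‖ ≤ ∑ _ρ : Fin 10, M * M'^(d+1) := fun K ξ =>
    (norm_sum_le _ _).trans (Finset.sum_le_sum fun ρ _ => hbdd ρ K ξ)
  refine ⟨∑ _ρ : Fin 10, C, Finset.sum_nonneg fun _ _ => hC, Bd.lim tmeas tbdd tBd fun ξ => ?_⟩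
  have hsm : Summable (fun x : Fin 10 × ℤ => f ξ (10 * x.2 + x.1.1)) := by
    refine summable_of_finite_support ?_
    have hf : (Function.support (f ξ)).Finite := (fin_k (ξ 0)).subset fun k hk => hs _ (right_ne_zero_of_mul (left_ne_zero_of_mul hk))
    refine Set.Finite.of_finite_image (f := fun x : Fin 10 × ℤ => 10 * x.2 + (x.1.1:ℤ)) (hf.subset ?_) ?_
    · rintro _ ⟨x, hx, rfl⟩; exact hx
    · rintro ⟨a, b⟩ _ ⟨a', b'⟩ _ hab
      simp only at hab
      have : a.1 = a'.1 ∧ b = b' := by omega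
      exact Prod.ext (Fin.ext this.1) this.2
  have e3 : ∑' k : ℤ, f ξ k = ∑ ρ : Fin 10, ∑' q : ℤ, f ξ (10 * q + ρ.1) := by
    have h1 : ∑' k : ℤ, f ξ k = ∑' x : Fin 10 × ℤ, f ξ (10 * x.2 + x.1.1) := by
      let e : Fin 10 × ℤ ≃ ℤ := (Equiv.prodComm _ _).trans (Int.divModEquiv 10).symm
      rw [← e.tsum_eq]
      refine tsum_congr fun x => ?_
      congr 1
      simp [e, Int.divModEquiv]
      ring
    rw [h1, hsm.tsum_prod, tsum_fintype]
  change Filter.Tendsto (fun K => t K ξ) Filter.atTop (nhds (∑' k : ℤ, f ξ k))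
  rw [e3]
  refine tendsto_finsetSum _ fun ρ _ => ?_
  have h2 : Summable (fun q : ℤ => f ξ (10 * q + ρ.1)) := hsm.comp_injective (i := fun q : ℤ => (ρ, q)) fun a b hab => (Prod.ext_iff.1 hab).2
  exact h2.hasSum.comp (Finset.tendsto_Icc_neg (R := ℤ))

end Aux

/-- **Proposition (the rough `ψ`-`φ` case).** Let `n = d + 2 ≥ 2` and fix exponents
`p₀,…,p_n ∈ (1,∞)` with `∑_j 1/p_j = 1` such that every standard smooth symbol `m'`
satisfies `|Λ_{m'}(F₀,…,F_n)| ≤ c(m') ∏_j ‖F_j‖_{p_j}` for Schwartz functions. Let `ψ` be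
smooth and supported in `[-2,-1/2] ∪ [1/2,2]`, let `ℓ₀ ≥ 100 log n` and let `φ` be smooth
and supported in `[-2^{-ℓ₀+1}, 2^{-ℓ₀+1}]`. Then the form associated with the symbol
`m(ξ) = ∑_{k ∈ ℤ} μ_n(ξ) ψ(2^{-k}ξ₁) φ(2^{-k}ξ₂) ⋯ φ(2^{-k}ξ_n)` satisfies
`|Λ_m(F₀,…,F_n)| ≤ c ∏_j ‖F_j‖_{p_j}` for some finite `c` and all Schwartz `F_j`. -/
theorem rough_psi_phi_case_bound
    (d : ℕ) (p : ℕ → ℝ) (hp : ∀ j ≤ d + 2, 1 < p j)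
    (hsum : ∑ j ∈ Finset.range (d + 3), 1 / p j = 1)
    (hyp : ∀ m' : (Fin (d + 2) → ℝ) → ℂ, IsStandardSymbol (d + 2) m' →
      ∃ c : ℝ, 0 < c ∧
        ∀ F : ℕ → SchwartzMap (Fin (d + 2) → ℝ) ℂ,
          ‖formM (d + 2) m' (fun j => ⇑(F j))‖ ≤
            c * ∏ j ∈ Finset.range (d + 3),
              (eLpNorm (⇑(F j)) (ENNReal.ofReal (p j)) volume).toReal)
    (ψ φ : ℝ → ℝ) (ℓ₀ : ℕ) (hℓ₀ : 100 * Real.log (d + 2) ≤ (ℓ₀ : ℝ))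
    (hψ : ContDiff ℝ (⊤ : ℕ∞) ψ)
    (hψsupp : tsupport ψ ⊆ Set.Icc (-2 : ℝ) (-(1/2)) ∪ Set.Icc (1/2 : ℝ) 2)
    (hφ : ContDiff ℝ (⊤ : ℕ∞) φ)
    (hφsupp : tsupport φ ⊆
      Set.Icc (-(2:ℝ) ^ (-(ℓ₀ : ℤ) + 1)) ((2:ℝ) ^ (-(ℓ₀ : ℤ) + 1))) :
    ∃ c : ℝ, 0 < c ∧
      ∀ F : ℕ → SchwartzMap (Fin (d + 2) → ℝ) ℂ,
        ‖formM (d + 2)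
            (fun ξ => ((∑' k : ℤ, muSymbol (d + 1) ξ * ψ ((2:ℝ) ^ (-k) * ξ 0) *
              ∏ j : Fin (d + 1), φ ((2:ℝ) ^ (-k) * ξ j.succ) : ℝ) : ℂ))
            (fun j => ⇑(F j))‖ ≤
          c * ∏ j ∈ Finset.range (d + 3),
            (eLpNorm (⇑(F j)) (ENNReal.ofReal (p j)) volume).toReal := by
  obtain ⟨hδ, hNδ⟩ := ell_bd d ℓ₀ hℓ₀
  have hψC : ContDiff ℝ (⊤ : ℕ∞) (fun z => (ψ z : ℂ)) := Complex.ofRealCLM.contDiff.comp hψ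
  have hφC : ContDiff ℝ (⊤ : ℕ∞) (fun z => (φ z : ℂ)) := Complex.ofRealCLM.contDiff.comp hφ
  have hs : ∀ z, (ψ z : ℂ) ≠ 0 → 1/2 ≤ |z| ∧ |z| ≤ 2 := by
    intro z hz
    have hz' : ψ z ≠ 0 := by exact_mod_cast hz
    rcases hψsupp (subset_tsupport _ hz') with h | h
    · have h1 := h.1
      have h2 := h.2
      rw [abs_of_neg (by linarith)]; constructor <;> linarith
    · have h1 := h.1
      have h2 := h.2
      rw [abs_of_pos (by linarith)]; constructor <;> linarith
  have hφs : ∀ z, (φ z : ℂ) ≠ 0 → |z| ≤ (2:ℝ) ^ (-(ℓ₀ : ℤ) + 1) := by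
    intro z hz
    have hz' : φ z ≠ 0 := by exact_mod_cast hz
    have h := hφsupp (subset_tsupport _ hz')
    exact abs_le.2 ⟨h.1, h.2⟩
  have hyp' : Hyp (d+2) p := hyp
  obtain ⟨C, hC, h⟩ := final hp hsum hyp' hψC hs hφC hδ hNδ hφs
  refine ⟨C + 1, by linarith, fun F => ?_⟩
  have h2 := (h.mono (by linarith : C ≤ C + 1)) F
  have e : (fun ξ : Fin (d+2) → ℝ => ((∑' k : ℤ, muSymbol (d + 1) ξ * ψ ((2:ℝ) ^ (-k) * ξ 0) *
              ∏ j : Fin (d + 1), φ ((2:ℝ) ^ (-k) * ξ j.succ) : ℝ) : ℂ)) = fun ξ => ∑' k : ℤ, (muSymbol (d+1) ξ : ℂ) * (ψ ((2:ℝ)^(-k) * ξ 0) : ℂ) * ∏ j : Fin (d+1), (φ ((2:ℝ)^(-k) * ξ j.succ) : ℂ) := by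
    ext ξ
    rw [Complex.ofReal_tsum]
    push_cast
    rfl
  rw [e]
  exact h2
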